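/- Let Ỹ ⊆ ℙ^m be an irreducible projective variety of dimension k, U ⊆ Gr(ℙ^{m−k}, ℙ^m) the open set over which the incidence projection is a deg(Ỹ)-to-1 covering, and L₀ ∈ U a basepoint. Then the monodromy homomorphism π₁(U, L₀) → Sym(L₀ ∩ Ỹ) is surjective. -/

import Mathlib

open MvPolynomial

noncomputable section

instance {m : ℕ} : TopologicalSpace (Projectivization ℂ (Fin (m + 1) → ℂ)) :=
  instTopologicalSpaceQuotient

/-- The projective variety in `ℙ^m` determined by a homogeneous ideal `J`. -/
def projVariety {m : ℕ} (J : Ideal (MvPolynomial (Fin (m + 1)) ℂ)) :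
    Set (Projectivization ℂ (Fin (m + 1) → ℂ)) :=
  {P | ∀ g ∈ J, eval P.rep g = 0}

/-- Membership of a projective point in the linear subspace cut out by the rows of `c`. -/
def memLin {k m : ℕ} (c : Fin k → Fin (m + 1) → ℂ)
    (P : Projectivization ℂ (Fin (m + 1) → ℂ)) : Prop :=
  ∀ i, ∑ j, c i j * P.rep j = 0

/-- The Zariski open subset `U ⊆ Gr(ℙ^{m−k}, ℙ^m)` given by nonvanishing of `D`. -/
def Uopen (k m : ℕ) (D : MvPolynomial (Fin k × Fin (m + 1)) ℂ) : Type :=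
  {c : Fin k → Fin (m + 1) → ℂ // eval (fun ij => c ij.1 ij.2) D ≠ 0}

/-- The part `ρ₁⁻¹(U)` of the incidence variety `Φ = {(L, y) : y ∈ L ∩ Ỹ}` over `U`. -/
def IncidenceU (k m : ℕ) (J : Ideal (MvPolynomial (Fin (m + 1)) ℂ))
    (D : MvPolynomial (Fin k × Fin (m + 1)) ℂ) : Type :=
  {p : (Fin k → Fin (m + 1) → ℂ) × Projectivization ℂ (Fin (m + 1) → ℂ) //
    (p.2 ∈ projVariety J ∧ memLin p.1 p.2) ∧ eval (fun ij => p.1 ij.1 ij.2) D ≠ 0}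

instance (k m : ℕ) (D : MvPolynomial (Fin k × Fin (m + 1)) ℂ) :
    TopologicalSpace (Uopen k m D) := instTopologicalSpaceSubtype

instance (k m : ℕ) (J : Ideal (MvPolynomial (Fin (m + 1)) ℂ))
    (D : MvPolynomial (Fin k × Fin (m + 1)) ℂ) :
    TopologicalSpace (IncidenceU k m J D) := instTopologicalSpaceSubtype

/-- The restriction `ρ₁⁻¹(U) → U` of the first projection. -/
def rho1 (k m : ℕ) (J : Ideal (MvPolynomial (Fin (m + 1)) ℂ))
    (D : MvPolynomial (Fin k × Fin (m + 1)) ℂ) : IncidenceU k m J D → Uopen k m D :=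
  fun x => ⟨x.1.1, x.2.2⟩

lemma Derivation.aeval_mvPolynomial {R A ι : Type*} [CommRing R] [CommRing A] [Algebra R A]
    [Fintype ι] (D : Derivation R A A) (g : ι → A) (p : MvPolynomial ι R) :
    D (aeval g p) =
      ∑ i, aeval g (pderiv i p) * D (g i) := by
  classical
  induction p using induction_on with
  | C a => simp
  | add p q hp hq => simp [hp, hq, add_mul, Finset.sum_add_distrib]
  | mul_X p i hp =>
    simp only [map_mul, aeval_X, Derivation.leibniz, hp, smul_eq_mul, map_add,
      add_mul, Finset.sum_add_distrib, pderiv_X, Finset.mul_sum]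
    congr 1
    · rw [Finset.sum_eq_single i]
      · simp
      · intro j _ hj
        simp [hj.symm]
      · simp
    · exact Finset.sum_congr rfl fun j _ => by ring

/-- The algebraic closure of `ℂ(x)`. -/
abbrev AlgFun : Type := AlgebraicClosure (FractionRing (Polynomial ℂ))

/-- The coordinate function in the algebraic closure of `ℂ(x)`. -/
def AlgFun.x : AlgFun := algebraMap (Polynomial ℂ) AlgFun Polynomial.X

lemma AlgFun.exists_derivation : ∃ D : Derivation ℂ AlgFun AlgFun, D AlgFun.x = 1 := by
  have h1 : Algebra.FormallyEtale (Polynomial ℂ) (FractionRing (Polynomial ℂ)) :=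
    Algebra.FormallyEtale.of_isLocalization (nonZeroDivisors (Polynomial ℂ))
  have h2 : Algebra.FormallyEtale (FractionRing (Polynomial ℂ)) AlgFun :=
    Algebra.FormallyEtale.of_isSeparable _ _
  have h3 : Algebra.FormallyEtale (Polynomial ℂ) AlgFun :=
    Algebra.FormallyEtale.comp _ (FractionRing (Polynomial ℂ)) _
  let e := (KaehlerDifferential.tensorKaehlerEquivOfFormallyEtale ℂ (Polynomial ℂ) AlgFun).symm
  let e2 := (TensorProduct.AlgebraTensorModule.congr (LinearEquiv.refl AlgFun AlgFun)
    (KaehlerDifferential.polynomialEquiv ℂ)).trans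
      (TensorProduct.AlgebraTensorModule.rid (Polynomial ℂ) AlgFun AlgFun)
  refine ⟨(e.trans e2).toLinearMap.compDer (KaehlerDifferential.D ℂ AlgFun), ?_⟩
  have := KaehlerDifferential.tensorKaehlerEquivOfFormallyEtale_symm_D_algebraMap ℂ (Polynomial ℂ)
    AlgFun Polynomial.X
  change e2 (e (KaehlerDifferential.D ℂ AlgFun (algebraMap (Polynomial ℂ) AlgFun Polynomial.X))) = 1
  rw [this]
  simp [e2, KaehlerDifferential.polynomialEquiv_D]

lemma AlgFun.transcendental_x : Transcendental ℂ AlgFun.x := by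
  have h : Function.Injective (algebraMap (Polynomial ℂ) AlgFun) := by
    rw [IsScalarTower.algebraMap_eq (Polynomial ℂ) (FractionRing (Polynomial ℂ)) AlgFun]
    exact (FaithfulSMul.algebraMap_injective (FractionRing (Polynomial ℂ)) AlgFun).comp
      (IsFractionRing.injective _ _)
  intro hx
  exact Polynomial.transcendental_X ℂ ((isAlgebraic_algebraMap_iff h).1 hx)

lemma AlgFun.mem_range_of_isAlgebraic {a : AlgFun} (h : IsAlgebraic ℂ a) :
    ∃ z : ℂ, algebraMap ℂ AlgFun z = a := by
  obtain ⟨p, hp0, hp⟩ := h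
  have hs := IsAlgClosed.splits p
  have h1 := hs.roots_map (algebraMap ℂ AlgFun)
  have ha : a ∈ (p.map (algebraMap ℂ AlgFun)).roots := by
    rw [Polynomial.mem_roots ((Polynomial.map_ne_zero_iff (algebraMap ℂ AlgFun).injective).2 hp0)]
    simpa [Polynomial.IsRoot, Polynomial.eval_map_algebraMap] using hp
  rw [h1] at ha
  obtain ⟨z, -, hz⟩ := Multiset.mem_map.1 ha
  exact ⟨z, hz⟩

/-- The constants of a derivation of the algebraic functions are the complex numbers. -/
lemma AlgFun.algebraic_of_deriv_eq_zero {D : Derivation ℂ AlgFun AlgFun} (hD : D AlgFun.x = 1)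
    {a : AlgFun} (ha : D a = 0) : ∃ z : ℂ, algebraMap ℂ AlgFun z = a := by
  classical
  suffices h : IsAlgebraic ℂ a from
    AlgFun.mem_range_of_isAlgebraic h
  have hex : ∃ F : MvPolynomial (Fin 2) ℂ, F ≠ 0 ∧ aeval ![AlgFun.x, a] F = 0 := by
    have h1 : Algebra.IsAlgebraic (Polynomial ℂ) AlgFun :=
      (IsFractionRing.comap_isAlgebraic_iff (K := FractionRing (Polynomial ℂ))).2 inferInstance
    obtain ⟨q, hq0, hq⟩ := h1.isAlgebraic a
    refine ⟨q.eval₂ (Polynomial.aeval (X 0 : MvPolynomial (Fin 2) ℂ)).toRingHom (X 1),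
      fun h => hq0 ?_, ?_⟩
    · have h2 : (aeval ![Polynomial.C Polynomial.X, (Polynomial.X : Polynomial (Polynomial ℂ))])
          (q.eval₂ (Polynomial.aeval (X 0 : MvPolynomial (Fin 2) ℂ)).toRingHom (X 1)) = q := by
        clear h hq hq0
        induction q using Polynomial.induction_on' with
        | add p q hp hq => rw [Polynomial.eval₂_add, map_add, hp, hq]
        | monomial n c =>
          rw [Polynomial.eval₂_monomial, map_mul, map_pow, aeval_X]
          have : (aeval ![Polynomial.C Polynomial.X, (Polynomial.X : Polynomial (Polynomial ℂ))])
              (Polynomial.aeval (X 0 : MvPolynomial (Fin 2) ℂ) c) = Polynomial.C c := by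
            induction c using Polynomial.induction_on' with
            | add p q hp hq => simp [hp, hq]
            | monomial n c =>
              simp [← Polynomial.C_mul_X_pow_eq_monomial]
          erw [this]
          simp [Polynomial.C_mul_X_pow_eq_monomial]
      rw [← h2, h, map_zero]
    · rw [← AlgHom.coe_toRingHom, Polynomial.hom_eval₂, ← hq, Polynomial.aeval_def,
        AlgHom.coe_toRingHom, aeval_X]
      congr 1
      ext <;> simp [AlgFun.x]
      rfl
  have hex' : ∃ n, ∃ F : MvPolynomial (Fin 2) ℂ,
      F.totalDegree = n ∧ F ≠ 0 ∧ aeval ![AlgFun.x, a] F = 0 := by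
    obtain ⟨F, h1, h2⟩ := hex
    exact ⟨_, F, rfl, h1, h2⟩
  obtain ⟨F, hFn, hF0, hFa⟩ := Nat.find_spec hex'
  have hp : aeval ![AlgFun.x, a] (pderiv 0 F) = 0 := by
    have := D.aeval_mvPolynomial ![AlgFun.x, a] F
    rw [hFa] at this
    simpa [Fin.sum_univ_two, hD, ha] using this.symm
  have hcoef : ∀ m ∈ F.support, m 0 = 0 := by
    intro m hm
    by_contra hm0
    have hne : pderiv 0 F ≠ 0 := by
      intro h0
      have h1 : coeff (m - Finsupp.single 0 1) (pderiv 0 F) = 0 := by simp [h0]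
      rw [coeff_pderiv, tsub_add_cancel_of_le
        (Finsupp.single_le_iff.2 (Nat.one_le_iff_ne_zero.2 hm0))] at h1
      rcases mul_eq_zero.1 h1 with h1 | h1
      · exact (mem_support_iff.1 hm) h1
      · exact Nat.cast_add_one_ne_zero _ h1
    have hdeg : (pderiv 0 F).totalDegree < F.totalDegree := by
      have hm1 := le_totalDegree hm
      have hm2 : m 0 ≤ m.sum fun _ e => e := by
        rw [Finsupp.sum_fintype _ _ (by simp)]
        exact Finset.single_le_sum (f := m) (fun _ _ => Nat.zero_le _) (Finset.mem_univ 0)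
      refine (Finset.sup_lt_iff (by rw [Nat.bot_eq_zero]; omega)).2 fun b hb => ?_
      have hb' : b + Finsupp.single 0 1 ∈ F.support := by
        rw [mem_support_iff] at hb ⊢
        rw [coeff_pderiv] at hb
        exact left_ne_zero_of_mul hb
      have hb1 := le_totalDegree hb'
      rw [Finsupp.sum_add_index' (by simp) (by simp), Finsupp.sum_single_index rfl] at hb1
      omega
    exact Nat.find_min hex' (hFn ▸ hdeg) ⟨_, rfl, hne, hp⟩
  have key : ∀ {A : Type} [CommRing A] [Algebra ℂ A] (g h : A),
      aeval ![g, h] F = aeval ![0, h] F := by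
    intro A _ _ g h
    rw [aeval_def, aeval_def, eval₂_eq', eval₂_eq']
    refine Finset.sum_congr rfl fun m hm => ?_
    simp [Fin.prod_univ_two, hcoef m hm]
  refine ⟨aeval ![0, Polynomial.X] F, fun h => hF0 ?_, ?_⟩
  · have h1 := congrArg (Polynomial.aeval (X 1 : MvPolynomial (Fin 2) ℂ)) h
    rw [map_zero, ← AlgHom.comp_apply, comp_aeval] at h1
    have h2 : (fun i => Polynomial.aeval (X 1 : MvPolynomial (Fin 2) ℂ)
        ((![0, Polynomial.X] : Fin 2 → Polynomial ℂ) i)) = ![0, X 1] := by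
      ext i; fin_cases i <;> simp
    rw [h2, ← key (X 0)] at h1
    have h3 : (![X 0, X 1] : Fin 2 → MvPolynomial (Fin 2) ℂ) = X := by
      ext i; fin_cases i <;> simp
    rwa [h3, aeval_X_left_apply] at h1
  · have h2 : (fun i => Polynomial.aeval a ((![0, Polynomial.X] : Fin 2 → Polynomial ℂ) i))
        = ![0, a] := by
      ext i; fin_cases i <;> simp
    rw [← AlgHom.comp_apply, comp_aeval, h2, ← key AlgFun.x, hFa]

lemma exists_algHom_complex_ne_zero {L : Type*} [Field L] [Algebra ℂ L] (S : Finset L)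
    (θ : Algebra.adjoin ℂ (S : Set L)) (hθ : θ ≠ 0) :
    ∃ φ : Algebra.adjoin ℂ (S : Set L) →ₐ[ℂ] ℂ, φ θ ≠ 0 := by
  have hft : Algebra.FiniteType ℂ (Algebra.adjoin ℂ (S : Set L)) :=
    (Subalgebra.fg_iff_finiteType _).1 ⟨S, rfl⟩
  have hJ : IsJacobsonRing (Algebra.adjoin ℂ (S : Set L)) :=
    isJacobsonRing_of_finiteType (A := ℂ)
  have h0 : (⊥ : Ideal (Algebra.adjoin ℂ (S : Set L))).jacobson = ⊥ :=
    hJ.out (Ideal.isPrime_bot.isRadical)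
  have h1 : θ ∉ (⊥ : Ideal (Algebra.adjoin ℂ (S : Set L))).jacobson := by
    rw [h0]; simpa using hθ
  rw [Ideal.jacobson, Submodule.mem_sInf] at h1
  push Not at h1
  obtain ⟨M, ⟨-, hM⟩, hθM⟩ := h1
  let _ : Field (Algebra.adjoin ℂ (S : Set L) ⧸ M) := Ideal.Quotient.field M
  have hfin := finite_of_finite_type_of_isJacobsonRing ℂ (Algebra.adjoin ℂ (S : Set L) ⧸ M)
  let e : ℂ ≃ₐ[ℂ] (Algebra.adjoin ℂ (S : Set L) ⧸ M) :=
    AlgEquiv.ofBijective (Algebra.ofId _ _)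
      (IsAlgClosed.algebraMap_bijective_of_isIntegral)
  refine ⟨e.symm.toAlgHom.comp (Ideal.Quotient.mkₐ ℂ M), fun h => hθM ?_⟩
  have h2 : e.symm (Ideal.Quotient.mk M θ) = 0 := h
  rwa [map_eq_zero_iff _ e.symm.injective, Ideal.Quotient.eq_zero_iff_mem] at h2

lemma exists_coeff_aeval_line (f : MvPolynomial (Fin 2) ℂ) {d : ℕ} (hdeg : f.totalDegree ≤ d) :
    ∃ K : Polynomial ℂ, ∀ (A : Type) [CommRing A] [Algebra ℂ A] (b c : A),
      (aeval ![Polynomial.C b + Polynomial.C c * Polynomial.X, Polynomial.X] f).natDegree ≤ d ∧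
      (aeval ![Polynomial.C b + Polynomial.C c * Polynomial.X, Polynomial.X] f).coeff d =
        Polynomial.aeval c K := by
  classical
  refine ⟨∑ m ∈ f.support, if m 0 + m 1 = d then Polynomial.monomial (m 0) (f.coeff m) else 0,
    fun A _ _ b c => ?_⟩
  have hm : ∀ m ∈ f.support, m 0 + m 1 ≤ d := fun m hm => by
    have := le_totalDegree hm
    rw [Finsupp.sum_fintype _ _ (by simp), Fin.sum_univ_two] at this
    omega
  have h1 : (Polynomial.C b + Polynomial.C c * Polynomial.X).natDegree ≤ 1 := by
    compute_degree
  have h2 : ∀ n, ((Polynomial.C b + Polynomial.C c * Polynomial.X) ^ n).natDegree ≤ n := fun n =>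
    (Polynomial.natDegree_pow_le_of_le n h1).trans (by simp)
  have h3 : ∀ i j, ((Polynomial.C b + Polynomial.C c * Polynomial.X) ^ i *
      (Polynomial.X : Polynomial A) ^ j).natDegree ≤ i + j := fun i j =>
    (Polynomial.natDegree_mul_le.trans (add_le_add (h2 i) (Polynomial.natDegree_X_pow_le j)))
  have hc : ∀ i j, ((Polynomial.C b + Polynomial.C c * Polynomial.X) ^ i *
      (Polynomial.X : Polynomial A) ^ j).coeff (i + j) = c ^ i := fun i j => by
    rw [Polynomial.coeff_mul_X_pow]
    have := Polynomial.coeff_pow_of_natDegree_le (m := i) h1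
    rw [mul_one] at this
    simp [this]
  rw [aeval_def, eval₂_eq']
  simp only [Fin.prod_univ_two, Matrix.cons_val_zero, Matrix.cons_val_one]
  constructor
  · refine Polynomial.natDegree_sum_le_of_forall_le _ _ fun m hmm => ?_
    rw [IsScalarTower.algebraMap_apply ℂ A (Polynomial A), ← Polynomial.C_eq_algebraMap]
    exact (Polynomial.natDegree_C_mul_le _ _).trans ((h3 _ _).trans (hm m hmm))
  · rw [Polynomial.finsetSum_coeff, map_sum]
    refine Finset.sum_congr rfl fun m hmm => ?_
    rw [IsScalarTower.algebraMap_apply ℂ A (Polynomial A), ← Polynomial.C_eq_algebraMap,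
      Polynomial.coeff_C_mul]
    split_ifs with h
    · rw [← h, hc, Polynomial.aeval_monomial]
    · rw [Polynomial.coeff_eq_zero_of_natDegree_lt, mul_zero, map_zero]
      exact (h3 _ _).trans_lt (lt_of_le_of_ne (hm m hmm) h)

lemma derivative_aeval_line {A : Type} [CommRing A] [Algebra ℂ A] (f : MvPolynomial (Fin 2) ℂ)
    (b c : A) :
    Polynomial.derivative (aeval ![Polynomial.C b + Polynomial.C c * Polynomial.X, Polynomial.X] f)
      = Polynomial.C c * aeval ![Polynomial.C b + Polynomial.C c * Polynomial.X, Polynomial.X]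
          (pderiv 0 f) +
        aeval ![Polynomial.C b + Polynomial.C c * Polynomial.X, Polynomial.X] (pderiv 1 f) := by
  have := ((Polynomial.derivative' (R := A)).restrictScalars ℂ).aeval_mvPolynomial
    ![Polynomial.C b + Polynomial.C c * Polynomial.X, Polynomial.X] f
  rw [Fin.sum_univ_two] at this
  refine Eq.trans this ?_
  have h1 : (Polynomial.derivative' (R := A)).restrictScalars ℂ
      (![Polynomial.C b + Polynomial.C c * Polynomial.X, Polynomial.X] 0) = Polynomial.C c := by
    change Polynomial.derivative (Polynomial.C b + Polynomial.C c * Polynomial.X) = _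
    simp
  have h2 : (Polynomial.derivative' (R := A)).restrictScalars ℂ
      (![Polynomial.C b + Polynomial.C c * Polynomial.X, Polynomial.X] 1) = 1 := by
    change Polynomial.derivative Polynomial.X = _
    simp
  rw [h1, h2, mul_one, mul_comm]

lemma eval_aeval_line {A : Type} [CommRing A] [Algebra ℂ A] (f : MvPolynomial (Fin 2) ℂ)
    (b c z : A) :
    (aeval ![Polynomial.C b + Polynomial.C c * Polynomial.X, Polynomial.X] f).eval z =
      aeval ![b + c * z, z] f := by
  have h : (Polynomial.aeval (R := A) z).restrictScalars ℂ
      (aeval ![Polynomial.C b + Polynomial.C c * Polynomial.X, Polynomial.X] f) =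
      aeval ![b + c * z, z] f := by
    rw [← AlgHom.comp_apply, comp_aeval]
    congr 2
    ext i; fin_cases i <;> simp
  simpa [Polynomial.aeval_def] using h

lemma eval_zero_eq_one_of_coeff_line (f : MvPolynomial (Fin 2) ℂ) {d : ℕ} {K : Polynomial ℂ}
    (hK : ∀ (A : Type) [CommRing A] [Algebra ℂ A] (b c : A),
      (aeval ![Polynomial.C b + Polynomial.C c * Polynomial.X, Polynomial.X] f).natDegree ≤ d ∧
      (aeval ![Polynomial.C b + Polynomial.C c * Polynomial.X, Polynomial.X] f).coeff d =
        Polynomial.aeval c K)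
    (B : Finset ℂ) (hB : B.card = d) (hf0 : ∀ Z, eval ![0, Z] f = ∏ b ∈ B, (Z - b)) :
    K.eval 0 = 1 := by
  have h := (hK ℂ 0 0).2
  have h1 : aeval ![Polynomial.C 0 + Polynomial.C 0 * Polynomial.X, Polynomial.X] f =
      ∏ b ∈ B, (Polynomial.X - Polynomial.C b) := by
    refine Polynomial.funext fun Z => ?_
    rw [eval_aeval_line, Polynomial.eval_prod]
    simpa using hf0 Z
  rw [h1, Polynomial.coe_aeval_eq_eval] at h
  rw [← h]
  have h2 : (∏ b ∈ B, (Polynomial.X - Polynomial.C b)).Monic :=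
    Polynomial.monic_prod_of_monic _ _ fun b _ => Polynomial.monic_X_sub_C b
  rw [← hB, ← Polynomial.natDegree_finsetProd_X_sub_C_eq_card B (fun b => b)]
  exact h2.coeff_natDegree

lemma exists_discriminant (f : MvPolynomial (Fin 2) ℂ) {d : ℕ} (hdeg : f.totalDegree ≤ d)
    (B : Finset ℂ) (hB : B.card = d) (hd : d ≠ 0)
    (hf0 : ∀ Z, eval ![0, Z] f = ∏ b ∈ B, (Z - b)) :
    ∃ Δ : Polynomial ℂ, Δ ≠ 0 ∧ ∀ (A : Type) [CommRing A] [Algebra ℂ A] (ξ ω : A),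
      aeval ![ξ, ω] f = 0 → aeval ![ξ, ω] (pderiv 1 f) = 0 → Polynomial.aeval ξ Δ = 0 := by
  obtain ⟨K, hK⟩ := exists_coeff_aeval_line f hdeg
  have h1 := hK (Polynomial ℂ) Polynomial.X 0
  set F : Polynomial (Polynomial ℂ) :=
    aeval ![Polynomial.C Polynomial.X + Polynomial.C 0 * Polynomial.X, Polynomial.X] f with hF
  have hF' := derivative_aeval_line f (Polynomial.X : Polynomial ℂ) 0
  replace hF' := hF'.trans (by rw [Polynomial.C_0 (R := Polynomial ℂ), zero_mul, zero_add])
  refine ⟨F.resultant (Polynomial.derivative F) d (d - 1), fun h0 => ?_, fun A _ _ ξ ω h2 h3 => ?_⟩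
  · have hmap : F.map (Polynomial.evalRingHom 0) = ∏ b ∈ B, (Polynomial.X - Polynomial.C b) := by
      refine Polynomial.funext fun Z => ?_
      have h5 : (Polynomial.mapAlgHom (Polynomial.aeval (R := ℂ) (0 : ℂ))) F =
          aeval ![Polynomial.C 0 + Polynomial.C 0 * Polynomial.X, Polynomial.X] f := by
        rw [hF, ← AlgHom.comp_apply, comp_aeval]
        congr 2
        ext1 i; fin_cases i <;> simp
      have h6 : F.map (Polynomial.evalRingHom 0) =
          aeval ![Polynomial.C 0 + Polynomial.C 0 * Polynomial.X, Polynomial.X] f := by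
        rw [← h5]; ext; simp
      rw [h6, eval_aeval_line, Polynomial.eval_prod]
      simpa using hf0 Z
    have h0' := congrArg (Polynomial.evalRingHom 0) h0
    rw [← Polynomial.resultant_map_map, ← Polynomial.derivative_map, hmap, map_zero] at h0'
    set G : Polynomial ℂ := ∏ b ∈ B, (Polynomial.X - Polynomial.C b) with hG
    have hGd : G.natDegree = d := by rw [hG, Polynomial.natDegree_finsetProd_X_sub_C_eq_card, hB]
    have hsep : G.Separable := by
      rw [hG]
      exact Polynomial.separable_prod_X_sub_C_iff'.2 (fun _ _ _ _ h => h)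
    have hGd' : (Polynomial.derivative G).natDegree = d - 1 := by
      rw [Polynomial.natDegree_derivative, hGd]
    refine Polynomial.resultant_ne_zero G (Polynomial.derivative G) hsep ?_
    rw [hGd, hGd']; exact h0'
  · obtain ⟨p, q, -, -, hpq⟩ := Polynomial.exists_mul_add_mul_eq_C_resultant F
      (Polynomial.derivative F) h1.1
      ((Polynomial.natDegree_derivative_le _).trans (Nat.sub_le_sub_right h1.1 1)) (Or.inl hd)
    have key : ∀ g : MvPolynomial (Fin 2) ℂ, Polynomial.eval₂ (Polynomial.aeval ξ).toRingHom ω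
        (aeval ![Polynomial.C Polynomial.X + Polynomial.C 0 * Polynomial.X, Polynomial.X] g :
          Polynomial (Polynomial ℂ)) = aeval ![ξ, ω] g := by
      intro g
      induction g using induction_on with
      | C a =>
        rw [aeval_C, aeval_C, IsScalarTower.algebraMap_apply ℂ (Polynomial ℂ)
          (Polynomial (Polynomial ℂ)), Polynomial.algebraMap_eq, Polynomial.eval₂_C]
        simp
      | add p q hp hq => rw [map_add, Polynomial.eval₂_add, hp, hq, map_add]
      | mul_X p i hp =>
        rw [map_mul, Polynomial.eval₂_mul, hp, map_mul, aeval_X, aeval_X]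
        congr 1
        fin_cases i <;> simp
    have k1 : Polynomial.eval₂ (Polynomial.aeval ξ).toRingHom ω F = 0 := by rw [hF, key, h2]
    have k2 : Polynomial.eval₂ (Polynomial.aeval ξ).toRingHom ω (Polynomial.derivative F) = 0 := by
      have k3 := key (pderiv 1 f)
      rw [Polynomial.C_0 (R := Polynomial ℂ)] at k3
      rw [hF', k3, h3]
    have h4 := congrArg (Polynomial.eval₂ (Polynomial.aeval ξ).toRingHom ω) hpq
    rw [Polynomial.eval₂_add, Polynomial.eval₂_mul, Polynomial.eval₂_mul, k1, k2, zero_mul,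
      zero_mul, add_zero, Polynomial.eval₂_C] at h4
    exact h4.symm

/-- A root of `f(x, ·)` in the algebraic closure of `ℂ(x)` with nonzero second derivative. -/
lemma exists_root_deriv_deriv_ne_zero (f : MvPolynomial (Fin 2) ℂ) {d : ℕ}
    (hdeg : f.totalDegree ≤ d) (B : Finset ℂ) (hB : B.card = d)
    (hf0 : ∀ Z, eval ![0, Z] f = ∏ b ∈ B, (Z - b)) (b₀ : ℂ) (hb₀ : b₀ ∈ B)
    (hna : ∀ a, ∃ s, eval ![s, a * s + b₀] f ≠ 0)
    {D : Derivation ℂ AlgFun AlgFun} (hD : D AlgFun.x = 1) :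
    ∃ ζ, aeval ![AlgFun.x, ζ] f = 0 ∧ D (D ζ) ≠ 0 := by
  classical
  by_contra! hcon
  have haff : ∀ ζ, ∃ a b : ℂ, aeval ![AlgFun.x, ζ] f = 0 →
      ζ = algebraMap ℂ AlgFun a * AlgFun.x + algebraMap ℂ AlgFun b := by
    intro ζ
    by_cases hζ : aeval ![AlgFun.x, ζ] f = 0
    · obtain ⟨a, ha⟩ := AlgFun.algebraic_of_deriv_eq_zero hD (hcon ζ hζ)
      have h1 : D (ζ - algebraMap ℂ AlgFun a * AlgFun.x) = 0 := by
        simp [Derivation.leibniz, hD, ← ha]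
      obtain ⟨b, hb⟩ := AlgFun.algebraic_of_deriv_eq_zero hD h1
      exact ⟨a, b, fun _ => by rw [hb]; ring⟩
    · exact ⟨0, 0, fun h => absurd h hζ⟩
  choose al be hab using haff
  obtain ⟨K, hK⟩ := exists_coeff_aeval_line f hdeg
  have hinj : Function.Injective (Polynomial.aeval (R := ℂ) AlgFun.x) :=
    transcendental_iff_injective.1 AlgFun.transcendental_x
  have hK0 : K.eval 0 = 1 := eval_zero_eq_one_of_coeff_line f hK B hB hf0
  set P := aeval ![Polynomial.C AlgFun.x + Polynomial.C 0 * Polynomial.X, Polynomial.X] f with hP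
  have hP1 := hK AlgFun AlgFun.x 0
  rw [← hP] at hP1
  have hPm : P.Monic := by
    refine Polynomial.monic_of_natDegree_le_of_coeff_eq_one d hP1.1 ?_
    rw [hP1.2, ← Polynomial.coeff_zero_eq_aeval_zero', Polynomial.coeff_zero_eq_eval_zero, hK0,
      map_one]
  have hPr : ∀ ζ ∈ P.roots, aeval ![AlgFun.x, ζ] f = 0 := by
    intro ζ hζ
    have := (Polynomial.mem_roots hPm.ne_zero).1 hζ
    rw [Polynomial.IsRoot, hP, eval_aeval_line] at this
    simpa using this
  have hsplit : P = (P.roots.map fun a => Polynomial.X - Polynomial.C a).prod := by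
    have := (IsAlgClosed.splits P).eq_prod_roots
    rwa [hPm.leadingCoeff, Polynomial.C_1, one_mul] at this
  have h1 : Polynomial.aeval AlgFun.x ((P.roots.map fun r =>
      Polynomial.C (b₀ - be r) - Polynomial.C (al r) * Polynomial.X).prod) =
      Polynomial.aeval AlgFun.x (aeval ![Polynomial.X, Polynomial.C b₀] f) := by
    have h2 : Polynomial.aeval AlgFun.x (aeval ![Polynomial.X, Polynomial.C b₀] f) =
        P.eval (algebraMap ℂ AlgFun b₀) := by
      rw [hP, eval_aeval_line, ← AlgHom.comp_apply, comp_aeval]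
      congr 2
      ext1 i; fin_cases i <;> simp
    rw [h2]
    conv_rhs => rw [hsplit]
    rw [map_multiset_prod, Polynomial.eval_multiset_prod, Multiset.map_map, Multiset.map_map]
    congr 1
    refine Multiset.map_congr rfl fun r hr => ?_
    conv_rhs => rw [hab r (hPr r hr)]
    simp
    ring
  have h2 := congrArg (Polynomial.eval 0) (hinj h1)
  have h3 : (aeval ![Polynomial.X, Polynomial.C b₀] f).eval 0 = 0 := by
    have h4 : Polynomial.aeval (0 : ℂ) (aeval ![Polynomial.X, Polynomial.C b₀] f) =
        aeval ![0, b₀] f := by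
      rw [← AlgHom.comp_apply, comp_aeval]
      congr 2
      ext1 i; fin_cases i <;> simp
    rw [← Polynomial.coe_aeval_eq_eval, h4]
    refine (hf0 b₀).trans ?_
    exact Finset.prod_eq_zero hb₀ (sub_self _)
  rw [h3, Polynomial.eval_multiset_prod, Multiset.prod_eq_zero_iff, Multiset.map_map] at h2
  obtain ⟨r, hr, hr0⟩ := Multiset.mem_map.1 h2
  have hbr : b₀ = be r := by simpa [sub_eq_zero] using hr0
  obtain ⟨s, hs⟩ := hna (al r)
  apply hs
  have h5 : Polynomial.aeval AlgFun.x
      (aeval ![Polynomial.X, Polynomial.C (al r) * Polynomial.X + Polynomial.C b₀] f) = 0 := by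
    rw [← AlgHom.comp_apply, comp_aeval, ← hPr r hr]
    congr 2
    ext1 i; fin_cases i
    · simp
    · conv_rhs => simp only [Fin.mk_one, Matrix.cons_val_one]; rw [hab r (hPr r hr)]
      simp [hbr]
  have h6 := congrArg (Polynomial.aeval s) (hinj (h5.trans (map_zero _).symm))
  rw [← AlgHom.comp_apply, comp_aeval, map_zero] at h6
  rw [← h6]
  change aeval _ f = _
  congr 2
  ext1 i; fin_cases i <;> simp


lemma exists_generic_tangent (f : MvPolynomial (Fin 2) ℂ) {d : ℕ}
    (hdeg : f.totalDegree ≤ d) (B : Finset ℂ) (hB : B.card = d)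
    (hf0 : ∀ Z, eval ![0, Z] f = ∏ b ∈ B, (Z - b)) (b₀ : ℂ) (hb₀ : b₀ ∈ B)
    (hna : ∀ a, ∃ s, eval ![s, a * s + b₀] f ≠ 0) (N : Polynomial ℂ) (hN : N ≠ 0) :
    ∃ (u v ζ k : AlgFun) (W : Finset AlgFun), k ≠ 0 ∧ Polynomial.aeval u N ≠ 0 ∧ W.card + 2 = d ∧
      ζ ∉ W ∧ aeval ![Polynomial.C (-v) + Polynomial.C (-u) * Polynomial.X, Polynomial.X] f =
        Polynomial.C k * ((Polynomial.X - Polynomial.C ζ) ^ 2 *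
          ∏ w ∈ W, (Polynomial.X - Polynomial.C w)) ∧
      aeval ![-v - u * ζ, ζ] (pderiv 0 f) ≠ 0 := by
  classical
  obtain ⟨D, hD⟩ := AlgFun.exists_derivation
  have hd : d ≠ 0 := by rw [← hB]; exact Finset.card_ne_zero_of_mem hb₀
  obtain ⟨K, hK⟩ := exists_coeff_aeval_line f hdeg
  have hK0 := eval_zero_eq_one_of_coeff_line f hK B hB hf0
  obtain ⟨Δ, hΔ0, hΔ⟩ := exists_discriminant f hdeg B hB hd hf0
  obtain ⟨ζ, hζ, hζ2⟩ := exists_root_deriv_deriv_ne_zero f hdeg B hB hf0 b₀ hb₀ hna hD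
  have hζ1 : D ζ ≠ 0 := fun h => hζ2 (by rw [h, map_zero])
  have hconst : ∀ ξ : AlgFun, Polynomial.aeval ξ Δ = 0 → ∃ z : ℂ, algebraMap ℂ AlgFun z = ξ :=
    fun ξ h => AlgFun.mem_range_of_isAlgebraic ⟨Δ, hΔ0, h⟩
  have hDconst : ∀ ξ : AlgFun, (∃ z : ℂ, algebraMap ℂ AlgFun z = ξ) → D ξ = 0 := by
    rintro _ ⟨z, rfl⟩; exact D.map_algebraMap z
  have chain : ∀ (a b : AlgFun) (g : MvPolynomial (Fin 2) ℂ), D (aeval ![a, b] g) =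
      aeval ![a, b] (pderiv 0 g) * D a + aeval ![a, b] (pderiv 1 g) * D b := by
    intro a b g
    rw [D.aeval_mvPolynomial, Fin.sum_univ_two]
    rfl
  have hfZ : aeval ![AlgFun.x, ζ] (pderiv 1 f) ≠ 0 := by
    intro h
    have := hDconst _ (hconst _ (hΔ _ _ _ hζ h))
    rw [hD] at this
    exact one_ne_zero this
  have hch := chain AlgFun.x ζ f
  rw [hζ, map_zero, hD, mul_one] at hch
  have hfs : aeval ![AlgFun.x, ζ] (pderiv 0 f) ≠ 0 := by
    intro h
    rw [h, zero_add] at hch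
    exact mul_ne_zero hfZ hζ1 hch.symm
  obtain ⟨u, hu⟩ : ∃ u, u = -(D ζ)⁻¹ := ⟨_, rfl⟩
  have hu0 : u ≠ 0 := by rw [hu]; exact neg_ne_zero.2 (inv_ne_zero hζ1)
  have huz : u * D ζ = -1 := by rw [hu]; field_simp
  have hDu0 : D u ≠ 0 := by
    intro h
    have := congrArg D huz
    rw [Derivation.leibniz, h, map_neg, Derivation.map_one_eq_zero] at this
    simp [hu0, hζ2] at this
  obtain ⟨v, hv⟩ : ∃ v, v = -AlgFun.x - u * ζ := ⟨_, rfl⟩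
  have hDv : D v = - (D u) * ζ := by
    rw [hv, map_sub, map_neg, hD, Derivation.leibniz, smul_eq_mul, smul_eq_mul, huz]
    ring
  have hx : -v - u * ζ = AlgFun.x := by rw [hv]; ring
  have hutr : ∀ Q : Polynomial ℂ, Q ≠ 0 → Polynomial.aeval u Q ≠ 0 := fun Q hQ h =>
    hDu0 (hDconst u (AlgFun.mem_range_of_isAlgebraic ⟨Q, hQ, h⟩))
  have hk : Polynomial.aeval u (K.comp (-Polynomial.X)) ≠ 0 := by
    refine hutr _ fun h => ?_
    have := congrArg (Polynomial.eval 0) h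
    simp [hK0] at this
  set p := aeval ![Polynomial.C (-v) + Polynomial.C (-u) * Polynomial.X, Polynomial.X] f with hp
  have hpd := hK AlgFun (-v) (-u)
  rw [← hp] at hpd
  have hpk : p.coeff d ≠ 0 := by
    rw [hpd.2]
    rw [Polynomial.aeval_comp] at hk
    simpa using hk
  have hp0 : p ≠ 0 := by rintro h; rw [h] at hpk; simp at hpk
  have hpn : p.natDegree = d := le_antisymm hpd.1 (Polynomial.le_natDegree_of_ne_zero hpk)
  have hpe : ∀ ω, p.eval ω = aeval ![-v - u * ω, ω] f := fun ω => by
    rw [hp, eval_aeval_line]; ring_nf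
  have hpe' : ∀ ω, (Polynomial.derivative p).eval ω = -u * aeval ![-v - u * ω, ω] (pderiv 0 f) +
      aeval ![-v - u * ω, ω] (pderiv 1 f) := fun ω => by
    rw [hp, derivative_aeval_line, Polynomial.eval_add, Polynomial.eval_mul, eval_aeval_line,
      eval_aeval_line, Polynomial.eval_C]; ring_nf
  have hpe'' : (Polynomial.derivative (Polynomial.derivative p)).eval ζ =
      - u * D u * aeval ![AlgFun.x, ζ] (pderiv 0 f) := by
    have h1 : (Polynomial.derivative (Polynomial.derivative p)).eval ζ =
        -u * (-u * aeval ![AlgFun.x, ζ] (pderiv 0 (pderiv 0 f)) +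
          aeval ![AlgFun.x, ζ] (pderiv 1 (pderiv 0 f))) +
        (-u * aeval ![AlgFun.x, ζ] (pderiv 0 (pderiv 1 f)) +
          aeval ![AlgFun.x, ζ] (pderiv 1 (pderiv 1 f))) := by
      rw [hp, derivative_aeval_line, Polynomial.derivative_add, Polynomial.derivative_C_mul,
        derivative_aeval_line, derivative_aeval_line]
      simp only [Polynomial.eval_add, Polynomial.eval_mul, eval_aeval_line, Polynomial.eval_C]
      rw [show -v + -u * ζ = AlgFun.x by rw [← hx]; ring]
    have h2 : -u * aeval ![AlgFun.x, ζ] (pderiv 0 f) + aeval ![AlgFun.x, ζ] (pderiv 1 f) = 0 := by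
      apply mul_left_cancel₀ hζ1
      linear_combination (-aeval ![AlgFun.x, ζ] (pderiv 0 f)) * huz - hch
    have h3 := congrArg D h2
    rw [map_add, Derivation.leibniz, chain, chain, hD, map_zero, map_neg] at h3
    simp only [smul_eq_mul] at h3
    rw [h1]
    linear_combination (-u) * h3 + (-u * aeval ![AlgFun.x, ζ] (pderiv 1 (pderiv 0 f)) +
          aeval ![AlgFun.x, ζ] (pderiv 1 (pderiv 1 f))) * huz
  have hpζ : p.IsRoot ζ := by rw [Polynomial.IsRoot, hpe, hx, hζ]
  have hp'ζ : (Polynomial.derivative p).IsRoot ζ := by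
    rw [Polynomial.IsRoot, hpe', hx]
    apply mul_left_cancel₀ hζ1
    linear_combination (-aeval ![AlgFun.x, ζ] (pderiv 0 f)) * huz - hch
  have hp''ζ : (Polynomial.derivative (Polynomial.derivative p)).eval ζ ≠ 0 := by
    rw [hpe'']
    exact mul_ne_zero (mul_ne_zero (neg_ne_zero.2 hu0) hDu0) hfs
  have hp'0 : Polynomial.derivative p ≠ 0 := fun h => hp''ζ (by simp [h])
  have hmult : p.rootMultiplicity ζ = 2 := by
    have h1 := Polynomial.derivative_rootMultiplicity_of_root hp'ζ
    rw [Polynomial.rootMultiplicity_eq_zero hp''ζ] at h1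
    have h2 := Polynomial.derivative_rootMultiplicity_of_root hpζ
    have h3 := (Polynomial.rootMultiplicity_pos hp0).2 hpζ
    have h4 := (Polynomial.rootMultiplicity_pos hp'0).2 hp'ζ
    omega
  have hmult' : ∀ ω, p.IsRoot ω → ω ≠ ζ → p.rootMultiplicity ω = 1 := by
    intro ω hω hne
    have h3 := (Polynomial.rootMultiplicity_pos hp0).2 hω
    by_contra hm
    have h4 : 1 < p.rootMultiplicity ω := by omega
    obtain ⟨-, h5⟩ := (Polynomial.one_lt_rootMultiplicity_iff_isRoot hp0).1 h4
    rw [Polynomial.IsRoot, hpe'] at h5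
    rw [Polynomial.IsRoot, hpe] at hω
    have h6 := chain (-v - u * ω) ω f
    rw [hω, map_zero, map_sub, map_neg, Derivation.leibniz, hDv] at h6
    simp only [smul_eq_mul] at h6
    have h7 : aeval ![-v - u * ω, ω] (pderiv 0 f) * (D u * (ζ - ω)) = 0 := by
      linear_combination -h6 - D ω * h5
    have h8 : D u * (ζ - ω) ≠ 0 := mul_ne_zero hDu0 (sub_ne_zero.2 hne.symm)
    have h9 := (mul_eq_zero.1 h7).resolve_right h8
    rw [h9, mul_zero, zero_add] at h5
    have hξ := hconst _ (hΔ _ _ _ hω h5)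
    have hDξ := hDconst _ hξ
    obtain ⟨ξ, hξ⟩ := hξ
    have hDω : D ω = 0 := by
      refine hDconst _ (AlgFun.mem_range_of_isAlgebraic
        ⟨aeval ![Polynomial.C ξ + Polynomial.C 0 * Polynomial.X, Polynomial.X] f, fun h => ?_, ?_⟩)
      · have := (hK ℂ ξ 0).2
        rw [h, Polynomial.coe_aeval_eq_eval, hK0] at this
        simp at this
      · rw [← AlgHom.comp_apply, comp_aeval, ← hω]
        congr 2
        ext1 i; fin_cases i
        · simp [hξ]
        · simp
    rw [map_sub, map_neg, Derivation.leibniz, hDv, hDω] at hDξ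
    simp only [smul_eq_mul] at hDξ
    exact h8 (by linear_combination hDξ)
  have hfact : p = Polynomial.C p.leadingCoeff * ((Polynomial.X - Polynomial.C ζ) ^ 2 *
      ∏ w ∈ p.roots.toFinset.erase ζ, (Polynomial.X - Polynomial.C w)) := by
    have h1 := (IsAlgClosed.splits p).eq_prod_roots
    have h2 : ζ ∈ p.roots.toFinset := Multiset.mem_toFinset.2 ((Polynomial.mem_roots hp0).2 hpζ)
    rw [Finset.prod_multiset_map_count, ← Finset.mul_prod_erase _ _ h2, Polynomial.count_roots,
      hmult] at h1
    conv_lhs => rw [h1]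
    congr 2
    refine Finset.prod_congr rfl fun w hw => ?_
    rw [Finset.mem_erase, Multiset.mem_toFinset, Polynomial.mem_roots hp0] at hw
    rw [Polynomial.count_roots, hmult' w hw.2 hw.1, pow_one]
  refine ⟨u, v, ζ, p.leadingCoeff, p.roots.toFinset.erase ζ, ?_, hutr N hN, ?_,
    Finset.notMem_erase _ _, ?_, by rwa [hx]⟩
  · exact Polynomial.leadingCoeff_ne_zero.2 hp0
  · rw [hfact, Polynomial.natDegree_C_mul (Polynomial.leadingCoeff_ne_zero.2 hp0),
      Polynomial.natDegree_mul (pow_ne_zero _ (Polynomial.X_sub_C_ne_zero ζ))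
        (Finset.prod_ne_zero_iff.2 fun w _ => Polynomial.X_sub_C_ne_zero w),
      Polynomial.natDegree_finsetProd_X_sub_C_eq_card, Polynomial.natDegree_pow,
      Polynomial.natDegree_X_sub_C] at hpn
    omega
  · exact hfact

/-- A line `s = -v - u Z` simply tangent to the curve `f = 0` at a single point. -/
lemma exists_simple_tangent (f : MvPolynomial (Fin 2) ℂ) {d : ℕ}
    (hdeg : f.totalDegree ≤ d) (B : Finset ℂ) (hB : B.card = d)
    (hf0 : ∀ Z, eval ![0, Z] f = ∏ b ∈ B, (Z - b)) (b₀ : ℂ) (hb₀ : b₀ ∈ B)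
    (hna : ∀ a, ∃ s, eval ![s, a * s + b₀] f ≠ 0) (N : Polynomial ℂ) (hN : N ≠ 0) :
    ∃ (u v ζ k : ℂ) (W : Finset ℂ), k ≠ 0 ∧ N.eval u ≠ 0 ∧ W.card + 2 = d ∧ ζ ∉ W ∧
      (∀ Z, eval ![-v - u * Z, Z] f = k * ((Z - ζ) ^ 2 * ∏ w ∈ W, (Z - w))) ∧
      eval ![-v - u * ζ, ζ] (pderiv 0 f) ≠ 0 := by
  classical
  obtain ⟨u, v, ζ, k, W, hk, hu, hW, hζ, hfac, hfs⟩ :=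
    exists_generic_tangent f hdeg B hB hf0 b₀ hb₀ hna N hN
  set S : Finset AlgFun := {u, v, ζ, k} ∪ W with hS
  have hmem : ∀ a ∈ S, a ∈ Algebra.adjoin ℂ (S : Set AlgFun) := fun a ha =>
    Algebra.subset_adjoin ha
  let R := Algebra.adjoin ℂ (S : Set AlgFun)
  obtain ⟨u', hu'⟩ : ∃ u' : R, (u' : AlgFun) = u := ⟨⟨u, hmem u (by simp [hS])⟩, rfl⟩
  obtain ⟨v', hv'⟩ : ∃ u' : R, (u' : AlgFun) = v := ⟨⟨v, hmem v (by simp [hS])⟩, rfl⟩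
  obtain ⟨ζ', hζ'⟩ : ∃ u' : R, (u' : AlgFun) = ζ := ⟨⟨ζ, hmem ζ (by simp [hS])⟩, rfl⟩
  obtain ⟨k', hk'⟩ : ∃ u' : R, (u' : AlgFun) = k := ⟨⟨k, hmem k (by simp [hS])⟩, rfl⟩
  obtain ⟨W', hW'⟩ : ∃ W' : Finset R, W'.map ⟨Subtype.val, Subtype.val_injective⟩ = W := by
    refine ⟨W.subtype _, ?_⟩
    ext w
    simp only [Finset.mem_map, Finset.mem_subtype, Function.Embedding.coeFn_mk, Subtype.exists,
      exists_and_left, exists_prop, exists_eq_right_right, and_iff_left_iff_imp]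
    exact fun hw => hmem w (by simp [hS, hw])
  have hcoe : ∀ (a b : R) (g : MvPolynomial (Fin 2) ℂ),
      ((aeval ![a, b] g : R) : AlgFun) = aeval ![(a : AlgFun), (b : AlgFun)] g := by
    intro a b g
    change R.val _ = _
    rw [← AlgHom.comp_apply, comp_aeval]
    congr 2
    ext1 i; fin_cases i <;> rfl
  have hcoe' : ∀ (a : R) (g : Polynomial ℂ),
      ((Polynomial.aeval a g : R) : AlgFun) = Polynomial.aeval (a : AlgFun) g := by
    intro a g
    change R.val _ = _
    rw [← Polynomial.aeval_algHom_apply]; rfl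
  set θ : R := k' * Polynomial.aeval u' N * aeval ![-v' - u' * ζ', ζ'] (pderiv 0 f) *
    ((∏ w ∈ W', (ζ' - w)) * ∏ p ∈ W'.offDiag, (p.1 - p.2)) with hθ
  have hθ0 : θ ≠ 0 := by
    refine mul_ne_zero (mul_ne_zero (mul_ne_zero ?_ ?_) ?_) (mul_ne_zero ?_ ?_)
    · rintro rfl; exact hk (by rw [← hk']; rfl)
    · intro h; apply hu; rw [← hu', ← hcoe', h]; rfl
    · intro h; apply hfs
      have := congrArg (Subtype.val) h
      rw [hcoe] at this
      simpa [hu', hv', hζ'] using this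
    · refine Finset.prod_ne_zero_iff.2 fun w hw => sub_ne_zero.2 ?_
      rintro rfl
      apply hζ
      rw [← hW', ← hζ']
      exact Finset.mem_map_of_mem _ hw
    · refine Finset.prod_ne_zero_iff.2 fun p hp => sub_ne_zero.2 (Finset.mem_offDiag.1 hp).2.2
  obtain ⟨φ, hφ⟩ := exists_algHom_complex_ne_zero S θ hθ0
  have hev : ∀ (a b : R) (g : MvPolynomial (Fin 2) ℂ),
      φ (aeval ![a, b] g) = eval ![φ a, φ b] g := by
    intro a b g
    rw [← AlgHom.comp_apply, comp_aeval, ← coe_aeval_eq_eval]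
    change aeval _ g = aeval _ g
    congr 2
    ext1 i; fin_cases i <;> rfl
  have hfac' : ∀ Z : ℂ, (aeval ![-v' - u' * algebraMap ℂ R Z, algebraMap ℂ R Z] f : R) =
      k' * ((algebraMap ℂ R Z - ζ') ^ 2 * ∏ w ∈ W', (algebraMap ℂ R Z - w)) := by
    intro Z
    apply Subtype.ext
    rw [hcoe]
    have h1 := congrArg (Polynomial.eval (algebraMap ℂ AlgFun Z)) hfac
    rw [eval_aeval_line, ← hW'] at h1
    simp only [Finset.prod_map, Polynomial.eval_mul, Polynomial.eval_pow, Polynomial.eval_sub,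
      Polynomial.eval_X, Polynomial.eval_C, Polynomial.eval_prod] at h1
    have h2 : (-v + -u * algebraMap ℂ AlgFun Z) = -v - u * algebraMap ℂ AlgFun Z := by ring
    rw [h2] at h1
    push_cast
    rw [hv', hu', hk', hζ']
    exact h1
  rw [hθ, map_mul, map_mul, map_mul, map_mul, map_prod, map_prod] at hφ
  simp only [ne_eq, mul_eq_zero, not_or, Finset.prod_eq_zero_iff, not_exists, not_and] at hφ
  obtain ⟨⟨⟨h1, h2⟩, h3⟩, h4, h5⟩ := hφ
  have hinj : Set.InjOn φ W' := by
    intro a ha b hb hab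
    by_contra hne
    refine h5 (a, b) (Finset.mem_offDiag.2 ⟨ha, hb, hne⟩) ?_
    rw [map_sub, hab, sub_self]
  refine ⟨φ u', φ v', φ ζ', φ k', W'.image φ, h1, ?_, ?_, ?_, ?_, ?_⟩
  · rw [← Polynomial.coe_aeval_eq_eval, Polynomial.aeval_algHom_apply]; exact h2
  · rw [Finset.card_image_of_injOn hinj, ← hW, ← hW', Finset.card_map]
  · intro h
    obtain ⟨w, hw, hwe⟩ := Finset.mem_image.1 h
    exact h4 w hw (by rw [map_sub, hwe, sub_self])
  · intro Z
    have := congrArg φ (hfac' Z)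
    rw [hev] at this
    have hZ : φ (algebraMap ℂ R Z) = Z := φ.commutes Z
    simp only [map_sub, map_neg, map_mul, map_pow, map_prod, hZ] at this
    rw [Finset.prod_image hinj]
    exact this
  · rw [hev] at h3
    simpa using h3

open Filter Topology in
/-- An entire function of polynomial growth is a polynomial. -/
lemma Differentiable.exists_polynomial_of_growth {F : ℂ → ℂ} (hF : Differentiable ℂ F) {K : ℝ}
    {M : ℕ} (hK : ∀ s, ‖F s‖ ≤ K * (1 + ‖s‖) ^ M) :
    ∃ P : Polynomial ℂ, P.natDegree ≤ M ∧ ∀ s, F s = P.eval s := by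
  have hK0 : 0 ≤ K := by
    have := (norm_nonneg _).trans (hK 0)
    simpa using this
  have hder : ∀ n, M < n → iteratedDeriv n F 0 = 0 := by
    intro n hn
    have hb : ∀ R : ℝ, 1 ≤ R → ‖iteratedDeriv n F 0‖ ≤ n.factorial * (K * 2 ^ M) / R := by
      intro R hR
      have hR0 : 0 < R := by linarith
      have h1 : ∀ s ∈ Metric.sphere (0 : ℂ) R, ‖F s‖ ≤ K * (2 * R) ^ M := by
        intro s hs
        rw [mem_sphere_zero_iff_norm] at hs
        refine (hK s).trans ?_
        rw [hs]
        gcongr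
        linarith
      refine (Complex.norm_iteratedDeriv_le_of_forall_mem_sphere_norm_le n hR0
        hF.diffContOnCl h1).trans ?_
      rw [div_le_div_iff₀ (by positivity) hR0, mul_pow]
      have h2 : R ^ M * R ≤ R ^ n := by
        rw [← pow_succ]; exact pow_le_pow_right₀ hR hn
      calc (n.factorial : ℝ) * (K * (2 ^ M * R ^ M)) * R
          = n.factorial * (K * 2 ^ M) * (R ^ M * R) := by ring
        _ ≤ n.factorial * (K * 2 ^ M) * R ^ n := by gcongr
    have ht : Tendsto (fun R : ℝ => n.factorial * (K * 2 ^ M) / R) atTop (𝓝 0) :=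
      tendsto_const_nhds.div_atTop tendsto_id
    have h3 : ‖iteratedDeriv n F 0‖ ≤ 0 :=
      ge_of_tendsto ht ((eventually_ge_atTop 1).mono hb)
    simpa using h3
  refine ⟨∑ n ∈ Finset.range (M + 1),
    Polynomial.monomial n ((n.factorial : ℂ)⁻¹ * iteratedDeriv n F 0), ?_, fun s => ?_⟩
  · refine Polynomial.natDegree_sum_le_of_forall_le _ _ fun n hn => ?_
    exact (Polynomial.natDegree_monomial_le _).trans
      (Nat.lt_succ_iff.1 (Finset.mem_range.1 hn))
  · rw [← Complex.taylorSeries_eq_of_entire' 0 s hF, Polynomial.eval_finsetSum,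
      tsum_eq_sum (s := Finset.range (M + 1))]
    · refine Finset.sum_congr rfl fun n _ => ?_
      rw [Polynomial.eval_monomial, sub_zero]
    · intro n hn
      rw [Finset.mem_range, not_lt] at hn
      rw [hder n hn]; ring

open Filter Topology in
/-- A continuous function on the complement of a finite set, holomorphic off a possibly larger
finite set and of polynomial growth, is a polynomial. -/
lemma exists_polynomial_of_growth_off_finite {g : ℂ → ℂ} {T T' : Set ℂ} (hT : T.Finite)
    (hT' : T'.Finite) (hc : ∀ s ∉ T, ContinuousAt g s)
    (hd : ∀ s ∉ T', DifferentiableAt ℂ g s) {K : ℝ} {M : ℕ}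
    (hK : ∀ s ∉ T, ‖g s‖ ≤ K * (1 + ‖s‖) ^ M) :
    ∃ P : Polynomial ℂ, P.natDegree ≤ M ∧ ∀ s ∉ T, g s = P.eval s := by
  classical
  have hev : ∀ (S : Set ℂ), S.Finite → ∀ c, ∀ᶠ s in 𝓝[≠] c, s ∉ S := by
    intro S hS c
    have h1 : (S \ {c})ᶜ ∈ 𝓝 c := (hS.subset Set.sdiff_subset).isClosed.isOpen_compl.mem_nhds
      (by simp)
    filter_upwards [mem_nhdsWithin_of_mem_nhds h1, self_mem_nhdsWithin] with s hs hne hsS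
    exact hs ⟨hsS, hne⟩
  have hK0 : 0 ≤ K := by
    obtain ⟨s, hs⟩ := hT.infinite_compl.nonempty
    have h1 := (norm_nonneg _).trans (hK s hs)
    by_contra hneg
    have : K * (1 + ‖s‖) ^ M < 0 := mul_neg_of_neg_of_pos (not_le.1 hneg) (by positivity)
    linarith
  let F : ℂ → ℂ := fun c => limUnder (𝓝[≠] c) g
  have hFd : ∀ c, ∃ U ∈ 𝓝 c, (∀ s ∈ U, s ≠ c → s ∉ T' ∧ s ∉ T) ∧
      DifferentiableOn ℂ (Function.update g c (F c)) U := by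
    intro c
    have h1 : ∀ᶠ s in 𝓝 c, s ≠ c → s ∉ T' ∧ s ∉ T :=
      eventually_nhdsWithin_iff.1 ((hev T' hT' c).and (hev T hT c))
    obtain ⟨U, hU, hUo, hcU⟩ := mem_nhds_iff.1 (h1.and (Metric.ball_mem_nhds c one_pos))
    refine ⟨U, hUo.mem_nhds hcU, fun s hs => (hU hs).1, ?_⟩
    refine Complex.differentiableOn_update_limUnder_of_bddAbove (hUo.mem_nhds hcU) ?_ ?_
    · intro s hs
      exact (hd s ((hU hs.1).1 hs.2).1).differentiableWithinAt
    · refine ⟨K * (1 + (‖c‖ + 1)) ^ M, ?_⟩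
      rintro _ ⟨s, hs, rfl⟩
      refine (hK s ((hU hs.1).1 hs.2).2).trans ?_
      have h2 : ‖s‖ ≤ ‖c‖ + 1 := by
        have := (hU hs.1).2
        change dist s c < 1 at this
        rw [dist_eq_norm] at this
        have h3 : ‖s‖ ≤ ‖s - c‖ + ‖c‖ := by simpa using norm_add_le (s - c) c
        linarith
      gcongr
  have hFeq : ∀ s ∉ T, F s = g s := fun s hs =>
    ((hc s hs).tendsto.mono_left nhdsWithin_le_nhds).limUnder_eq
  have hF : Differentiable ℂ F := by
    intro c
    obtain ⟨U, hU, hUT, hd⟩ := hFd c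
    refine (hd.differentiableAt hU).congr_of_eventuallyEq ?_
    filter_upwards [hU] with s hs
    by_cases hsc : s = c
    · subst hsc; simp
    · rw [Function.update_of_ne hsc, hFeq s (hUT s hs hsc).2]
  have hFK : ∀ s, ‖F s‖ ≤ K * (1 + ‖s‖) ^ M := by
    intro c
    have h1 : Tendsto (fun s => ‖F s‖) (𝓝[≠] c) (𝓝 ‖F c‖) :=
      (hF c).continuousAt.norm.tendsto.mono_left nhdsWithin_le_nhds
    have h2 : Tendsto (fun s : ℂ => K * (1 + ‖s‖) ^ M) (𝓝[≠] c) (𝓝 (K * (1 + ‖c‖) ^ M)) :=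
      (Continuous.tendsto (by fun_prop) c).mono_left nhdsWithin_le_nhds
    refine le_of_tendsto_of_tendsto h1 h2 ?_
    filter_upwards [hev T hT c] with s hs
    rw [hFeq s hs]; exact hK s hs
  obtain ⟨P, hP, hFP⟩ := hF.exists_polynomial_of_growth hFK
  exact ⟨P, hP, fun s hs => by rw [← hFP, hFeq s hs]⟩

open Filter Topology in
lemma hasDerivAt_mul_of_continuousAt {φ ρ : ℂ → ℂ} {s φ' : ℂ} (hφ : HasDerivAt φ φ' s)
    (h0 : φ s = 0) (hρ : ContinuousAt ρ s) :
    HasDerivAt (fun x => φ x * ρ x) (φ' * ρ s) s := by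
  rw [hasDerivAt_iff_tendsto_slope] at hφ ⊢
  have h1 := hφ.mul (hρ.tendsto.mono_left (nhdsWithin_le_nhds (s := {s}ᶜ)))
  refine h1.congr fun x => ?_
  simp only [slope_def_field, h0, zero_mul, sub_zero]
  ring

lemma continuous_evalEval (g : Polynomial (Polynomial ℂ)) :
    Continuous fun p : ℂ × ℂ => g.evalEval p.1 p.2 := by
  induction g using Polynomial.induction_on' with
  | add p q hp hq =>
    simp only [Polynomial.evalEval_add]
    exact hp.add hq
  | monomial n a =>
    simp only [Polynomial.evalEval, Polynomial.eval_monomial, Polynomial.eval_mul,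
      Polynomial.eval_pow, Polynomial.eval_C]
    fun_prop

open Filter Topology in
/-- A continuous simple root of a polynomial with polynomial coefficients is differentiable. -/
lemma differentiableAt_of_simple_root (q : Polynomial (Polynomial ℂ)) {r : ℂ → ℂ} {s : ℂ}
    (hr : ContinuousAt r s) (hq : ∀ᶠ x in 𝓝 s, q.evalEval x (r x) = 0)
    (hq' : (Polynomial.derivative q).evalEval s (r s) ≠ 0) : DifferentiableAt ℂ r s := by
  obtain ⟨φ, Q, hQ⟩ : ∃ (φ : Polynomial ℂ) (Q : Polynomial (Polynomial ℂ)),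
      q = Polynomial.C φ + (Polynomial.X - Polynomial.C (Polynomial.C (r s))) * Q := by
    refine ⟨q.eval (Polynomial.C (r s)), q /ₘ (Polynomial.X - Polynomial.C (Polynomial.C (r s))), ?_⟩
    rw [← Polynomial.modByMonic_X_sub_C_eq_C_eval, Polynomial.modByMonic_add_div]
  have hQs : Q.evalEval s (r s) ≠ 0 := by
    rw [hQ] at hq'
    simpa [Polynomial.evalEval_add, Polynomial.evalEval_mul, Polynomial.evalEval_sub] using hq'
  have hq2 : ∀ x y, q.evalEval x y = φ.eval x + (y - r s) * Q.evalEval x y := by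
    intro x y
    rw [hQ]
    simp [Polynomial.evalEval_add, Polynomial.evalEval_mul, Polynomial.evalEval_sub,
      Polynomial.evalEval_C]
  have hc : ContinuousAt (fun x => Q.evalEval x (r x)) s :=
    ContinuousAt.comp (f := fun x => (x, r x)) (continuous_evalEval Q).continuousAt
      (continuousAt_id.prodMk hr)
  have hφ0 : φ.eval s = 0 := by
    have := hq.self_of_nhds
    rw [hq2] at this
    simpa using this
  have h1 := (hasDerivAt_mul_of_continuousAt (φ.hasDerivAt s) hφ0
    (hc.inv₀ hQs)).const_sub (r s)
  refine (h1.congr_of_eventuallyEq ?_).differentiableAt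
  filter_upwards [hq, hc.eventually_ne hQs] with x hx hne
  rw [hq2] at hx
  have h2 : (Polynomial.evalEval x (r x) Q) * (Polynomial.evalEval x (r x) Q)⁻¹ = 1 :=
    mul_inv_cancel₀ hne
  simp only [Pi.inv_apply]
  linear_combination (-(r x - r s)) * h2 + (Polynomial.evalEval x (r x) Q)⁻¹ * hx

open Filter Topology in
/-- Continuous roots of a nonzero polynomial over `ℂ[X]` are differentiable off a finite set. -/
lemma exists_finite_differentiableAt_root (p : Polynomial (Polynomial ℂ)) (hp : p ≠ 0) :
    ∃ T : Set ℂ, T.Finite ∧ ∀ s ∉ T, ∀ r : ℂ → ℂ, ContinuousAt r s →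
      (∀ᶠ x in 𝓝 s, p.evalEval x (r x) = 0) → DifferentiableAt ℂ r s := by
  let K := FractionRing (Polynomial ℂ)
  let ι := algebraMap (Polynomial ℂ) K
  have hι : Function.Injective ι := IsFractionRing.injective _ _
  have hιp : Function.Injective (Polynomial.map ι) := Polynomial.map_injective _ hι
  have hden : ∀ P : Polynomial K, ∃ (b : Polynomial ℂ) (P' : Polynomial (Polynomial ℂ)),
      b ≠ 0 ∧ P'.map ι = Polynomial.C (ι b) * P := by
    intro P
    obtain ⟨b, hb, h⟩ := IsLocalization.integerNormalization_spec
      (nonZeroDivisors (Polynomial ℂ)) P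
    refine ⟨b, _, nonZeroDivisors.ne_zero hb, h.trans ?_⟩
    rw [← Polynomial.smul_eq_C_mul, algebraMap_smul]
  have hpK : p.map ι ≠ 0 := by rwa [Ne, Polynomial.map_eq_zero_iff hι]
  obtain ⟨q₀, n, hsq, -, H, hH⟩ := exists_squarefree_dvd_pow_of_ne_zero hpK
  have hsep : q₀.Separable := PerfectField.separable_iff_squarefree.2 hsq
  obtain ⟨a, b, hab⟩ := hsep
  obtain ⟨δ₁, q, hδ₁, hq⟩ := hden q₀
  obtain ⟨δ₂, a', hδ₂, ha'⟩ := hden a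
  obtain ⟨δ₃, b', hδ₃, hb'⟩ := hden b
  obtain ⟨δ₄, H', hδ₄, hH'⟩ := hden H
  have e1 : Polynomial.C δ₃ * a' * q + Polynomial.C δ₂ * b' * Polynomial.derivative q =
      Polynomial.C (δ₁ * δ₂ * δ₃) := by
    apply hιp
    simp only [Polynomial.map_add, Polynomial.map_mul, Polynomial.map_C, ← Polynomial.derivative_map,
      hq, ha', hb', Polynomial.derivative_C_mul, map_mul]
    linear_combination (Polynomial.C (ι δ₁) * Polynomial.C (ι δ₂) * Polynomial.C (ι δ₃)) * hab
  have e2 : Polynomial.C δ₄ * q ^ n = Polynomial.C (δ₁ ^ n) * (p * H') := by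
    apply hιp
    simp only [Polynomial.map_mul, Polynomial.map_C, Polynomial.map_pow, hq, hH', map_pow, mul_pow,
      hH]
    ring
  refine ⟨{s | (δ₁ * δ₂ * δ₃ * δ₄).IsRoot s}, Polynomial.finite_setOfPred_isRoot (by
    simp [hδ₁, hδ₂, hδ₃, hδ₄]), fun s hs r hr hpr => ?_⟩
  have hs' : δ₁.eval s ≠ 0 ∧ δ₂.eval s ≠ 0 ∧ δ₃.eval s ≠ 0 ∧ δ₄.eval s ≠ 0 := by
    simpa [and_assoc] using hs
  have hqr : ∀ᶠ x in 𝓝 s, q.evalEval x (r x) = 0 := by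
    filter_upwards [hpr, δ₄.continuous.continuousAt.eventually_ne hs'.2.2.2] with x hx hne
    have := congrArg (Polynomial.evalEval x (r x)) e2
    rw [Polynomial.evalEval_mul, Polynomial.evalEval_C, Polynomial.evalEval_mul,
      Polynomial.evalEval_mul, hx, zero_mul, mul_zero, Polynomial.evalEval_pow] at this
    exact eq_zero_of_pow_eq_zero ((mul_eq_zero.1 this).resolve_left hne)
  refine differentiableAt_of_simple_root q hr hqr fun h0 => ?_
  have := congrArg (Polynomial.evalEval s (r s)) e1
  rw [Polynomial.evalEval_add, Polynomial.evalEval_mul _ _ _ q,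
    Polynomial.evalEval_mul _ _ _ (Polynomial.derivative q), h0,
    hqr.self_of_nhds, Polynomial.evalEval_C, mul_zero, mul_zero, add_zero] at this
  simp [hs'.1, hs'.2.1, hs'.2.2.1] at this

/-- Polynomial functions on `ι → ℂ`. -/
def PolyFun {ι : Type} (φ : (ι → ℂ) → ℂ) : Prop := ∃ p : MvPolynomial ι ℂ, ∀ x, φ x = eval x p

namespace PolyFun

variable {ι κ : Type} {φ ψ : (ι → ℂ) → ℂ}

lemma eval (p : MvPolynomial ι ℂ) : PolyFun fun x => MvPolynomial.eval x p := ⟨p, fun _ => rfl⟩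

lemma const (a : ℂ) : PolyFun fun _ : ι → ℂ => a := ⟨C a, fun _ => (eval_C a).symm⟩

lemma coord (i : ι) : PolyFun fun x : ι → ℂ => x i := ⟨X i, fun _ => (eval_X i).symm⟩

lemma add (h : PolyFun φ) (h' : PolyFun ψ) : PolyFun fun x => φ x + ψ x := by
  obtain ⟨p, hp⟩ := h
  obtain ⟨q, hq⟩ := h'
  exact ⟨p + q, fun x => by simp only [hp, hq, map_add]⟩

lemma mul (h : PolyFun φ) (h' : PolyFun ψ) : PolyFun fun x => φ x * ψ x := by
  obtain ⟨p, hp⟩ := h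
  obtain ⟨q, hq⟩ := h'
  exact ⟨p * q, fun x => by simp only [hp, hq, map_mul]⟩

lemma neg (h : PolyFun φ) : PolyFun fun x => -φ x := by
  obtain ⟨p, hp⟩ := h
  exact ⟨-p, fun x => by simp only [hp, map_neg]⟩

lemma sub (h : PolyFun φ) (h' : PolyFun ψ) : PolyFun fun x => φ x - ψ x := by
  simpa only [sub_eq_add_neg] using h.add h'.neg

lemma pow (h : PolyFun φ) (n : ℕ) : PolyFun fun x => φ x ^ n := by
  obtain ⟨p, hp⟩ := h
  exact ⟨p ^ n, fun x => by simp only [hp, map_pow]⟩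

lemma sum {α : Type*} (s : Finset α) {f : α → (ι → ℂ) → ℂ} (h : ∀ a ∈ s, PolyFun (f a)) :
    PolyFun fun x => ∑ a ∈ s, f a x := by
  choose! p hp using h
  exact ⟨∑ a ∈ s, p a, fun x => by rw [map_sum]; exact Finset.sum_congr rfl fun a ha => hp a ha x⟩

lemma prod {α : Type*} (s : Finset α) {f : α → (ι → ℂ) → ℂ} (h : ∀ a ∈ s, PolyFun (f a)) :
    PolyFun fun x => ∏ a ∈ s, f a x := by
  choose! p hp using h
  exact ⟨∏ a ∈ s, p a, fun x => by rw [map_prod]; exact Finset.prod_congr rfl fun a ha => hp a ha x⟩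

lemma comp (h : PolyFun φ) {f : (κ → ℂ) → ι → ℂ} (hf : ∀ i, PolyFun fun x => f x i) :
    PolyFun fun x => φ (f x) := by
  obtain ⟨p, hp⟩ := h
  choose q hq using hf
  refine ⟨bind₁ q p, fun x => ?_⟩
  have hx : f x = fun i => MvPolynomial.eval x (q i) := funext fun i => hq i x
  change φ (f x) = _
  rw [hp, hx, ← coe_aeval_eq_eval, ← coe_aeval_eq_eval]
  change aeval _ p = aeval x (bind₁ q p)
  rw [aeval_bind₁]
  rfl

lemma polynomial_eval (P : Polynomial ℂ) (h : PolyFun φ) : PolyFun fun x => P.eval (φ x) := by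
  simp only [Polynomial.eval_eq_sum, Polynomial.sum]
  exact sum _ fun i _ => (const _).mul (h.pow i)

lemma exists_polynomial_line (h : PolyFun φ) (a b : ι → ℂ) :
    ∃ P : Polynomial ℂ, ∀ s : ℂ, φ (a + s • b) = P.eval s := by
  obtain ⟨p, hp⟩ := h
  refine ⟨aeval (fun i => Polynomial.C (a i) + Polynomial.X * Polynomial.C (b i)) p, fun s => ?_⟩
  rw [hp, ← Polynomial.coe_aeval_eq_eval, ← AlgHom.comp_apply, comp_aeval]
  change aeval _ p = _
  congr 2
  ext i
  rw [Pi.add_apply, Pi.smul_apply, smul_eq_mul, Polynomial.coe_aeval_eq_eval, Polynomial.eval_add,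
    Polynomial.eval_mul, Polynomial.eval_C, Polynomial.eval_C, Polynomial.eval_X]

lemma continuous (h : PolyFun φ) : Continuous φ := by
  obtain ⟨p, hp⟩ := h
  have h : φ = fun x => MvPolynomial.eval x p := funext hp
  rw [h]
  exact p.continuous_eval

/-- Polynomial functions are determined by generic values along lines. -/
lemma eq_of_eq_on {E : (ι → ℂ) → ℂ} (hφ : PolyFun φ) (hψ : PolyFun ψ) (hE : PolyFun E)
    (hne : ∃ w, E w ≠ 0) (h : ∀ w, E w ≠ 0 → φ w = ψ w) (w : ι → ℂ) : φ w = ψ w := by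
  obtain ⟨w₁, hw₁⟩ := hne
  obtain ⟨P, hP⟩ := hφ.exists_polynomial_line w (w₁ - w)
  obtain ⟨Q, hQ⟩ := hψ.exists_polynomial_line w (w₁ - w)
  obtain ⟨R, hR⟩ := hE.exists_polynomial_line w (w₁ - w)
  have hR0 : R ≠ 0 := by
    rintro rfl
    have := hR 1
    simp [hw₁] at this
  have h1 : R * (P - Q) = 0 := by
    refine Polynomial.funext fun s => ?_
    rw [Polynomial.eval_mul, Polynomial.eval_sub, ← hR, ← hP, ← hQ, Polynomial.eval_zero]
    by_cases hs : E (w + s • (w₁ - w)) = 0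
    · rw [hs, zero_mul]
    · rw [h _ hs, sub_self, mul_zero]
  have h2 := (mul_eq_zero.1 h1).resolve_left hR0
  have h3 := hP 0
  rw [sub_eq_zero.1 h2, ← hQ] at h3
  simpa using h3

lemma growth [Fintype ι] (h : PolyFun φ) :
    ∃ (K : ℝ) (N : ℕ), 0 ≤ K ∧ ∀ x, ‖φ x‖ ≤ K * (1 + ‖x‖) ^ N := by
  obtain ⟨p, hp⟩ := h
  simp only [hp]
  clear hp
  induction p using MvPolynomial.induction_on with
  | C a => exact ⟨‖a‖, 0, norm_nonneg _, fun x => by simp⟩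
  | add p q hp hq =>
    obtain ⟨K, N, hK, hp⟩ := hp
    obtain ⟨K', N', hK', hq⟩ := hq
    refine ⟨K + K', N + N', by positivity, fun x => ?_⟩
    have h1 : (1 : ℝ) ≤ 1 + ‖x‖ := by linarith [norm_nonneg x]
    rw [map_add]
    refine (norm_add_le _ _).trans ((add_le_add (hp x) (hq x)).trans ?_)
    rw [add_mul]
    gcongr <;> first | exact h1 | omega
  | mul_X p i hp =>
    obtain ⟨K, N, hK, hp⟩ := hp
    refine ⟨K, N + 1, hK, fun x => ?_⟩
    rw [map_mul, eval_X, norm_mul, pow_succ, ← mul_assoc]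
    gcongr
    · exact hp x
    · linarith [norm_le_pi_norm x i]

lemma of_lines_fin (n : ℕ) {E g : (Fin n → ℂ) → ℂ} (hE : PolyFun E) {M : ℕ}
    (hg : ∀ a b, ∃ P : Polynomial ℂ, P.natDegree ≤ M ∧
      ∀ s : ℂ, E (a + s • b) ≠ 0 → g (a + s • b) = P.eval s) :
    ∃ H, PolyFun H ∧ ∀ w, E w ≠ 0 → g w = H w := by
  classical
  induction n with
  | zero => exact ⟨fun _ => g 0, const _, fun w _ => by rw [Subsingleton.elim w 0]⟩
  | succ n ih =>
    by_cases hE0 : ∃ w, E w ≠ 0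
    swap
    · push Not at hE0
      exact ⟨fun _ => 0, const _, fun w hw => absurd (hE0 w) hw⟩
    obtain ⟨w₀, hw₀⟩ := hE0
    have hcons : ∀ (x : ℂ) (y : Fin n → ℂ), (Fin.cons x y : Fin (n + 1) → ℂ) =
        Fin.cons 0 y + x • Fin.cons 1 0 := by
      intro x y
      ext i
      refine Fin.cases ?_ (fun i => ?_) i <;> simp
    have hcons' : ∀ (x : ℂ) (a b : Fin n → ℂ) (s : ℂ),
        (Fin.cons x (a + s • b) : Fin (n + 1) → ℂ) = Fin.cons x a + s • Fin.cons 0 b := by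
      intro x a b s
      ext i
      refine Fin.cases ?_ (fun i => ?_) i <;> simp
    have hconsP : ∀ x, ∀ i, PolyFun fun y : Fin n → ℂ => (Fin.cons x y : Fin (n + 1) → ℂ) i := by
      intro x i
      refine Fin.cases ?_ (fun i => ?_) i
      · simpa using const x
      · simpa using coord i
    obtain ⟨R, hR⟩ := hE.exists_polynomial_line (Fin.cons 0 (Fin.tail w₀)) (Fin.cons 1 0)
    have hR0 : R ≠ 0 := by
      rintro rfl
      have := hR (w₀ 0)
      rw [← hcons, Fin.cons_self_tail] at this
      simp [hw₀] at this
    obtain ⟨S, hS, hScard⟩ : ∃ S : Finset ℂ, (∀ x ∈ S, E (Fin.cons x (Fin.tail w₀)) ≠ 0) ∧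
        S.card = M + 1 := by
      have hinf : {x | E (Fin.cons x (Fin.tail w₀)) ≠ 0}.Infinite := by
        have : {x | R.IsRoot x}.Finite := Polynomial.finite_setOfPred_isRoot hR0
        refine this.infinite_compl.mono fun x hx => ?_
        change E _ ≠ 0
        rw [hcons, hR]; exact hx
      obtain ⟨S, hS, hc⟩ := hinf.exists_subset_card_eq (M + 1)
      exact ⟨S, fun x hx => hS hx, hc⟩
    have hind : ∀ x : ℂ, ∃ H, PolyFun H ∧ ∀ y : Fin n → ℂ, E (Fin.cons x y) ≠ 0 →
        g (Fin.cons x y) = H y := by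
      intro x
      refine ih (E := fun y => E (Fin.cons x y)) (g := fun y => g (Fin.cons x y))
        (hE.comp (hconsP x)) fun a b => ?_
      obtain ⟨P, hP, hP'⟩ := hg (Fin.cons x a) (Fin.cons 0 b)
      exact ⟨P, hP, fun s hs => by rw [hcons'] at hs ⊢; exact hP' s hs⟩
    choose H hH hgH using hind
    let G : (Fin (n + 1) → ℂ) → ℂ := fun w =>
      ∑ x ∈ S, (Lagrange.basis S id x).eval (w 0) * H x (Fin.tail w)
    have htail : ∀ φ : (Fin n → ℂ) → ℂ, PolyFun φ → PolyFun fun w : Fin (n + 1) → ℂ =>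
        φ (Fin.tail w) := fun φ hφ => hφ.comp (f := fun w => Fin.tail w) fun i => coord i.succ
    have hG : PolyFun G := sum _ fun x _ => (polynomial_eval _ (coord 0)).mul (htail _ (hH x))
    have hgG : ∀ w, E w ≠ 0 → (∀ x ∈ S, E (Fin.cons x (Fin.tail w)) ≠ 0) → g w = G w := by
      intro w hw hwS
      obtain ⟨P, hP, hP'⟩ := hg (Fin.cons 0 (Fin.tail w)) (Fin.cons 1 0)
      simp only [← hcons] at hP'
      have h1 : P = Lagrange.interpolate S id fun x => H x (Fin.tail w) := by
        refine Lagrange.eq_interpolate_of_eval_eq _ Function.injective_id.injOn ?_ fun x hx => ?_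
        · rw [hScard]
          exact Polynomial.degree_le_natDegree.trans_lt (by exact_mod_cast Nat.lt_succ_of_le hP)
        · rw [id, ← hP' x (hwS x hx), hgH x _ (hwS x hx)]
      have h2 := hP' (w 0)
      rw [Fin.cons_self_tail] at h2
      rw [h2 hw, h1, Lagrange.interpolate_apply, Polynomial.eval_finsetSum]
      simp [G, mul_comm]
    refine ⟨G, hG, fun w hw => ?_⟩
    have hE' : PolyFun fun w => E w * ∏ x ∈ S, E (Fin.cons x (Fin.tail w)) :=
      hE.mul (prod _ fun x _ => htail _ (hE.comp (hconsP x)))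
    obtain ⟨P, -, hP⟩ := hg w (w₀ - w)
    obtain ⟨Q, hQ⟩ := hG.exists_polynomial_line w (w₀ - w)
    obtain ⟨R', hR'⟩ := hE'.exists_polynomial_line w (w₀ - w)
    have hR'0 : R' ≠ 0 := by
      rintro rfl
      have := hR' 1
      simp only [one_smul, add_sub_cancel, Polynomial.eval_zero, mul_eq_zero, hw₀, false_or] at this
      obtain ⟨x, hx, h⟩ := Finset.prod_eq_zero_iff.1 this
      exact hS x hx h
    have h1 : R' * (P - Q) = 0 := by
      refine Polynomial.funext fun s => ?_
      rw [Polynomial.eval_mul, Polynomial.eval_sub, ← hR', ← hQ, Polynomial.eval_zero]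
      by_cases hs : E (w + s • (w₀ - w)) * ∏ x ∈ S, E (Fin.cons x (Fin.tail (w + s • (w₀ - w)))) = 0
      · rw [hs, zero_mul]
      · obtain ⟨hs1, hs2⟩ := mul_ne_zero_iff.1 hs
        rw [← hP s hs1, hgG _ hs1 (Finset.prod_ne_zero_iff.1 hs2), sub_self, mul_zero]
    have h2 := sub_eq_zero.1 ((mul_eq_zero.1 h1).resolve_left hR'0)
    have h3 := hP 0
    rw [h2, ← hQ] at h3
    simp only [zero_smul, add_zero] at h3
    exact h3 hw

/-- A function that restricts on each line to a polynomial of bounded degree is polynomial. -/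
lemma of_lines [Fintype ι] {E g : (ι → ℂ) → ℂ} (hE : PolyFun E) {M : ℕ}
    (hg : ∀ a b, ∃ P : Polynomial ℂ, P.natDegree ≤ M ∧
      ∀ s : ℂ, E (a + s • b) ≠ 0 → g (a + s • b) = P.eval s) :
    ∃ H, PolyFun H ∧ ∀ w, E w ≠ 0 → g w = H w := by
  let e := Fintype.equivFin ι
  obtain ⟨H, hH, hgH⟩ := of_lines_fin (Fintype.card ι) (E := fun y => E (y ∘ e))
    (g := fun y => g (y ∘ e)) (hE.comp fun i => coord _) (M := M) fun a b => hg (a ∘ e) (b ∘ e)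
  refine ⟨fun w => H (w ∘ e.symm), hH.comp fun i => coord _, fun w hw => ?_⟩
  have := hgH (w ∘ e.symm)
  simp only [Function.comp_assoc, Equiv.symm_comp_self, Function.comp_id] at this
  exact this hw

end PolyFun

/-- The points of `V` on the affine-linear slice of parameter `w = (u, v)`, cut out by the
equations `xᵢ + uᵢ z + vᵢ = 0`. -/
def slice {k n : ℕ} (V : Set (Fin n → ℂ)) (x : Fin k → (Fin n → ℂ) → ℂ) (z : (Fin n → ℂ) → ℂ)
    (w : Fin k ⊕ Fin k → ℂ) : Set (Fin n → ℂ) :=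
  {y | y ∈ V ∧ ∀ i, x i y + w (Sum.inl i) * z y + w (Sum.inr i) = 0}

/-- The path `γ` of parameters avoids the zeros of `e` and lifts to a path from `y` to `y'` in the
slices. -/
def Transports {k n : ℕ} (V : Set (Fin n → ℂ)) (x : Fin k → (Fin n → ℂ) → ℂ) (z : (Fin n → ℂ) → ℂ)
    (e : (Fin k ⊕ Fin k → ℂ) → ℂ) {w w' : Fin k ⊕ Fin k → ℂ} (γ : Path w w') (y y' : Fin n → ℂ) :
    Prop :=
  ∃ Γ : Path y y', ∀ t, e (γ t) ≠ 0 ∧ Γ t ∈ slice V x z (γ t)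

/-- An irreducible affine variety `V` whose slices form a finite covering of `{e ≠ 0}`, with
polynomial control on the function `z`. -/
structure SliceCovering {k n : ℕ} (V : Set (Fin n → ℂ)) (x : Fin k → (Fin n → ℂ) → ℂ)
    (z : (Fin n → ℂ) → ℂ) (e : (Fin k ⊕ Fin k → ℂ) → ℂ) : Prop where
  irr : ∀ φ ψ : (Fin n → ℂ) → ℂ, PolyFun φ → PolyFun ψ → (∃ y ∈ V, φ y ≠ 0) → (∃ y ∈ V, ψ y ≠ 0) →
    ∃ y ∈ V, φ y ≠ 0 ∧ ψ y ≠ 0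
  polyFun_x : ∀ i, PolyFun (x i)
  polyFun_z : PolyFun z
  polyFun_e : PolyFun e
  e_zero : e 0 ≠ 0
  finite : ∀ w, e w ≠ 0 → (slice V x z w).Finite
  sections : ∀ w₀, e w₀ ≠ 0 → ∃ r > 0, ∃ σ : (Fin n → ℂ) → (Fin k ⊕ Fin k → ℂ) → Fin n → ℂ,
    (∀ w ∈ Metric.ball w₀ r, e w ≠ 0) ∧
    (∀ y ∈ slice V x z w₀, ContinuousOn (σ y) (Metric.ball w₀ r) ∧ σ y w₀ = y) ∧
    ∀ w ∈ Metric.ball w₀ r, Set.BijOn (fun y => σ y w) (slice V x z w₀) (slice V x z w)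
  lift : ∀ {w w'} (γ : Path w w'), (∀ t, e (γ t) ≠ 0) → ∀ y ∈ slice V x z w,
    ∃ y', Transports V x z e γ y y'
  lift_unique : ∀ {w w'} (γ : Path w w') {y y₁ y₂}, Transports V x z e γ y y₁ →
    Transports V x z e γ y y₂ → y₁ = y₂
  relation : ∃ (κ : (Fin k ⊕ Fin k → ℂ) → ℂ) (N : ℕ) (a : ℕ → (Fin k ⊕ Fin k → ℂ) → ℂ),
    PolyFun κ ∧ (∀ j, PolyFun (a j)) ∧ ∀ w, e w ≠ 0 → κ w ≠ 0 ∧ ∀ y ∈ slice V x z w,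
      κ w * z y ^ N + ∑ j ∈ Finset.range N, a j w * z y ^ j = 0
  bound : ∃ C : ℝ, 0 ≤ C ∧ ∀ y ∈ V, ‖z y‖ ≤ C * (1 + ‖fun i => x i y‖)

namespace Transports

variable {k n : ℕ} {V : Set (Fin n → ℂ)} {x : Fin k → (Fin n → ℂ) → ℂ} {z : (Fin n → ℂ) → ℂ}
  {e : (Fin k ⊕ Fin k → ℂ) → ℂ} {w w' w'' : Fin k ⊕ Fin k → ℂ} {γ : Path w w'}
  {y y' y'' : Fin n → ℂ}

lemma trans (h : Transports V x z e γ y y') {γ' : Path w' w''}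
    (h' : Transports V x z e γ' y' y'') : Transports V x z e (γ.trans γ') y y'' := by
  obtain ⟨Γ, hΓ⟩ := h
  obtain ⟨Γ', hΓ'⟩ := h'
  refine ⟨Γ.trans Γ', fun t => ?_⟩
  rw [Path.trans_apply, Path.trans_apply]
  split_ifs
  · exact hΓ _
  · exact hΓ' _

lemma symm (h : Transports V x z e γ y y') : Transports V x z e γ.symm y' y := by
  obtain ⟨Γ, hΓ⟩ := h
  exact ⟨Γ.symm, fun t => hΓ _⟩

lemma mem_right (h : Transports V x z e γ y y') : y' ∈ slice V x z w' := by
  obtain ⟨Γ, hΓ⟩ := h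
  simpa using (hΓ 1).2

lemma refl (hw : e w ≠ 0) (hy : y ∈ slice V x z w) : Transports V x z e (Path.refl w) y y :=
  ⟨Path.refl y, fun t => by simpa using ⟨hw, hy⟩⟩

end Transports

namespace SliceCovering

variable {k n : ℕ} {V : Set (Fin n → ℂ)} {x : Fin k → (Fin n → ℂ) → ℂ} {z : (Fin n → ℂ) → ℂ}
  {e : (Fin k ⊕ Fin k → ℂ) → ℂ}

/-- A relation on the points of a slice which is invariant under transport along paths. -/
def Invariant (V : Set (Fin n → ℂ)) (x : Fin k → (Fin n → ℂ) → ℂ) (z : (Fin n → ℂ) → ℂ)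
    (e : (Fin k ⊕ Fin k → ℂ) → ℂ)
    (R : (Fin k ⊕ Fin k → ℂ) → (Fin n → ℂ) → (Fin n → ℂ) → Prop) : Prop :=
  ∀ ⦃w w'⦄ (γ : Path w w') ⦃y₁ y₁' y₂ y₂'⦄, Transports V x z e γ y₁ y₁' →
    Transports V x z e γ y₂ y₂' → (R w y₁ y₂ ↔ R w' y₁' y₂')

lemma Invariant.not {R : (Fin k ⊕ Fin k → ℂ) → (Fin n → ℂ) → (Fin n → ℂ) → Prop}
    (h : Invariant V x z e R) : Invariant V x z e fun w y y' => ¬ R w y y' :=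
  fun _ _ γ _ _ _ _ h₁ h₂ => not_congr (h γ h₁ h₂)

lemma invariant_eq (A : SliceCovering V x z e) : Invariant V x z e fun _ y y' => y = y' := by
  intro w w' γ y₁ y₁' y₂ y₂' h₁ h₂
  constructor
  · rintro rfl
    exact A.lift_unique γ h₁ h₂
  · rintro rfl
    exact A.lift_unique γ.symm h₁.symm h₂.symm

/-- Local sections, compatible with invariant relations. -/
lemma exists_sections (A : SliceCovering V x z e)
    {w₀ : Fin k ⊕ Fin k → ℂ} (hw₀ : e w₀ ≠ 0) :
    ∃ r > 0, ∃ σ : (Fin n → ℂ) → (Fin k ⊕ Fin k → ℂ) → Fin n → ℂ,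
    (∀ w ∈ Metric.ball w₀ r, e w ≠ 0) ∧
    (∀ y ∈ slice V x z w₀, ContinuousOn (σ y) (Metric.ball w₀ r) ∧ σ y w₀ = y) ∧
    (∀ w ∈ Metric.ball w₀ r, Set.BijOn (fun y => σ y w) (slice V x z w₀) (slice V x z w)) ∧
    ∀ w ∈ Metric.ball w₀ r, ∃ γ : Path w₀ w, (∀ t, γ t ∈ Metric.ball w₀ r) ∧
      ∀ y ∈ slice V x z w₀, Transports V x z e γ y (σ y w) := by
  obtain ⟨r, hr, σ, h1, h2, h3⟩ := A.sections w₀ hw₀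
  refine ⟨r, hr, σ, h1, h2, h3, fun w hw => ?_⟩
  have hpc : IsPathConnected (Metric.ball w₀ r) :=
    (convex_ball w₀ r).isPathConnected ⟨w₀, Metric.mem_ball_self hr⟩
  obtain ⟨γ, hγ⟩ := hpc.joinedIn w₀ (Metric.mem_ball_self hr) w hw
  refine ⟨γ, hγ, fun y hy => ?_⟩
  refine ⟨⟨⟨fun t => σ y (γ t), (h2 y hy).1.comp_continuous γ.continuous hγ⟩, ?_, ?_⟩, fun t => ?_⟩
  · simp [(h2 y hy).2]
  · simp
  · exact ⟨h1 _ (hγ t), (h3 _ (hγ t)).mapsTo hy⟩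

lemma exists_polynomial_comp_line {ι κ : Type} {φ : (ι → ℂ) → ℂ} (h : PolyFun φ)
    {w : (κ → ℂ) → ι → ℂ} (hw : ∀ i, PolyFun fun p => w p i) (a b : κ → ℂ) :
    ∃ P : Polynomial ℂ, ∀ s : ℂ, φ (w (a + s • b)) = P.eval s :=
  (h.comp hw).exists_polynomial_line a b

lemma isPathConnected_ne_zero {ι : Type} [Fintype ι] {φ : (ι → ℂ) → ℂ} (h : PolyFun φ)
    (hne : ∃ w, φ w ≠ 0) : IsPathConnected {w | φ w ≠ 0} := by
  obtain ⟨w₀, hw₀⟩ := hne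
  refine ⟨w₀, hw₀, fun {w} hw => ?_⟩
  obtain ⟨P, hP⟩ := h.exists_polynomial_line w₀ (w - w₀)
  have hP0 : P ≠ 0 := by
    rintro rfl
    have := hP 0
    simp [hw₀] at this
  have hpc : IsPathConnected ({s | P.IsRoot s}ᶜ : Set ℂ) :=
    (Polynomial.finite_setOfPred_isRoot hP0).countable.isPathConnected_compl_of_one_lt_rank
      (by rw [Complex.rank_real_complex]; norm_num)
  have hj := hpc.joinedIn 0 (fun h0 => hw₀ (by simpa [h0.eq_zero] using hP 0)) 1
    (fun h1 => hw (by simpa [h1.eq_zero] using hP 1))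
  obtain ⟨γ, hγ⟩ := hj
  refine ⟨⟨⟨fun t => w₀ + γ t • (w - w₀), by fun_prop⟩, by simp, by simp⟩, fun t => ?_⟩
  intro h0
  exact hγ t ((hP _).symm.trans h0)

lemma ncard_slice (A : SliceCovering V x z e) {w : Fin k ⊕ Fin k → ℂ} (hw : e w ≠ 0) :
    (slice V x z w).ncard = (slice V x z 0).ncard := by
  obtain ⟨γ, hγ⟩ := (isPathConnected_ne_zero A.polyFun_e ⟨0, A.e_zero⟩).joinedIn 0 A.e_zero w hw
  choose! τ hτ using A.lift γ hγ
  have hinj : Set.InjOn τ (slice V x z 0) := fun y hy y' hy' h =>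
    A.lift_unique γ.symm (hτ y hy).symm (h ▸ (hτ y' hy').symm)
  have himg : τ '' slice V x z 0 = slice V x z w := by
    ext y
    constructor
    · rintro ⟨y', hy', rfl⟩
      exact (hτ y' hy').mem_right
    · intro hy
      obtain ⟨y', hy'⟩ := A.lift γ.symm (fun t => hγ _) y hy
      exact ⟨y', hy'.mem_right, A.lift_unique γ (hτ _ hy'.mem_right)
        (by simpa using hy'.symm)⟩
  rw [← himg, hinj.ncard_image]

/-- Along polynomial curves the function `z` is differentiable on continuous families of points of
the slices, away from finitely many parameters. -/
lemma exists_finite_differentiableAt (A : SliceCovering V x z e) {w : ℂ → Fin k ⊕ Fin k → ℂ}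
    (hw : ∀ φ : (Fin k ⊕ Fin k → ℂ) → ℂ, PolyFun φ →
      ∃ P : Polynomial ℂ, ∀ s : ℂ, φ (w s) = P.eval s) (hne : ∃ s, e (w s) ≠ 0) :
    ∃ T : Set ℂ, T.Finite ∧ ∀ s ∉ T, ∀ r : ℂ → Fin n → ℂ, ContinuousAt r s →
      (∀ᶠ t in nhds s, e (w t) ≠ 0 ∧ r t ∈ slice V x z (w t)) →
      DifferentiableAt ℂ (fun t => z (r t)) s := by
  obtain ⟨κ, N, a, hκ, ha, hrel⟩ := A.relation
  obtain ⟨K, hK⟩ := hw κ hκ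
  choose a' ha' using fun j => hw (a j) (ha j)
  obtain ⟨s₀, hs₀⟩ := hne
  let p : Polynomial (Polynomial ℂ) := Polynomial.C K * Polynomial.X ^ N +
    ∑ j ∈ Finset.range N, Polynomial.C (a' j) * Polynomial.X ^ j
  have hp : p ≠ 0 := by
    intro h0
    have h1 : p.coeff N = K := by
      simp only [p, Polynomial.coeff_add, Polynomial.coeff_C_mul, Polynomial.coeff_X_pow,
        Polynomial.finsetSum_coeff, if_true, mul_one]
      rw [Finset.sum_eq_zero, add_zero]
      intro j hj
      rw [if_neg (Finset.mem_range.1 hj).ne', mul_zero]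
    rw [h0, Polynomial.coeff_zero] at h1
    have := hK s₀
    rw [← h1, Polynomial.eval_zero] at this
    exact (hrel _ hs₀).1 this
  obtain ⟨T, hT, h⟩ := exists_finite_differentiableAt_root p hp
  refine ⟨T, hT, fun s hs r hr hev => h s hs _ ?_ ?_⟩
  · exact A.polyFun_z.continuous.continuousAt.comp hr
  · filter_upwards [hev] with t ht
    have := (hrel _ ht.1).2 _ ht.2
    simp only [p, Polynomial.evalEval, Polynomial.eval_add, Polynomial.eval_mul, Polynomial.eval_C,
      Polynomial.eval_pow, Polynomial.eval_X, Polynomial.eval_finsetSum]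
    simpa only [hK, ha'] using this

lemma exists_growth (A : SliceCovering V x z e) :
    ∃ κ : (Fin k ⊕ Fin k → ℂ) → ℂ, PolyFun κ ∧ (∀ w, e w ≠ 0 → κ w ≠ 0) ∧
      ∃ (K : ℝ) (M : ℕ), 0 ≤ K ∧ ∀ w, e w ≠ 0 → ∀ y ∈ slice V x z w,
        ‖κ w * z y‖ ≤ K * (1 + ‖w‖) ^ M := by
  obtain ⟨κ, N, a, hκ, ha, hrel⟩ := A.relation
  refine ⟨κ, hκ, fun w hw => (hrel w hw).1, ?_⟩
  choose K M hK hKM using fun j => ((ha j).mul (hκ.pow (N - 1 - j))).growth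
  refine ⟨1 + ∑ j ∈ Finset.range N, K j, ∑ j ∈ Finset.range N, M j,
    add_nonneg zero_le_one (Finset.sum_nonneg fun j _ => hK j), fun w hw y hy => ?_⟩
  obtain ⟨h0, h1⟩ := hrel w hw
  replace h1 := h1 y hy
  have hw1 : (1 : ℝ) ≤ 1 + ‖w‖ := by linarith [norm_nonneg w]
  have hsum : ∑ j ∈ Finset.range N, ‖a j w * κ w ^ (N - 1 - j)‖ ≤
      (∑ j ∈ Finset.range N, K j) * (1 + ‖w‖) ^ ∑ j ∈ Finset.range N, M j := by
    rw [Finset.sum_mul]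
    refine Finset.sum_le_sum fun j hj => (hKM j w).trans ?_
    exact mul_le_mul_of_nonneg_left (pow_le_pow_right₀ hw1
      (Finset.single_le_sum (f := M) (fun _ _ => Nat.zero_le _) hj)) (hK j)
  have hgoal : ‖κ w * z y‖ ≤ 1 + ∑ j ∈ Finset.range N, ‖a j w * κ w ^ (N - 1 - j)‖ := by
    by_contra! hcon
    have hnn : 0 ≤ ∑ j ∈ Finset.range N, ‖a j w * κ w ^ (N - 1 - j)‖ :=
      Finset.sum_nonneg fun _ _ => norm_nonneg _
    rcases N with _ | N
    · simp [h0] at h1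
    set q := κ w * z y
    have h2 : q ^ (N + 1) = -∑ j ∈ Finset.range (N + 1), a j w * κ w ^ (N + 1 - 1 - j) * q ^ j := by
      have : q ^ (N + 1) = κ w ^ N * (κ w * z y ^ (N + 1)) := by simp only [q]; ring
      rw [this, eq_neg_of_add_eq_zero_left h1, mul_neg, Finset.mul_sum]
      congr 1
      refine Finset.sum_congr rfl fun j hj => ?_
      have hj' : N = (N - j) + j := by have := Finset.mem_range.1 hj; omega
      rw [Nat.add_sub_cancel, mul_pow]
      nth_rewrite 1 [hj']
      ring
    have h3 : ‖q‖ ^ (N + 1) ≤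
        (∑ j ∈ Finset.range (N + 1), ‖a j w * κ w ^ (N + 1 - 1 - j)‖) * ‖q‖ ^ N := by
      rw [← norm_pow, h2, norm_neg, Finset.sum_mul]
      refine (norm_sum_le _ _).trans (Finset.sum_le_sum fun j hj => ?_)
      rw [norm_mul _ (q ^ j), norm_pow]
      exact mul_le_mul_of_nonneg_left (pow_le_pow_right₀ (by linarith)
        (Nat.lt_succ_iff.1 (Finset.mem_range.1 hj))) (norm_nonneg _)
    rw [pow_succ'] at h3
    have := le_of_mul_le_mul_right h3 (pow_pos (by linarith) _)
    linarith
  refine hgoal.trans ?_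
  rw [add_mul, one_mul]
  exact add_le_add (one_le_pow₀ hw1) hsum

end SliceCovering

namespace SliceCovering

variable {k n : ℕ} {V : Set (Fin n → ℂ)} {x : Fin k → (Fin n → ℂ) → ℂ} {z : (Fin n → ℂ) → ℂ}
  {e : (Fin k ⊕ Fin k → ℂ) → ℂ}

open Classical in
/-- The product of `c (X - z y - t z y')` over the related pairs `(y, y')` of points of a slice. -/
def pairProd (V : Set (Fin n → ℂ)) (x : Fin k → (Fin n → ℂ) → ℂ) (z : (Fin n → ℂ) → ℂ)
    (R : (Fin k ⊕ Fin k → ℂ) → (Fin n → ℂ) → (Fin n → ℂ) → Prop) (t : ℂ)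
    (w : Fin k ⊕ Fin k → ℂ) (c X : ℂ) : ℂ :=
  ∏ᶠ q ∈ slice V x z w ×ˢ slice V x z w, if R w q.1 q.2 then c * (X - z q.1 - t * z q.2) else 1

variable {R : (Fin k ⊕ Fin k → ℂ) → (Fin n → ℂ) → (Fin n → ℂ) → Prop} {t : ℂ}

open Classical in
lemma pairProd_eq_prod (A : SliceCovering V x z e) {w : Fin k ⊕ Fin k → ℂ} (hw : e w ≠ 0) (c X : ℂ) :
    pairProd V x z R t w c X = ∏ q ∈ ((A.finite w hw).prod (A.finite w hw)).toFinset,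
      if R w q.1 q.2 then c * (X - z q.1 - t * z q.2) else 1 :=
  finprod_mem_eq_finite_toFinset_prod _ _

lemma pairProd_ne_zero_iff (A : SliceCovering V x z e) {w : Fin k ⊕ Fin k → ℂ} (hw : e w ≠ 0)
    {c : ℂ} (hc : c ≠ 0) (X : ℂ) : pairProd V x z R t w c X ≠ 0 ↔
      ∀ y ∈ slice V x z w, ∀ y' ∈ slice V x z w, R w y y' → X ≠ z y + t * z y' := by
  classical
  rw [pairProd_eq_prod A hw, Finset.prod_ne_zero_iff]
  simp only [Set.Finite.mem_toFinset, Set.mem_prod, Prod.forall, and_imp]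
  constructor
  · intro h y hy y' hy' hR hX
    have := h y y' hy hy'
    rw [if_pos hR, hX] at this
    exact this (by ring)
  · intro h y y' hy hy'
    split_ifs with hR
    · refine mul_ne_zero hc fun h0 => h y hy y' hy' hR ?_
      linear_combination h0
    · exact one_ne_zero

lemma norm_pairProd_le (A : SliceCovering V x z e) {w : Fin k ⊕ Fin k → ℂ} (hw : e w ≠ 0)
    {c X : ℂ} {B : ℝ} (hB : 1 ≤ B) (h : ∀ y ∈ slice V x z w, ∀ y' ∈ slice V x z w, R w y y' →
      ‖c * (X - z y - t * z y')‖ ≤ B) :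
    ‖pairProd V x z R t w c X‖ ≤ B ^ ((slice V x z 0).ncard * (slice V x z 0).ncard) := by
  classical
  rw [pairProd_eq_prod A hw, norm_prod]
  refine (Finset.prod_le_prod (fun _ _ => norm_nonneg _) (g := fun _ => B) ?_).trans (le_of_eq ?_)
  · intro q hq
    rw [Set.Finite.mem_toFinset] at hq
    split_ifs with hR
    · exact h _ hq.1 _ hq.2 hR
    · simpa using hB
  · rw [Finset.prod_const, ← Set.ncard_eq_toFinset_card _ ((A.finite w hw).prod (A.finite w hw)),
      Set.ncard_prod, A.ncard_slice hw]

/-- Products over invariant pairs of points are polynomial in the parameters. -/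
lemma polyFun_pairProd (A : SliceCovering V x z e) (hR : Invariant V x z e R) (t : ℂ) {ι : Type}
    [Fintype ι] {w : (ι → ℂ) → Fin k ⊕ Fin k → ℂ} (hw : ∀ i, PolyFun fun p => w p i)
    {c X : (ι → ℂ) → ℂ} (hc : PolyFun c) (hX : PolyFun X) {K : ℝ} {M : ℕ}
    (hK : ∀ p, e (w p) ≠ 0 → ∀ y ∈ slice V x z (w p), ‖c p * z y‖ ≤ K * (1 + ‖p‖) ^ M) :
    ∃ H : (ι → ℂ) → ℂ, PolyFun H ∧
      ∀ p, e (w p) ≠ 0 → pairProd V x z R t (w p) (c p) (X p) = H p := by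
  classical
  obtain ⟨K₁, M₁, hK₁, hg⟩ := (hc.mul hX).growth
  set d := (slice V x z 0).ncard * (slice V x z 0).ncard
  set B : ℝ := 1 + K₁ + |K| + ‖t‖ * |K| with hB
  have hB1 : 1 ≤ B := by
    have : 0 ≤ ‖t‖ * |K| := by positivity
    have := abs_nonneg K
    linarith
  have hgrowth : ∀ p, e (w p) ≠ 0 → ‖pairProd V x z R t (w p) (c p) (X p)‖ ≤
      B ^ d * (1 + ‖p‖) ^ ((M + M₁) * d) := by
    intro p hp
    have h1 : (1 : ℝ) ≤ 1 + ‖p‖ := by linarith [norm_nonneg p]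
    have h2 : (1 : ℝ) ≤ (1 + ‖p‖) ^ (M + M₁) := one_le_pow₀ h1
    rw [pow_mul (1 + ‖p‖), ← mul_pow]
    refine norm_pairProd_le A hp (one_le_mul_of_one_le_of_one_le hB1 h2) fun y hy y' hy' _ => ?_
    have hle : ∀ y ∈ slice V x z (w p), ‖c p * z y‖ ≤ |K| * (1 + ‖p‖) ^ (M + M₁) := fun y hy =>
      (hK p hp y hy).trans (mul_le_mul (le_abs_self K) (pow_le_pow_right₀ h1 (by omega))
        (by positivity) (abs_nonneg K))
    have hle1 : ‖c p * X p‖ ≤ K₁ * (1 + ‖p‖) ^ (M + M₁) :=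
      (hg p).trans (mul_le_mul_of_nonneg_left (pow_le_pow_right₀ h1 (by omega)) hK₁)
    have : c p * (X p - z y - t * z y') = c p * X p - c p * z y - t * (c p * z y') := by ring
    rw [this]
    calc _ ≤ ‖c p * X p‖ + ‖c p * z y‖ + ‖t‖ * ‖c p * z y'‖ := by
          refine (norm_sub_le _ _).trans (add_le_add (norm_sub_le _ _) (norm_mul _ _).le)
      _ ≤ K₁ * (1 + ‖p‖) ^ (M + M₁) + |K| * (1 + ‖p‖) ^ (M + M₁) +
          ‖t‖ * (|K| * (1 + ‖p‖) ^ (M + M₁)) := by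
          gcongr
          · exact hle y hy
          · exact hle y' hy'
      _ ≤ _ := by rw [hB]; linarith
  refine PolyFun.of_lines (E := fun p => e (w p)) (A.polyFun_e.comp hw) (M := (M + M₁) * d)
    fun a b => ?_
  by_cases hne : ∃ s : ℂ, e (w (a + s • b)) ≠ 0
  swap
  · push Not at hne
    exact ⟨0, by simp, fun s hs => absurd (hne s) hs⟩
  set L : ℂ → ι → ℂ := fun s => a + s • b with hL
  have hLc : Continuous L := by fun_prop
  have hwc : Continuous fun s => w (L s) :=
    continuous_pi fun i => ((hw i).continuous).comp hLc
  obtain ⟨P, hP⟩ := exists_polynomial_comp_line A.polyFun_e hw a b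
  have hP0 : P ≠ 0 := by
    rintro rfl
    obtain ⟨s, hs⟩ := hne
    exact hs (by simpa using hP s)
  have hT : {s | e (w (L s)) = 0}.Finite := by
    refine (Polynomial.finite_setOfPred_isRoot hP0).subset fun s hs => ?_
    exact (hP s).symm.trans hs
  obtain ⟨T', hT', hdiff⟩ := A.exists_finite_differentiableAt (w := fun s => w (L s))
    (fun φ hφ => exists_polynomial_comp_line hφ hw a b) hne
  have hloc : ∀ s, e (w (L s)) ≠ 0 → ∃ (I : Finset ((Fin n → ℂ) × (Fin n → ℂ)))
      (r : (Fin n → ℂ) → ℂ → Fin n → ℂ), (∀ q ∈ I, q.1 ∈ slice V x z (w (L s)) ∧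
        q.2 ∈ slice V x z (w (L s))) ∧ (∀ y ∈ slice V x z (w (L s)), ContinuousAt (r y) s ∧
      ∀ᶠ s' in nhds s, e (w (L s')) ≠ 0 ∧ r y s' ∈ slice V x z (w (L s'))) ∧
      ∀ᶠ s' in nhds s, pairProd V x z R t (w (L s')) (c (L s')) (X (L s')) =
        ∏ q ∈ I, if R (w (L s)) q.1 q.2 then
          c (L s') * (X (L s') - z (r q.1 s') - t * z (r q.2 s')) else 1 := by
    intro s hs
    obtain ⟨ρ, hρ, σ, h1, h2, h3, h4⟩ := A.exists_sections hs
    have hball : ∀ᶠ s' in nhds s, w (L s') ∈ Metric.ball (w (L s)) ρ :=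
      hwc.continuousAt.eventually (Metric.ball_mem_nhds _ hρ)
    refine ⟨((A.finite _ hs).prod (A.finite _ hs)).toFinset, fun y s' => σ y (w (L s')), ?_,
      fun y hy => ⟨?_, ?_⟩, ?_⟩
    · intro q hq
      rwa [Set.Finite.mem_toFinset] at hq
    · exact ((h2 y hy).1.continuousAt (Metric.ball_mem_nhds _ hρ)).comp
        (f := fun s' => w (L s')) hwc.continuousAt
    · filter_upwards [hball] with s' hs'
      exact ⟨h1 _ hs', (h3 _ hs').mapsTo hy⟩
    · filter_upwards [hball] with s' hs'
      obtain ⟨γ, -, hγ⟩ := h4 _ hs'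
      rw [← finprod_mem_eq_finite_toFinset_prod, pairProd]
      symm
      refine finprod_mem_eq_of_bijOn (fun q => (σ q.1 (w (L s')), σ q.2 (w (L s')))) ?_ ?_
      · have hb := h3 _ hs'
        refine ⟨fun q hq => ⟨hb.mapsTo hq.1, hb.mapsTo hq.2⟩, fun q hq q' hq' h => ?_, ?_⟩
        · rw [Prod.mk.injEq] at h
          exact Prod.ext (hb.injOn hq.1 hq'.1 h.1) (hb.injOn hq.2 hq'.2 h.2)
        · rintro ⟨y, y'⟩ ⟨hy, hy'⟩
          obtain ⟨a, ha, rfl⟩ := hb.surjOn hy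
          obtain ⟨a', ha', rfl⟩ := hb.surjOn hy'
          exact ⟨(a, a'), ⟨ha, ha'⟩, rfl⟩
      · intro q hq
        simp only [hR γ (hγ _ hq.1) (hγ _ hq.2)]
  have hcL : ∀ φ : (ι → ℂ) → ℂ, PolyFun φ → Differentiable ℂ fun s => φ (L s) := by
    intro φ hφ
    obtain ⟨Q, hQ⟩ := hφ.exists_polynomial_line a b
    rw [funext hQ]
    exact Q.differentiable
  refine (fun ⟨Q, hQd, hQ⟩ => ⟨Q, hQd, fun s hs => hQ s hs⟩ : _ → _)
    (exists_polynomial_of_growth_off_finite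
    (g := fun s => pairProd V x z R t (w (L s)) (c (L s)) (X (L s)))
    (K := B ^ d * (1 + ‖a‖ + ‖b‖) ^ ((M + M₁) * d)) (M := (M + M₁) * d) hT (hT'.union hT)
    (fun s hs => ?_) (fun s hs => ?_) (fun s hs => ?_))
  · obtain ⟨I, r, hI, hr, hev⟩ := hloc s hs
    refine ContinuousAt.congr ?_ (hev.mono fun _ h => h.symm)
    refine tendsto_finsetProd _ fun q hq => ?_
    obtain ⟨hq1, hq2⟩ := hI q hq
    have hzc := A.polyFun_z.continuous
    split_ifs with h
    · exact ((hcL c hc).continuous.continuousAt).mul ((((hcL X hX).continuous.continuousAt).sub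
        (hzc.continuousAt.comp (hr _ hq1).1)).sub
        (continuousAt_const.mul (hzc.continuousAt.comp (hr _ hq2).1)))
    · exact continuousAt_const
  · rw [Set.mem_union, not_or] at hs
    obtain ⟨I, r, hI, hr, hev⟩ := hloc s hs.2
    refine DifferentiableAt.congr_of_eventuallyEq ?_ hev
    refine DifferentiableAt.fun_finsetProd fun q hq => ?_
    obtain ⟨hq1, hq2⟩ := hI q hq
    split_ifs with h
    · exact ((hcL c hc) s).mul ((((hcL X hX) s).sub
        (hdiff s hs.1 _ (hr _ hq1).1 (hr _ hq1).2)).sub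
        ((differentiableAt_const _).mul (hdiff s hs.1 _ (hr _ hq2).1 (hr _ hq2).2)))
    · exact differentiableAt_const _
  · refine (hgrowth (L s) hs).trans ?_
    rw [mul_assoc, ← mul_pow]
    have h1 : ‖L s‖ ≤ ‖a‖ + ‖s‖ * ‖b‖ := (norm_add_le _ _).trans (by rw [norm_smul])
    gcongr
    nlinarith [norm_nonneg a, norm_nonneg b, norm_nonneg s, mul_nonneg (norm_nonneg a) (norm_nonneg s)]

end SliceCovering

/-- Clearing denominators in a polynomial function. -/
lemma PolyFun.exists_clear_denom {ι κ : Type} {H : (ι → ℂ) → ℂ} (hH : PolyFun H)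
    {ν : (κ → ℂ) → ℂ} (hν : PolyFun ν) {f : ι → (κ → ℂ) → ℂ} (hf : ∀ i, PolyFun (f i)) :
    ∃ (N : ℕ) (φ : (κ → ℂ) → ℂ), PolyFun φ ∧
      ∀ q, ν q ≠ 0 → φ q = ν q ^ N * H fun i => f i q / ν q := by
  obtain ⟨p, hp⟩ := hH
  obtain rfl : H = fun x => MvPolynomial.eval x p := funext hp
  clear hp
  induction p using MvPolynomial.induction_on with
  | C a => exact ⟨0, fun _ => a, PolyFun.const a, fun q _ => by simp⟩
  | add p p' hp hp' =>
    obtain ⟨N, φ, hφ, h⟩ := hp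
    obtain ⟨N', φ', hφ', h'⟩ := hp'
    refine ⟨N + N', fun q => ν q ^ N' * φ q + ν q ^ N * φ' q,
      ((hν.pow _).mul hφ).add ((hν.pow _).mul hφ'), fun q hq => ?_⟩
    beta_reduce
    rw [h q hq, h' q hq, map_add]
    ring
  | mul_X p i hp =>
    obtain ⟨N, φ, hφ, h⟩ := hp
    refine ⟨N + 1, fun q => φ q * f i q, hφ.mul (hf i), fun q hq => ?_⟩
    beta_reduce
    rw [h q hq, map_mul, eval_X]
    field_simp
    ring

lemma Set.Finite.exists_injOn_add_mul {S : Set ℂ} (hS : S.Finite) :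
    ∃ t : ℂ, ∀ a ∈ S, ∀ b ∈ S, ∀ a' ∈ S, ∀ b' ∈ S, a + t * b = a' + t * b' → a = a' ∧ b = b' := by
  have hfin : ((fun q : (ℂ × ℂ) × (ℂ × ℂ) => (q.2.1 - q.1.1) / (q.1.2 - q.2.2)) ''
      ((S ×ˢ S) ×ˢ (S ×ˢ S))).Finite := ((hS.prod hS).prod (hS.prod hS)).image _
  obtain ⟨t, ht⟩ := hfin.infinite_compl.nonempty
  refine ⟨t, fun a ha b hb a' ha' b' hb' h => ?_⟩
  by_cases hbb : b = b'
  · subst hbb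
    exact ⟨add_right_cancel h, rfl⟩
  · refine absurd ⟨((a, b), (a', b')), ⟨⟨ha, hb⟩, ⟨ha', hb'⟩⟩, ?_⟩ ht
    change (a' - a) / (b - b') = t
    rw [div_eq_iff (sub_ne_zero.2 hbb)]
    linear_combination -h

namespace SliceCovering

variable {k n : ℕ} {V : Set (Fin n → ℂ)} {x : Fin k → (Fin n → ℂ) → ℂ} {z : (Fin n → ℂ) → ℂ}
  {e : (Fin k ⊕ Fin k → ℂ) → ℂ}

lemma irr_prod (A : SliceCovering V x z e) {φ ψ : (Fin n ⊕ Fin n → ℂ) → ℂ} (hφ : PolyFun φ)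
    (hψ : PolyFun ψ) (h : ∀ y ∈ V, ∀ y' ∈ V, φ (Sum.elim y y') * ψ (Sum.elim y y') = 0)
    {a b : Fin n → ℂ} (ha : a ∈ V) (hb : b ∈ V) (hab : ψ (Sum.elim a b) ≠ 0) {y y' : Fin n → ℂ}
    (hy : y ∈ V) (hy' : y' ∈ V) : φ (Sum.elim y y') = 0 := by
  by_contra hcon
  have hl : ∀ {φ : (Fin n ⊕ Fin n → ℂ) → ℂ}, PolyFun φ → ∀ y', PolyFun fun y => φ (Sum.elim y y') :=
    fun hφ y' => hφ.comp (f := fun y => Sum.elim y y') fun i => by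
      rcases i with i | i
      · exact PolyFun.coord i
      · exact PolyFun.const _
  have hr : ∀ {φ : (Fin n ⊕ Fin n → ℂ) → ℂ}, PolyFun φ → ∀ y, PolyFun fun y' => φ (Sum.elim y y') :=
    fun hφ y => hφ.comp (f := fun y' => Sum.elim y y') fun i => by
      rcases i with i | i
      · exact PolyFun.const _
      · exact PolyFun.coord i
  obtain ⟨c, hc, hc1, hc2⟩ := A.irr _ _ (hl hφ y') (hl hψ b) ⟨y, hy, hcon⟩ ⟨a, ha, hab⟩
  obtain ⟨c', hc', hc1', hc2'⟩ := A.irr _ _ (hr hφ c) (hr hψ c) ⟨y', hy', hc1⟩ ⟨b, hb, hc2⟩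
  exact mul_ne_zero hc1' hc2' (h c hc c' hc')

/-- The monodromy action is doubly transitive. -/
theorem exists_transports_pair (A : SliceCovering V x z e) (hinj : Set.InjOn z (slice V x z 0))
    {y₁ y₂ y₃ y₄ : Fin n → ℂ} (h₁ : y₁ ∈ slice V x z 0) (h₂ : y₂ ∈ slice V x z 0)
    (h₃ : y₃ ∈ slice V x z 0) (h₄ : y₄ ∈ slice V x z 0) (h₁₂ : y₁ ≠ y₂) (h₃₄ : y₃ ≠ y₄) :
    ∃ γ : Path (0 : Fin k ⊕ Fin k → ℂ) 0,
      Transports V x z e γ y₁ y₃ ∧ Transports V x z e γ y₂ y₄ := by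
  classical
  let R : (Fin k ⊕ Fin k → ℂ) → (Fin n → ℂ) → (Fin n → ℂ) → Prop := fun w y y' =>
    ∃ γ : Path 0 w, Transports V x z e γ y₁ y ∧ Transports V x z e γ y₂ y'
  have hR : Invariant V x z e R := by
    intro w w' γ a a' b b' ha hb
    constructor
    · rintro ⟨δ, h, h'⟩
      exact ⟨δ.trans γ, h.trans ha, h'.trans hb⟩
    · rintro ⟨δ, h, h'⟩
      exact ⟨δ.trans γ.symm, h.trans ha.symm, h'.trans hb.symm⟩
  suffices h : R 0 y₃ y₄ from h
  obtain ⟨t, ht⟩ := ((A.finite 0 A.e_zero).image z).exists_injOn_add_mul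
  replace ht : ∀ a ∈ slice V x z 0, ∀ b ∈ slice V x z 0, ∀ a' ∈ slice V x z 0,
      ∀ b' ∈ slice V x z 0, z a + t * z b = z a' + t * z b' → a = a' ∧ b = b' := by
    intro a ha b hb a' ha' b' hb' h
    obtain ⟨h1, h2⟩ := ht _ ⟨a, ha, rfl⟩ _ ⟨b, hb, rfl⟩ _ ⟨a', ha', rfl⟩ _ ⟨b', hb', rfl⟩ h
    exact ⟨hinj ha ha' h1, hinj hb hb' h2⟩
  obtain ⟨κ, hκ, hκ0, K, M, hK, hKM⟩ := A.exists_growth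
  -- the parameters are the coordinates of `w`, and the value `X`
  have hw : ∀ i, PolyFun fun p : Option (Fin k ⊕ Fin k) → ℂ => p (some i) :=
    fun i => PolyFun.coord _
  have hgr : ∀ p : Option (Fin k ⊕ Fin k) → ℂ, e (fun i => p (some i)) ≠ 0 →
      ∀ y ∈ slice V x z (fun i => p (some i)),
      ‖κ (fun i => p (some i)) * z y‖ ≤ K * (1 + ‖p‖) ^ M := by
    intro p hp y hy
    refine (hKM _ hp y hy).trans ?_
    gcongr
    exact (pi_norm_le_iff_of_nonneg (norm_nonneg _)).2 fun i => norm_le_pi_norm p (some i)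
  obtain ⟨H, hH, hHR⟩ := polyFun_pairProd A hR t (w := fun p i => p (some i)) hw
    (hκ.comp hw) (PolyFun.coord none) hgr
  obtain ⟨H', hH', hHR'⟩ := polyFun_pairProd A hR.not t (w := fun p i => p (some i)) hw
    (hκ.comp hw) (PolyFun.coord none) hgr
  let ν : (Fin n ⊕ Fin n → ℂ) → ℂ := fun q => z (q ∘ Sum.inl) - z (q ∘ Sum.inr)
  have hl : ∀ {φ : (Fin n → ℂ) → ℂ}, PolyFun φ →
      PolyFun fun q : Fin n ⊕ Fin n → ℂ => φ (q ∘ Sum.inl) :=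
    fun hφ => hφ.comp (f := fun q => q ∘ Sum.inl) fun i => PolyFun.coord _
  have hr : ∀ {φ : (Fin n → ℂ) → ℂ}, PolyFun φ →
      PolyFun fun q : Fin n ⊕ Fin n → ℂ => φ (q ∘ Sum.inr) :=
    fun hφ => hφ.comp (f := fun q => q ∘ Sum.inr) fun i => PolyFun.coord _
  have hν : PolyFun ν := (hl A.polyFun_z).sub (hr A.polyFun_z)
  let f : Option (Fin k ⊕ Fin k) → (Fin n ⊕ Fin n → ℂ) → ℂ := fun o q => o.elim
    ((z (q ∘ Sum.inl) + t * z (q ∘ Sum.inr)) * ν q)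
    (Sum.elim (fun i => -(x i (q ∘ Sum.inl) - x i (q ∘ Sum.inr)))
      fun i => x i (q ∘ Sum.inl) * z (q ∘ Sum.inr) - x i (q ∘ Sum.inr) * z (q ∘ Sum.inl))
  have hf : ∀ o, PolyFun (f o) := by
    rintro (_ | i | i)
    · exact ((hl A.polyFun_z).add ((PolyFun.const t).mul (hr A.polyFun_z))).mul hν
    · exact ((hl (A.polyFun_x i)).sub (hr (A.polyFun_x i))).neg
    · exact ((hl (A.polyFun_x i)).mul (hr A.polyFun_z)).sub
        ((hr (A.polyFun_x i)).mul (hl A.polyFun_z))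
  obtain ⟨N, φ, hφ, hφH⟩ := hH.exists_clear_denom hν hf
  obtain ⟨N', φ', hφ', hφH'⟩ := hH'.exists_clear_denom hν hf
  obtain ⟨N₀, φ₀, hφ₀, hφE⟩ := (A.polyFun_e.comp hw).exists_clear_denom hν hf
  have hzero : ∀ y ∈ V, ∀ y' ∈ V, φ (Sum.elim y y') *
      (ν (Sum.elim y y') * φ₀ (Sum.elim y y') * φ' (Sum.elim y y')) = 0 := by
    intro y hy y' hy'
    by_cases hν0 : ν (Sum.elim y y') = 0
    · simp [hν0]
    rw [hφH _ hν0, hφH' _ hν0, hφE _ hν0]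
    set p : Option (Fin k ⊕ Fin k) → ℂ := fun i => f i (Sum.elim y y') / ν (Sum.elim y y')
    by_cases he : e (fun i => p (some i)) = 0
    · simp [he]
    have hνz : z y - z y' ≠ 0 := hν0
    have hp0 : p none = z y + t * z y' := by
      change (z y + t * z y') * ν (Sum.elim y y') / ν (Sum.elim y y') = _
      rw [mul_div_cancel_right₀ _ hν0]
    have hpl : ∀ i, p (some (Sum.inl i)) = -(x i y - x i y') / (z y - z y') := fun i => rfl
    have hpr : ∀ i, p (some (Sum.inr i)) = (x i y * z y' - x i y' * z y) / (z y - z y') :=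
      fun i => rfl
    have hmem : y ∈ slice V x z fun i => p (some i) := by
      refine ⟨hy, fun i => ?_⟩
      beta_reduce
      rw [hpl, hpr]
      field_simp
      ring
    have hmem' : y' ∈ slice V x z fun i => p (some i) := by
      refine ⟨hy', fun i => ?_⟩
      beta_reduce
      rw [hpl, hpr]
      field_simp
      ring
    have : H p = 0 ∨ H' p = 0 := by
      by_cases hyR : R (fun i => p (some i)) y y'
      · left
        rw [← hHR p he]
        by_contra hne
        exact (pairProd_ne_zero_iff A he (hκ0 _ he) _).1 hne y hmem y' hmem' hyR hp0
      · right
        rw [← hHR' p he]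
        by_contra hne
        exact (pairProd_ne_zero_iff A he (hκ0 _ he) _).1 hne y hmem y' hmem' hyR hp0
    rcases this with h | h <;> simp [h]
  have hspec : ∀ {a b : Fin n → ℂ}, a ∈ slice V x z 0 → b ∈ slice V x z 0 → a ≠ b →
      ν (Sum.elim a b) ≠ 0 ∧ (fun i => f i (Sum.elim a b) / ν (Sum.elim a b)) =
        (fun o => o.elim (z a + t * z b) 0 : Option (Fin k ⊕ Fin k) → ℂ) := by
    intro a b ha hb hab
    have hν0 : ν (Sum.elim a b) ≠ 0 := sub_ne_zero.2 fun h => hab (hinj ha hb h)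
    refine ⟨hν0, ?_⟩
    have hxa : ∀ i, x i a = 0 := fun i => by simpa using ha.2 i
    have hxb : ∀ i, x i b = 0 := fun i => by simpa using hb.2 i
    ext o
    rcases o with _ | i | i
    · change (z a + t * z b) * ν (Sum.elim a b) / ν (Sum.elim a b) = _
      rw [mul_div_cancel_right₀ _ hν0]
      rfl
    · change -(x i a - x i b) / _ = 0
      rw [hxa, hxb]; simp
    · change (x i a * z b - x i b * z a) / _ = 0
      rw [hxa, hxb]; simp
  have hw0 : ∀ X : ℂ, (fun i => (fun o => o.elim X 0 : Option (Fin k ⊕ Fin k) → ℂ) (some i)) = 0 :=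
    fun X => rfl
  obtain ⟨hν₁₂, hp₁₂⟩ := hspec h₁ h₂ h₁₂
  obtain ⟨hν₃₄, hp₃₄⟩ := hspec h₃ h₄ h₃₄
  have hne : ν (Sum.elim y₁ y₂) * φ₀ (Sum.elim y₁ y₂) * φ' (Sum.elim y₁ y₂) ≠ 0 := by
    rw [hφH' _ hν₁₂, hφE _ hν₁₂, hp₁₂]
    refine mul_ne_zero (mul_ne_zero hν₁₂ (mul_ne_zero (pow_ne_zero _ hν₁₂) ?_))
      (mul_ne_zero (pow_ne_zero _ hν₁₂) ?_)
    · rw [hw0]; exact A.e_zero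
    · rw [← hHR' _ (by rw [hw0]; exact A.e_zero), hw0,
        pairProd_ne_zero_iff A A.e_zero (hκ0 _ A.e_zero)]
      intro a ha b hb hnR hX
      obtain ⟨rfl, rfl⟩ := ht _ h₁ _ h₂ _ ha _ hb hX
      exact hnR ⟨Path.refl 0, Transports.refl A.e_zero h₁, Transports.refl A.e_zero h₂⟩
  have h0 := A.irr_prod hφ ((hν.mul hφ₀).mul hφ') hzero h₁.1 h₂.1 hne h₃.1 h₄.1
  rw [hφH _ hν₃₄, hp₃₄] at h0
  have h0' := (mul_eq_zero.1 h0).resolve_left (pow_ne_zero _ hν₃₄)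
  rw [← hHR _ (by rw [hw0]; exact A.e_zero), hw0] at h0'
  by_contra hcon
  refine (pairProd_ne_zero_iff A A.e_zero (hκ0 _ A.e_zero) _).2 ?_ h0'
  intro a ha b hb hab hX
  obtain ⟨rfl, rfl⟩ := ht _ h₃ _ h₄ _ ha _ hb hX
  exact hcon hab

end SliceCovering

lemma MvPolynomial.IsHomogeneous.eval_smul_point {ι : Type} {p : MvPolynomial ι ℂ} {j : ℕ}
    (hp : p.IsHomogeneous j) (s : ℂ) (q : ι → ℂ) : eval (s • q) p = s ^ j * eval q p := by
  rw [eval_eq, eval_eq, Finset.mul_sum]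
  refine Finset.sum_congr rfl fun a ha => ?_
  have hj := hp (mem_support_iff.1 ha)
  rw [Finsupp.weight_apply] at hj
  simp only [Pi.smul_apply, smul_eq_mul, mul_pow, Finset.prod_mul_distrib, Finset.prod_pow_eq_pow_sum]
  rw [show ∑ i ∈ a.support, a i = j by simpa [Finsupp.sum] using hj]
  ring

/-- A polynomial of growth of order `d` off the zeros of another one has total degree at
most `d`. -/
lemma MvPolynomial.totalDegree_le_of_growth {ι : Type} [Fintype ι] (p : MvPolynomial ι ℂ)
    {E : (ι → ℂ) → ℂ} (hE : PolyFun E) (hne : ∃ q, E q ≠ 0) {K : ℝ} {d : ℕ}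
    (hK : ∀ q, E q ≠ 0 → ‖eval q p‖ ≤ K * (1 + ‖q‖) ^ d) : p.totalDegree ≤ d := by
  classical
  have hcomp : ∀ i, d < i → homogeneousComponent i p = 0 := by
    intro i hi
    suffices h : ∀ q, eval q (homogeneousComponent i p) = 0 from
      MvPolynomial.funext fun q => by simp [h]
    refine PolyFun.eq_of_eq_on (PolyFun.eval _) (PolyFun.const 0) hE hne fun q hq => ?_
    let P : Polynomial ℂ := ∑ j ∈ Finset.range (p.totalDegree + 1),
      Polynomial.monomial j (eval q (homogeneousComponent j p))
    have hP : ∀ s : ℂ, eval (s • q) p = P.eval s := by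
      intro s
      conv_lhs => rw [← sum_homogeneousComponent p]
      rw [map_sum, Polynomial.eval_finsetSum]
      refine Finset.sum_congr rfl fun j _ => ?_
      rw [Polynomial.eval_monomial, mul_comm]
      exact (homogeneousComponent_isHomogeneous j p).eval_smul_point s q
    obtain ⟨R, hR⟩ := hE.exists_polynomial_line 0 q
    have hR0 : R ≠ 0 := by
      rintro rfl
      have := hR 1
      simp [hq] at this
    obtain ⟨Q, hQd, hQ⟩ := exists_polynomial_of_growth_off_finite (g := fun s => P.eval s)
      (T := {s | R.IsRoot s}) (T' := ∅) (K := K * (1 + ‖q‖) ^ d) (M := d)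
      (Polynomial.finite_setOfPred_isRoot hR0) Set.finite_empty
      (fun s _ => P.continuous.continuousAt) (fun s _ => P.differentiable.differentiableAt) (by
        intro s hs
        have hEs : E (s • q) ≠ 0 := by
          have := hR s
          rw [zero_add] at this
          rw [this]; exact hs
        rw [← hP]
        refine (hK _ hEs).trans ?_
        have hK0 : 0 ≤ K := by
          have := (norm_nonneg _).trans (hK _ hEs)
          by_contra! hneg
          exact absurd this (not_le.2 (mul_neg_of_neg_of_pos hneg (by positivity)))
        rw [mul_assoc, ← mul_pow]
        gcongr
        rw [norm_smul]
        nlinarith [norm_nonneg s, norm_nonneg q])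
    have hPQ : P = Q := by
      refine Polynomial.eq_of_infinite_eval_eq _ _
        ((Polynomial.finite_setOfPred_isRoot hR0).infinite_compl.mono fun s hs => hQ s hs)
    have hcoeff : P.coeff i = 0 := by
      rw [hPQ]
      exact Polynomial.coeff_eq_zero_of_natDegree_lt (hQd.trans_lt hi)
    by_cases hi' : i ≤ p.totalDegree
    · simpa [P, Polynomial.finsetSum_coeff, Polynomial.coeff_monomial, Nat.lt_succ_iff, hi'] using hcoeff
    · rw [homogeneousComponent_eq_zero _ _ (not_le.1 hi'), map_zero]
  by_contra! hd
  have hp := sum_homogeneousComponent p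
  have hle : p.totalDegree ≤ d := by
    rw [← hp]
    refine (totalDegree_finsetSum _ _).trans (Finset.sup_le fun i _ => ?_)
    by_cases hi : d < i
    · simp [hcomp i hi]
    · exact (homogeneousComponent_isHomogeneous i p).totalDegree_le.trans (not_lt.1 hi)
  exact absurd hd (not_lt.2 hle)

namespace SliceCovering

variable {k n : ℕ} {V : Set (Fin n → ℂ)} {x : Fin k → (Fin n → ℂ) → ℂ} {z : (Fin n → ℂ) → ℂ}
  {e : (Fin k ⊕ Fin k → ℂ) → ℂ}

/-- The polynomial whose zero locus is the projection of `V` to the coordinates `x` and `z`. -/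
theorem exists_projection (A : SliceCovering V x z e) (hne : (slice V x z 0).Nonempty) :
    ∃ F : (Option (Fin k) → ℂ) → ℂ, PolyFun F ∧
      (∀ q : Option (Fin k) → ℂ, e (Sum.elim 0 fun i => -q (some i)) ≠ 0 →
        F q = ∏ᶠ y ∈ slice V x z (Sum.elim 0 fun i => -q (some i)), (q none - z y)) ∧
      (∀ y ∈ V, F (fun o => o.elim (z y) fun i => x i y) = 0) ∧
      ∃ K : ℝ, ∀ q : Option (Fin k) → ℂ, e (Sum.elim 0 fun i => -q (some i)) ≠ 0 →
        ‖F q‖ ≤ K * (1 + ‖q‖) ^ (slice V x z 0).ncard := by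
  classical
  obtain ⟨C, hC0, hC⟩ := A.bound
  have hw : ∀ i, PolyFun fun q : Option (Fin k) → ℂ =>
      (Sum.elim 0 fun i => -q (some i) : Fin k ⊕ Fin k → ℂ) i := by
    rintro (i | i)
    · exact PolyFun.const 0
    · exact (PolyFun.coord _).neg
  have hb : ∀ q : Option (Fin k) → ℂ, ∀ y ∈ slice V x z (Sum.elim 0 fun i => -q (some i)),
      ‖z y‖ ≤ C * (1 + ‖q‖) := by
    intro q y hy
    refine (hC y hy.1).trans ?_
    gcongr
    refine (pi_norm_le_iff_of_nonneg (norm_nonneg _)).2 fun i => ?_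
    have := hy.2 i
    simp only [Sum.elim_inl, Sum.elim_inr, Pi.zero_apply, zero_mul, add_zero] at this
    rw [show x i y = q (some i) by linear_combination this]
    exact norm_le_pi_norm q _
  obtain ⟨F, hF, hFR⟩ := polyFun_pairProd A A.invariant_eq 0 hw (PolyFun.const 1)
    (PolyFun.coord none) (K := C) (M := 1) (by
      intro q _ y hy
      rw [one_mul, pow_one]
      exact hb q y hy)
  have hprod : ∀ q : Option (Fin k) → ℂ, e (Sum.elim 0 fun i => -q (some i)) ≠ 0 →
        F q = ∏ᶠ y ∈ slice V x z (Sum.elim 0 fun i => -q (some i)), (q none - z y) := by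
    intro q hq
    have hfin := A.finite _ hq
    rw [← hFR q hq, pairProd_eq_prod A hq, finprod_mem_eq_finite_toFinset_prod _ hfin,
      ← Set.Finite.toFinset_prod hfin hfin, Finset.prod_product]
    refine Finset.prod_congr rfl fun y hy => ?_
    simp only
    rw [Finset.prod_ite_eq, if_pos hy]
    ring
  refine ⟨F, hF, hprod, fun y hy => ?_, (1 + C) ^ (slice V x z 0).ncard, fun q hq => ?_⟩
  · by_contra hcon
    obtain ⟨y₀, hy₀⟩ := hne
    have h1 : PolyFun fun y => F (fun o => o.elim (z y) fun i => x i y) := hF.comp fun o => by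
      rcases o with _ | i
      · exact A.polyFun_z
      · exact A.polyFun_x i
    have h2 : PolyFun fun y => e (Sum.elim 0 fun i => -x i y) := A.polyFun_e.comp fun o => by
      rcases o with i | i
      · exact PolyFun.const 0
      · exact (A.polyFun_x i).neg
    obtain ⟨c, hc, hc1, hc2⟩ := A.irr _ _ h1 h2 ⟨y, hy, hcon⟩ ⟨y₀, hy₀.1, by
      have hx : ∀ i, x i y₀ = 0 := fun i => by simpa using hy₀.2 i
      have : (Sum.elim 0 fun i => -x i y₀ : Fin k ⊕ Fin k → ℂ) = 0 := by
        ext (i | i) <;> simp [hx]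
      rw [this]
      exact A.e_zero⟩
    refine hc1 ?_
    have hfin := A.finite _ hc2
    rw [hprod _ hc2]
    simp only [Option.elim_some, Option.elim_none]
    rw [finprod_mem_eq_finite_toFinset_prod _ hfin]
    refine Finset.prod_eq_zero (i := c) ?_ (sub_self _)
    simp [slice, hc]
  · have hfin := A.finite _ hq
    rw [hprod q hq, finprod_mem_eq_finite_toFinset_prod _ hfin, norm_prod]
    refine (Finset.prod_le_prod (fun _ _ => norm_nonneg _)
      (g := fun _ => (1 + C) * (1 + ‖q‖)) fun y hy => ?_).trans (le_of_eq ?_)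
    · have h1 := hb q y (hfin.mem_toFinset.1 hy)
      have h2 := norm_le_pi_norm q none
      linarith [norm_sub_le (q none) (z y)]
    · rw [Finset.prod_const, mul_pow, ← Set.ncard_eq_toFinset_card _ hfin, A.ncard_slice hq]

end SliceCovering

lemma PolyFun.differentiable {ι : Type} [Fintype ι] {φ : (ι → ℂ) → ℂ} (h : PolyFun φ) :
    Differentiable ℂ φ := by
  obtain ⟨p, hp⟩ := h
  obtain rfl : φ = fun x => MvPolynomial.eval x p := funext hp
  clear hp
  induction p using MvPolynomial.induction_on with
  | C a => simp
  | add p q hp hq => simp only [map_add]; exact hp.add hq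
  | mul_X p i hp => simp only [map_mul, eval_X]; exact hp.mul (differentiable_apply i)

/-- Division by a polynomial which is monic of degree one in the distinguished variable. -/
lemma PolyFun.exists_sub_eq_mul {ι : Type} {φ ψ : (Option ι → ℂ) → ℂ} (hφ : PolyFun φ)
    (hψ : PolyFun ψ) : ∃ Q : (Option ι → ℂ) → ℂ, PolyFun Q ∧
      ∀ q, φ q - φ (fun o => o.elim (ψ q) fun i => q (some i)) = (q none - ψ q) * Q q := by
  have hsub : ∀ o : Option ι, PolyFun fun q : Option ι → ℂ => o.elim (ψ q) fun i => q (some i) := by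
    rintro (_ | i)
    · exact hψ
    · exact PolyFun.coord _
  obtain ⟨p, hp⟩ := hφ
  obtain rfl : φ = fun x => MvPolynomial.eval x p := funext hp
  clear hp
  induction p using MvPolynomial.induction_on with
  | C a => exact ⟨fun _ => 0, PolyFun.const 0, fun q => by simp⟩
  | add p p' hp hp' =>
    obtain ⟨Q, hQ, h⟩ := hp
    obtain ⟨Q', hQ', h'⟩ := hp'
    refine ⟨_, hQ.add hQ', fun q => ?_⟩
    simp only [map_add] at h h' ⊢
    linear_combination h q + h' q
  | mul_X p o hp =>
    obtain ⟨Q, hQ, h⟩ := hp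
    simp only [map_mul, eval_X]
    rcases o with _ | i
    · refine ⟨_, (hQ.mul (PolyFun.coord none)).add ((PolyFun.eval p).comp hsub), fun q => ?_⟩
      simp only [Option.elim_none]
      linear_combination q none * h q
    · refine ⟨_, hQ.mul (PolyFun.coord (some i)), fun q => ?_⟩
      simp only [Option.elim_some]
      linear_combination q (some i) * h q

namespace SliceCovering

variable {k n : ℕ} {V : Set (Fin n → ℂ)} {x : Fin k → (Fin n → ℂ) → ℂ} {z : (Fin n → ℂ) → ℂ}
  {e : (Fin k ⊕ Fin k → ℂ) → ℂ}

/-- The projection of `V` does not contain a line through a given point in every direction. -/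
theorem exists_direction (A : SliceCovering V x z e) (hinj : Set.InjOn z (slice V x z 0))
    {F : (Option (Fin k) → ℂ) → ℂ} (hF : PolyFun F)
    (hF0 : ∀ Z : ℂ, F (fun o => o.elim Z 0) = ∏ᶠ y ∈ slice V x z 0, (Z - z y))
    (hFV : ∀ y ∈ V, F (fun o => o.elim (z y) fun i => x i y) = 0) {y₁ y₂ : Fin n → ℂ}
    (h₁ : y₁ ∈ slice V x z 0) (h₂ : y₂ ∈ slice V x z 0) (h₁₂ : y₁ ≠ y₂) :
    ∃ η : Fin k → ℂ, ∀ a : ℂ, ∃ s : ℂ, F (fun o => o.elim (a * s + z y₁) fun i => s * η i) ≠ 0 := by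
  classical
  by_contra! hcon
  set p₀ : Option (Fin k) → ℂ := fun o => o.elim (z y₁) 0 with hp₀
  set L := fderiv ℂ F p₀ with hL
  have hline : ∀ v : Option (Fin k) → ℂ, HasDerivAt (fun s : ℂ => F (p₀ + s • v)) (L v) 0 := by
    intro v
    have h := (hF.differentiable p₀).hasFDerivAt
    have h' : HasDerivAt (fun s : ℂ => p₀ + s • v) v 0 := by
      simpa using ((hasDerivAt_id (0 : ℂ)).smul_const v).const_add p₀
    exact HasFDerivAt.comp_hasDerivAt 0 (by simpa using h) h'
  have hfin := A.finite 0 A.e_zero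
  set P : Polynomial ℂ := ∏ y ∈ hfin.toFinset.erase y₁, (Polynomial.X + Polynomial.C (z y₁ - z y))
  have hP0 : P.eval 0 ≠ 0 := by
    rw [Polynomial.eval_prod, Finset.prod_ne_zero_iff]
    intro y hy
    obtain ⟨hy, hy'⟩ := Finset.mem_erase.1 hy
    simp only [Polynomial.eval_add, Polynomial.eval_X, Polynomial.eval_C, zero_add]
    exact sub_ne_zero.2 fun h => hy (hinj h₁ (hfin.mem_toFinset.1 hy') h).symm
  have hFP : ∀ s : ℂ, F (p₀ + s • fun o => o.elim 1 0) = s * P.eval s := by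
    intro s
    have : (p₀ + s • fun o => o.elim 1 0 : Option (Fin k) → ℂ) = fun o => o.elim (z y₁ + s) 0 := by
      ext (_ | i) <;> simp [hp₀]
    rw [this, hF0, finprod_mem_eq_finite_toFinset_prod _ hfin,
      ← Finset.mul_prod_erase _ _ (hfin.mem_toFinset.2 h₁), Polynomial.eval_prod]
    congr 1
    · ring
    · exact Finset.prod_congr rfl fun y _ => by simp; ring
  have hsP : ∀ g : ℂ → ℂ, Continuous g → HasDerivAt (fun s => s * g s) (g 0) 0 := by
    intro g hg
    simpa using hasDerivAt_mul_of_continuousAt (hasDerivAt_id (0 : ℂ)) rfl hg.continuousAt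
  have hL1 : L (fun o => o.elim 1 0) = P.eval 0 := by
    have h := hline (fun o => o.elim 1 0)
    simp only [hFP] at h
    exact h.unique (hsP _ P.continuous)
  set α : (Fin k → ℂ) → ℂ := fun η => -L (fun o => o.elim 0 η) / P.eval 0 with hα
  have hαη : ∀ η, F (fun o => o.elim (α η + z y₁) η) = 0 := by
    intro η
    obtain ⟨a, ha⟩ := hcon η
    have h := hline fun o => o.elim a η
    have h0 : ∀ s : ℂ, F (p₀ + s • fun o => o.elim a η) = 0 := by
      intro s
      rw [← ha s]
      congr 1
      ext (_ | i) <;> simp [hp₀]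
      ring
    simp only [h0] at h
    have hLa := h.unique (hasDerivAt_const _ _)
    have hdec : (fun o => o.elim a η : Option (Fin k) → ℂ) =
        (fun o => o.elim 0 η) + a • fun o => o.elim 1 0 := by
      ext (_ | i) <;> simp
    rw [hdec, map_add, map_smul, hL1, smul_eq_mul] at hLa
    have : α η = a := by
      rw [hα, div_eq_iff hP0]
      linear_combination -hLa
    rw [this]
    simpa using ha 1
  have hαP : PolyFun fun q : Option (Fin k) → ℂ => α (fun i => q (some i)) + z y₁ := by
    have hsum : ∀ η : Fin k → ℂ, α η = ∑ i, η i * α (Pi.single i 1) := by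
      intro η
      have : (fun o => o.elim 0 η : Option (Fin k) → ℂ) =
          ∑ i, η i • fun o => o.elim 0 (Pi.single i 1 : Fin k → ℂ) := by
        ext (_ | j) <;> simp [Finset.sum_apply, Pi.single_apply]
      simp only [hα, this, map_sum, map_smul, smul_eq_mul, ← Finset.sum_neg_distrib,
        Finset.sum_div]
      exact Finset.sum_congr rfl fun i _ => by ring
    have hsum' : (fun q : Option (Fin k) → ℂ => α (fun i => q (some i)) + z y₁) =
        fun q => ∑ i, q (some i) * α (Pi.single i 1) + z y₁ := funext fun q => by rw [hsum]
    rw [hsum']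
    exact (PolyFun.sum _ fun i _ => (PolyFun.coord _).mul (PolyFun.const _)).add (PolyFun.const _)
  obtain ⟨Q, hQ, hFQ⟩ := hF.exists_sub_eq_mul hαP
  replace hFQ : ∀ q, F q = (q none - (α (fun i => q (some i)) + z y₁)) * Q q := by
    intro q
    rw [← hFQ, hαη, sub_zero]
  have hα0 : α 0 = 0 := by
    have : (fun o => o.elim 0 0 : Option (Fin k) → ℂ) = 0 := by ext (_ | i) <;> rfl
    change -L (fun o => o.elim 0 0) / P.eval 0 = 0
    rw [this]
    simp
  have hQ0 : Q p₀ ≠ 0 := by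
    have h := hline (fun o => o.elim 1 0)
    have hv : ∀ s : ℂ, F (p₀ + s • fun o => o.elim 1 0) =
        s * Q (p₀ + s • fun o => o.elim 1 0) := by
      intro s
      rw [hFQ]
      congr 1
      have : (fun i => (p₀ + s • fun o => o.elim 1 0 : Option (Fin k) → ℂ) (some i)) = 0 := by
        ext i; simp [hp₀]
      rw [this, hα0]
      simp [hp₀]
    simp only [hv] at h
    have h' := h.unique (hsP (fun s => Q (p₀ + s • fun o => o.elim 1 0))
      (hQ.continuous.comp (by fun_prop)))
    rw [hL1] at h'
    rw [h'] at hP0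
    simpa using hP0
  have hx : ∀ y ∈ slice V x z 0, (fun i => x i y) = 0 := fun y hy => funext fun i => by
    simpa using hy.2 i
  have hxz : ∀ o : Option (Fin k), PolyFun fun y => (o.elim (z y) fun i => x i y : ℂ) := by
    rintro (_ | i)
    · exact A.polyFun_z
    · exact A.polyFun_x i
  obtain ⟨c, hc, hc1, hc2⟩ := A.irr (fun y => z y - (α (fun i => x i y) + z y₁))
    (fun y => Q fun o => o.elim (z y) fun i => x i y)
    (A.polyFun_z.sub (hαP.comp hxz)) (hQ.comp hxz)
    ⟨y₂, h₂.1, by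
      rw [hx y₂ h₂, hα0, zero_add]
      exact sub_ne_zero.2 fun h => h₁₂ (hinj h₂ h₁ h).symm⟩
    ⟨y₁, h₁.1, by rw [hx y₁ h₁]; exact hQ0⟩
  have h := hFV c hc
  rw [hFQ] at h
  exact mul_ne_zero hc1 hc2 h

end SliceCovering

lemma MvPolynomial.hasDerivAt_eval_sub (F : MvPolynomial (Fin 2) ℂ) (a b : ℂ) :
    HasDerivAt (fun s : ℂ => eval ![a - s, b] F) (-eval ![a, b] (pderiv 0 F)) 0 := by
  induction F using MvPolynomial.induction_on with
  | C c => simpa using hasDerivAt_const (0 : ℂ) c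
  | add p q hp hq =>
    simp only [map_add, neg_add]
    exact hp.add hq
  | mul_X p i hp =>
    simp only [map_mul, eval_X, Derivation.leibniz, pderiv_X, smul_eq_mul, map_add]
    fin_cases i
    · have h : HasDerivAt (fun s : ℂ => ![a - s, b] 0) (-1) 0 := by
        simpa using (hasDerivAt_id (0 : ℂ)).const_sub a
      refine (hp.mul h).congr_deriv ?_
      simp
      ring
    · have h : HasDerivAt (fun s : ℂ => ![a - s, b] 1) 0 0 := hasDerivAt_const _ _
      refine (hp.mul h).congr_deriv ?_
      simp
      ring

/-- Expansion of a bivariate polynomial along a family of parallel lines. -/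
lemma MvPolynomial.exists_eval_line_eq (F : MvPolynomial (Fin 2) ℂ) (u v : ℂ) :
    ∃ B : ℂ × ℂ → ℂ, Continuous B ∧ (∀ ζ, B (0, ζ) = -eval ![-v - u * ζ, ζ] (pderiv 0 F)) ∧
      ∀ s Z, eval ![-v - s - u * Z, Z] F = eval ![-v - u * Z, Z] F + s * B (s, Z) := by
  have hφ : PolyFun fun q : Option Unit → ℂ =>
      eval ![-v - q none - u * q (some ()), q (some ())] F := by
    refine (PolyFun.eval F).comp
      (f := fun q : Option Unit → ℂ => ![-v - q none - u * q (some ()), q (some ())]) fun i => ?_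
    fin_cases i
    · exact ((PolyFun.const _).sub (PolyFun.coord _)).sub ((PolyFun.const _).mul (PolyFun.coord _))
    · exact PolyFun.coord _
  obtain ⟨Q, hQ, h⟩ := hφ.exists_sub_eq_mul (PolyFun.const 0)
  have hB : Continuous fun p : ℂ × ℂ => Q fun o => o.elim p.1 fun _ => p.2 := by
    refine hQ.continuous.comp (continuous_pi fun o => ?_)
    rcases o with _ | i
    · exact continuous_fst
    · exact continuous_snd
  have heq : ∀ s Z, eval ![-v - s - u * Z, Z] F = eval ![-v - u * Z, Z] F +
      s * Q fun o => o.elim s fun _ => Z := by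
    intro s Z
    have := h fun o => o.elim s fun _ => Z
    simp only [Option.elim_none, Option.elim_some, sub_zero] at this
    linear_combination this
  refine ⟨_, hB, fun ζ => ?_, heq⟩
  have h1 := F.hasDerivAt_eval_sub (-v - u * ζ) ζ
  have h2 : HasDerivAt (fun s : ℂ => eval ![-v - u * ζ - s, ζ] F)
      (Q fun o => o.elim 0 fun _ => ζ) 0 := by
    have h3 := hasDerivAt_mul_of_continuousAt (hasDerivAt_id (0 : ℂ)) rfl
      (ρ := fun s => Q fun o => o.elim s fun _ => ζ)
      (hB.comp (Continuous.prodMk_left ζ)).continuousAt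
    rw [one_mul] at h3
    have h4 : (fun s : ℂ => eval ![-v - u * ζ - s, ζ] F) = fun s => eval ![-v - u * ζ, ζ] F +
        id s * Q fun o => o.elim s fun _ => ζ := by
      ext s
      rw [show -v - u * ζ - s = -v - s - u * ζ by ring]
      exact heq s ζ
    rw [h4]
    exact h3.const_add _
  exact h2.unique h1

lemma Polynomial.exists_eval_eq_mul_prod {Q : Polynomial ℂ} {R : Finset ℂ}
    (hd : Q.natDegree ≤ R.card) (h : ∀ r ∈ R, Q.eval r = 0) :
    ∃ c, ∀ Z, Q.eval Z = c * ∏ r ∈ R, (Z - r) := by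
  obtain ⟨T, hT⟩ : ∏ r ∈ R, (Polynomial.X - Polynomial.C r) ∣ Q :=
    Finset.prod_dvd_of_coprime
      (fun a _ b _ hab => Polynomial.isCoprime_X_sub_C_of_isUnit_sub (sub_ne_zero.2 hab).isUnit)
      fun r hr => Polynomial.dvd_iff_isRoot.2 (h r hr)
  by_cases hT0 : T = 0
  · exact ⟨0, fun Z => by simp [hT, hT0]⟩
  have hmon : (∏ r ∈ R, (Polynomial.X - Polynomial.C r)).Monic :=
    Polynomial.monic_prod_of_monic _ _ fun r _ => Polynomial.monic_X_sub_C r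
  rw [hT, hmon.natDegree_mul' hT0, Polynomial.natDegree_finsetProd_X_sub_C_eq_card] at hd
  obtain ⟨c, hc⟩ := Polynomial.natDegree_eq_zero.1 (show T.natDegree = 0 by omega)
  refine ⟨c, fun Z => ?_⟩
  rw [hT, ← hc, Polynomial.eval_mul, Polynomial.eval_prod]
  simp [mul_comm]

/-- If a split polynomial is much smaller at `a` than at `b`, it has a root close to `a`. -/
lemma Polynomial.exists_root_near {Q : Polynomial ℂ} {R : Finset ℂ} (hd : Q.natDegree ≤ R.card)
    (h : ∀ r ∈ R, Q.eval r = 0) {a b : ℂ} {δ : ℝ} (hδ : 0 < δ)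
    (hab : ‖Q.eval a‖ * (1 + ‖b - a‖ / δ) ^ R.card < ‖Q.eval b‖) : ∃ r ∈ R, ‖r - a‖ < δ := by
  by_contra! hcon
  obtain ⟨c, hc⟩ := Polynomial.exists_eval_eq_mul_prod hd h
  refine absurd hab (not_lt.2 ?_)
  rw [hc, hc, norm_mul, norm_mul, mul_assoc, norm_prod, norm_prod, ← Finset.prod_const,
    ← Finset.prod_mul_distrib]
  refine mul_le_mul_of_nonneg_left (Finset.prod_le_prod (fun _ _ => norm_nonneg _)
    fun r hr => ?_) (norm_nonneg _)
  have h1 := hcon r hr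
  rw [norm_sub_rev] at h1
  have h2 : ‖b - r‖ ≤ ‖b - a‖ + ‖a - r‖ := by
    simpa using norm_add_le (b - a) (a - r)
  have h3 : ‖b - a‖ ≤ ‖a - r‖ * (‖b - a‖ / δ) := by
    rw [mul_div_assoc', le_div_iff₀ hδ, mul_comm]
    exact mul_le_mul_of_nonneg_right h1 (norm_nonneg _)
  linarith

open Filter Topology in
/-- Near a double root of a split polynomial, the two roots of a smoothing are interchanged by
the monodromy. -/
lemma exists_local_monodromy {c ζ : ℂ} {W : Finset ℂ} (hc : c ≠ 0) (hζ : ζ ∉ W)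
    {B : ℂ × ℂ → ℂ} (hB : Continuous B) (hB0 : B (0, ζ) ≠ 0) :
    ∃ δ > 0, (∀ a ∈ insert ζ W, ∀ b ∈ insert ζ W, a ≠ b → 2 * δ ≤ ‖a - b‖) ∧
      ∃ ε₀ > 0, (∀ s : ℂ, ‖s‖ < ε₀ → ∀ a ∈ insert ζ W, ∀ Z : ℂ, ‖Z - a‖ = δ →
        c * ((Z - ζ) ^ 2 * ∏ w ∈ W, (Z - w)) + s * B (s, Z) ≠ 0) ∧
      ∀ (ε : ℝ), 0 < ε → ε < ε₀ → ∀ Z : unitInterval → ℂ, Continuous Z →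
        (∀ t : unitInterval, ‖Z t - ζ‖ < δ ∧ c * ((Z t - ζ) ^ 2 * ∏ w ∈ W, (Z t - w)) +
          (ε * Complex.exp (2 * Real.pi * Complex.I * (t : ℝ))) *
            B (ε * Complex.exp (2 * Real.pi * Complex.I * (t : ℝ)), Z t) = 0) → Z 1 ≠ Z 0 := by
  classical
  set h : ℂ → ℂ := fun Z => c * ∏ w ∈ W, (Z - w) with hh
  have hhc : Continuous h := by fun_prop
  have hh0 : h ζ ≠ 0 := mul_ne_zero hc
    (Finset.prod_ne_zero_iff.2 fun w hw => sub_ne_zero.2 fun h => hζ (h ▸ hw))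
  have hρ : ContinuousAt (fun p : ℂ × ℂ => B p * h ζ / (h p.2 * B (0, ζ))) (0, ζ) := by
    refine ContinuousAt.div (by fun_prop) (by fun_prop) (mul_ne_zero hh0 hB0)
  obtain ⟨δ₁, hδ₁, hρ₁⟩ : ∃ δ₁ > 0, ∀ s Z : ℂ, ‖s‖ < δ₁ → ‖Z - ζ‖ < δ₁ →
      ‖B (s, Z) * h ζ / (h Z * B (0, ζ)) - 1‖ < 1 ∧ h Z ≠ 0 := by
    have h1 : ∀ᶠ p : ℂ × ℂ in 𝓝 (0, ζ), ‖B p * h ζ / (h p.2 * B (0, ζ)) - 1‖ < 1 := by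
      have := (hρ.sub_const 1).norm
      refine this.eventually_lt_const (u := 1) ?_
      change ‖B (0, ζ) * h ζ / (h ζ * B (0, ζ)) - 1‖ < 1
      rw [show B (0, ζ) * h ζ / (h ζ * B (0, ζ)) = 1 by
        rw [mul_comm]; exact div_self (mul_ne_zero hh0 hB0)]
      simp
    have h2 : ∀ᶠ p : ℂ × ℂ in 𝓝 (0, ζ), h p.2 ≠ 0 :=
      (hhc.comp continuous_snd).continuousAt.eventually_ne hh0
    obtain ⟨δ₁, hδ₁, hb⟩ := Metric.eventually_nhds_iff.1 (h1.and h2)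
    refine ⟨δ₁, hδ₁, fun s Z hs hZ => hb ?_⟩
    rw [Prod.dist_eq, dist_zero_right, dist_eq_norm]
    exact max_lt hs hZ
  obtain ⟨δ, hδ, hδδ₁, hsep⟩ : ∃ δ > 0, δ < δ₁ ∧
      ∀ a ∈ insert ζ W, ∀ b ∈ insert ζ W, a ≠ b → 2 * δ < ‖a - b‖ := by
    have h1 : ∀ᶠ δ : ℝ in 𝓝[>] 0, ∀ a ∈ insert ζ W, ∀ b ∈ insert ζ W, a ≠ b →
        2 * δ < ‖a - b‖ := by
      simp only [Filter.eventually_all_finset]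
      intro a _ b _
      by_cases hab : a = b
      · simp [hab]
      · have : ContinuousAt (fun δ : ℝ => 2 * δ) 0 := by fun_prop
        refine ((this.eventually_lt_const (u := ‖a - b‖) ?_).filter_mono nhdsWithin_le_nhds).mono
          fun _ h _ => h
        simpa [sub_eq_zero] using hab
    have h2 : ∀ᶠ δ : ℝ in 𝓝[>] 0, δ < δ₁ :=
      (eventually_lt_nhds hδ₁).filter_mono nhdsWithin_le_nhds
    obtain ⟨δ, ⟨hδ1, hδ2⟩, hδ⟩ := ((h1.and h2).and self_mem_nhdsWithin).exists
    exact ⟨δ, hδ, hδ2, hδ1⟩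
  refine ⟨δ, hδ, fun a ha b hb hab => (hsep a ha b hb hab).le, ?_⟩
  have hcpt : IsCompact (⋃ a ∈ insert ζ W, Metric.sphere a δ) :=
    (insert ζ W).isCompact_biUnion fun a _ => isCompact_sphere a δ
  have hev : ∀ᶠ s : ℂ in 𝓝 0, ∀ Z ∈ ⋃ a ∈ insert ζ W, Metric.sphere a δ,
      c * ((Z - ζ) ^ 2 * ∏ w ∈ W, (Z - w)) + s * B (s, Z) ≠ 0 := by
    refine hcpt.eventually_forall_of_forall_eventually fun Z hZ => ?_
    have hcont : Continuous fun p : ℂ × ℂ =>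
        c * ((p.2 - ζ) ^ 2 * ∏ w ∈ W, (p.2 - w)) + p.1 * B (p.1, p.2) := by fun_prop
    refine hcont.continuousAt.eventually_ne ?_
    simp only [zero_mul, add_zero]
    simp only [Set.mem_iUnion, exists_prop] at hZ
    obtain ⟨a, ha, hZa⟩ := hZ
    rw [mem_sphere_iff_norm] at hZa
    have hne : ∀ b ∈ insert ζ W, Z - b ≠ 0 := by
      intro b hb hZb
      obtain rfl := sub_eq_zero.1 hZb
      have hba : Z ≠ a := by
        rintro rfl
        simp at hZa
        exact hδ.ne hZa
      have := hsep Z hb a ha hba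
      linarith
    exact mul_ne_zero hc (mul_ne_zero (pow_ne_zero _ (hne ζ (Finset.mem_insert_self _ _)))
      (Finset.prod_ne_zero_iff.2 fun w hw => hne w (Finset.mem_insert_of_mem hw)))
  obtain ⟨ε₁, hε₁, hev⟩ := Metric.eventually_nhds_iff.1 hev
  refine ⟨min ε₁ δ₁, lt_min hε₁ hδ₁, fun s hs a ha Z hZ => ?_, fun ε hε hεε Z hZc hZ h01 => ?_⟩
  · refine hev (by simpa using hs.trans_le (min_le_left _ _)) Z ?_
    simp only [Set.mem_iUnion, exists_prop]
    exact ⟨a, ha, mem_sphere_iff_norm.2 hZ⟩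
  obtain ⟨β, hβ⟩ := IsAlgClosed.exists_pow_nat_eq (-B (0, ζ) / h ζ) two_pos
  have hβ0 : β ≠ 0 := by
    rintro rfl
    rw [zero_pow two_ne_zero, eq_comm, div_eq_zero_iff, neg_eq_zero] at hβ
    exact hβ.elim hB0 hh0
  let E : unitInterval → ℂ := fun t => (Real.sqrt ε : ℂ) * Complex.exp (Real.pi * Complex.I * (t : ℝ))
  have hE2 : ∀ t : unitInterval, E t ^ 2 = ε * Complex.exp (2 * Real.pi * Complex.I * (t : ℝ)) := by
    intro t
    simp only [E, mul_pow]
    rw [← Complex.ofReal_pow, Real.sq_sqrt hε.le, ← Complex.exp_nat_mul]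
    congr 2
    push_cast; ring
  have hsqrt : (Real.sqrt ε : ℂ) ≠ 0 := by
    exact_mod_cast (Real.sqrt_pos.2 hε).ne'
  have hE0 : ∀ t, E t ≠ 0 := fun t => mul_ne_zero hsqrt (Complex.exp_ne_zero _)
  have hEc : Continuous E := by fun_prop
  let χ : unitInterval → ℂ := fun t => (Z t - ζ) / (β * E t)
  have hχc : Continuous χ := by
    refine Continuous.div (by fun_prop) (by fun_prop) fun t => mul_ne_zero hβ0 (hE0 t)
  have hχ2 : ∀ t, (χ t).re ≠ 0 := by
    intro t hre
    obtain ⟨hZt, hroot⟩ := hZ t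
    rw [← hE2] at hroot
    have hnorm : ‖E t ^ 2‖ < δ₁ := by
      rw [hE2, norm_mul, show 2 * Real.pi * Complex.I * (t : ℝ) =
        ((2 * Real.pi * t : ℝ) : ℂ) * Complex.I by push_cast; ring,
        Complex.norm_exp_ofReal_mul_I, mul_one, Complex.norm_real, Real.norm_of_nonneg hε.le]
      exact hεε.trans_le (min_le_right _ _)
    obtain ⟨hlt, hh1⟩ := hρ₁ _ _ hnorm (hZt.trans hδδ₁)
    have hχρ : χ t ^ 2 = B (E t ^ 2, Z t) * h ζ / (h (Z t) * B (0, ζ)) := by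
      have h1 : (Z t - ζ) ^ 2 * h (Z t) = -(E t ^ 2 * B (E t ^ 2, Z t)) := by
        simp only [hh]
        linear_combination hroot
      have hE0' := hE0 t
      simp only [χ, div_pow, mul_pow, hβ]
      rw [eq_div_of_mul_eq hh1 h1]
      field_simp
    rw [← hχρ] at hlt
    have h2 := (Complex.abs_re_le_norm _).trans_lt hlt
    rw [Complex.sub_re, Complex.one_re, sq, Complex.mul_re, hre, abs_lt] at h2
    nlinarith [h2.1, mul_self_nonneg (χ t).im]
  have hχ1 : χ 1 = -χ 0 := by
    simp only [χ, h01, E, Set.Icc.coe_one, Set.Icc.coe_zero]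
    simp [Complex.exp_pi_mul_I, div_neg]
  have hχr : Continuous fun t => (χ t).re := Complex.continuous_re.comp hχc
  obtain ⟨t, ht⟩ : ∃ t, (χ t).re = 0 := by
    rcases le_total (χ 0).re 0 with h0 | h0
    · exact mem_range_of_exists_le_of_exists_ge hχr ⟨0, h0⟩ ⟨1, by rw [hχ1]; simpa using h0⟩
    · exact mem_range_of_exists_le_of_exists_ge hχr ⟨1, by rw [hχ1]; simpa using h0⟩ ⟨0, h0⟩
  exact hχ2 t ht

namespace SliceCovering

variable {k n : ℕ} {V : Set (Fin n → ℂ)} {x : Fin k → (Fin n → ℂ) → ℂ} {z : (Fin n → ℂ) → ℂ}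
  {e : (Fin k ⊕ Fin k → ℂ) → ℂ}

lemma exists_discriminant (A : SliceCovering V x z e) (hinj : Set.InjOn z (slice V x z 0)) :
    ∃ S : (Fin k ⊕ Fin k → ℂ) → ℂ, PolyFun S ∧ S 0 ≠ 0 ∧
      ∀ w, e w ≠ 0 → S w ≠ 0 → Set.InjOn z (slice V x z w) := by
  obtain ⟨κ, hκ, hκ0, K, M, hK, hKM⟩ := A.exists_growth
  obtain ⟨S, hS, hSR⟩ := polyFun_pairProd A A.invariant_eq.not (-1) (w := fun w => w)
    PolyFun.coord hκ (PolyFun.const 0) hKM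
  refine ⟨S, hS, ?_, fun w hw hSw => ?_⟩
  · rw [← hSR 0 A.e_zero, pairProd_ne_zero_iff A A.e_zero (hκ0 0 A.e_zero)]
    intro y hy y' hy' hne h
    exact hne (hinj hy hy' (by linear_combination -h))
  · rw [← hSR w hw, pairProd_ne_zero_iff A hw (hκ0 w hw)] at hSw
    intro y hy y' hy' h
    by_contra hne
    exact hSw y hy y' hy' hne (by linear_combination -h)

/-- A one-parameter family of parallel slices, one of which is simply tangent to `V`. -/
theorem exists_tangent_family (A : SliceCovering V x z e) (hinj : Set.InjOn z (slice V x z 0))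
    {y₁ y₂ : Fin n → ℂ} (h₁ : y₁ ∈ slice V x z 0) (h₂ : y₂ ∈ slice V x z 0) (h₁₂ : y₁ ≠ y₂)
    {E : (Fin k ⊕ Fin k → ℂ) → ℂ} (hE : PolyFun E) (hE0 : E 0 ≠ 0) :
    ∃ (η : Fin k → ℂ) (u v ζ c : ℂ) (W : Finset ℂ) (f : MvPolynomial (Fin 2) ℂ),
      f.totalDegree ≤ (slice V x z 0).ncard ∧ c ≠ 0 ∧ W.card + 2 = (slice V x z 0).ncard ∧
      ζ ∉ W ∧ (∀ Z, eval ![-v - u * Z, Z] f = c * ((Z - ζ) ^ 2 * ∏ w ∈ W, (Z - w))) ∧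
      eval ![-v - u * ζ, ζ] (pderiv 0 f) ≠ 0 ∧ E (Sum.elim (u • η) 0) ≠ 0 ∧
      ∀ s, ∀ y ∈ slice V x z (Sum.elim (u • η) (s • η)), eval ![-s - u * z y, z y] f = 0 := by
  classical
  obtain ⟨F, hF, hFprod, hFV, K, hK⟩ := A.exists_projection ⟨y₁, h₁⟩
  have hzero : (Sum.elim 0 fun _ => -0 : Fin k ⊕ Fin k → ℂ) = 0 := by ext (i | i) <;> simp
  have hF0 : ∀ Z : ℂ, F (fun o => o.elim Z 0) = ∏ᶠ y ∈ slice V x z 0, (Z - z y) := by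
    intro Z
    have h := hFprod fun o => o.elim Z 0
    simp only [Option.elim_some, Option.elim_none, Pi.zero_apply, hzero] at h
    exact h A.e_zero
  obtain ⟨η, hη⟩ := A.exists_direction hinj hF hF0 hFV h₁ h₂ h₁₂
  obtain ⟨f, hf⟩ : PolyFun fun a : Fin 2 → ℂ => F fun o => o.elim (a 1) fun i => a 0 * η i := by
    refine hF.comp (f := fun (a : Fin 2 → ℂ) (o : Option (Fin k)) =>
      o.elim (a 1) fun i => a 0 * η i) fun o => ?_
    rcases o with _ | i
    · exact PolyFun.coord 1
    · exact (PolyFun.coord 0).mul (PolyFun.const _)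
  have hfin := A.finite 0 A.e_zero
  have hdeg : f.totalDegree ≤ (slice V x z 0).ncard := by
    have hEP : PolyFun fun a : Fin 2 → ℂ => e (Sum.elim 0 fun i => -(a 0 * η i)) :=
      A.polyFun_e.comp fun o => by
        rcases o with i | i
        · exact PolyFun.const 0
        · exact ((PolyFun.coord 0).mul (PolyFun.const _)).neg
    have hK0 : 0 ≤ K := by
      have h := hK (fun o => o.elim 0 0) (by
        simp only [Option.elim_some, Pi.zero_apply, hzero]
        exact A.e_zero)
      by_contra! hneg
      exact absurd ((norm_nonneg _).trans h) (not_le.2 (mul_neg_of_neg_of_pos hneg (by positivity)))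
    refine f.totalDegree_le_of_growth hEP ⟨0, by
        simp only [Pi.zero_apply, zero_mul, hzero]
        exact A.e_zero⟩
      (K := K * (1 + ‖η‖) ^ (slice V x z 0).ncard) fun a ha => ?_
    rw [← hf]
    refine (hK _ ha).trans ?_
    rw [mul_assoc, ← mul_pow]
    gcongr
    have : ‖(fun o => o.elim (a 1) fun i => a 0 * η i : Option (Fin k) → ℂ)‖ ≤
        (1 + ‖η‖) * ‖a‖ := by
      refine (pi_norm_le_iff_of_nonneg (by positivity)).2 fun o => ?_
      rcases o with _ | i
      · simp only [Option.elim_none]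
        nlinarith [norm_le_pi_norm a 1, mul_nonneg (norm_nonneg η) (norm_nonneg a)]
      · simp only [Option.elim_some, norm_mul]
        have := mul_le_mul (norm_le_pi_norm a 0) (norm_le_pi_norm η i) (norm_nonneg _) (norm_nonneg _)
        nlinarith [norm_nonneg a]
    nlinarith [norm_nonneg η]
  have hline : PolyFun fun w : Fin 1 → ℂ => E (Sum.elim (w 0 • η) 0) := hE.comp fun o => by
    rcases o with i | i
    · exact (PolyFun.coord 0).mul (PolyFun.const _)
    · exact PolyFun.const 0
  obtain ⟨N, hN⟩ := hline.exists_polynomial_line 0 1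
  simp only [zero_add, Pi.smul_apply, Pi.one_apply, smul_eq_mul, mul_one] at hN
  have hN0 : N ≠ 0 := by
    rintro rfl
    have := hN 0
    rw [zero_smul, Sum.elim_zero_zero, Polynomial.eval_zero] at this
    exact hE0 this
  obtain ⟨u, v, ζ, c, W, hc, hu, hW, hζ, hfac, hpd⟩ := exists_simple_tangent f hdeg
    (hfin.toFinset.image z) (by
      rw [Finset.card_image_of_injOn (by simpa using hinj), Set.ncard_eq_toFinset_card _ hfin]) (by
      intro Z
      rw [← hf, Finset.prod_image (by simpa using hinj), ← finprod_mem_eq_finite_toFinset_prod _ hfin,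
        ← hF0]
      refine congrArg F (funext fun o => ?_)
      rcases o with _ | i <;> simp)
    (z y₁) (Finset.mem_image_of_mem z (hfin.mem_toFinset.2 h₁)) (by
      intro a
      obtain ⟨s, hs⟩ := hη a
      exact ⟨s, by rw [← hf]; simpa using hs⟩) N hN0
  refine ⟨η, u, v, ζ, c, W, f, hdeg, hc, hW, hζ, hfac, hpd, by rwa [hN], fun s y hy => ?_⟩
  rw [← hf, ← hFV y hy.1]
  refine congrArg F (funext fun o => ?_)
  rcases o with _ | i
  · simp
  · have := hy.2 i
    simp only [Sum.elim_inl, Sum.elim_inr, Pi.smul_apply, smul_eq_mul] at this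
    simp only [Option.elim_some, Matrix.cons_val_zero]
    linear_combination -this

end SliceCovering

namespace SliceCovering

variable {k n : ℕ} {V : Set (Fin n → ℂ)} {x : Fin k → (Fin n → ℂ) → ℂ} {z : (Fin n → ℂ) → ℂ}
  {e : (Fin k ⊕ Fin k → ℂ) → ℂ}

open Filter Topology in
/-- Some loop, based at another slice, acts as a transposition. -/
theorem exists_swap (A : SliceCovering V x z e) (hinj : Set.InjOn z (slice V x z 0))
    {y₁ y₂ : Fin n → ℂ} (h₁ : y₁ ∈ slice V x z 0) (h₂ : y₂ ∈ slice V x z 0) (h₁₂ : y₁ ≠ y₂) :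
    ∃ w, e w ≠ 0 ∧ ∃ γ : Path w w, (∀ t, e (γ t) ≠ 0) ∧ ∃ a ∈ slice V x z w, ∃ b ∈ slice V x z w,
      a ≠ b ∧ Transports V x z e γ a b ∧ Transports V x z e γ b a ∧
      ∀ y ∈ slice V x z w, y ≠ a → y ≠ b → Transports V x z e γ y y := by
  classical
  obtain ⟨S, hS, hS0, hSinj⟩ := A.exists_discriminant hinj
  obtain ⟨η, u, v, ζ, c, W, f, hdeg, hc, hW, hζ, hfac, hpd, hne, hroot⟩ :=
    A.exists_tangent_family hinj h₁ h₂ h₁₂ (A.polyFun_e.mul hS) (mul_ne_zero A.e_zero hS0)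
  obtain ⟨B, hB, hB0, hBf⟩ := f.exists_eval_line_eq u v
  obtain ⟨δ, hδ, hsep, ε₀, hε₀, hcross, hmono⟩ :=
    exists_local_monodromy hc hζ hB (by rw [hB0]; exact neg_ne_zero.2 hpd)
  let p : ℂ → Fin k ⊕ Fin k → ℂ := fun s => Sum.elim (u • η) ((v + s) • η)
  have hpc : Continuous p := continuous_pi fun i => by
    rcases i with i | i
    · exact continuous_const
    · exact (by fun_prop : Continuous fun s : ℂ => (v + s) * η i)
  have hproot : ∀ s, ∀ y ∈ slice V x z (p s),
      c * ((z y - ζ) ^ 2 * ∏ w ∈ W, (z y - w)) + s * B (s, z y) = 0 := by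
    intro s y hy
    rw [← hfac, ← hBf, ← hroot _ y hy]
    congr 3
    ring
  -- the discriminant does not vanish for small nonzero values of the parameter
  have hev1 : ∀ᶠ s : ℂ in 𝓝[≠] 0, e (p s) ≠ 0 ∧ S (p s) ≠ 0 := by
    have hline : PolyFun fun q : Fin 1 → ℂ => e (p (q 0)) * S (p (q 0)) :=
      (A.polyFun_e.mul hS).comp (f := fun q => p (q 0)) fun o => by
        rcases o with i | i
        · exact PolyFun.const _
        · exact ((PolyFun.const v).add (PolyFun.coord 0)).mul (PolyFun.const _)
    obtain ⟨N, hN⟩ := hline.exists_polynomial_line 0 1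
    simp only [zero_add, Pi.smul_apply, Pi.one_apply, smul_eq_mul, mul_one] at hN
    have hN0 : N ≠ 0 := by
      rintro rfl
      have := hN (-v)
      simp only [p, add_neg_cancel, zero_smul, Polynomial.eval_zero] at this
      exact hne this
    have hfin := Polynomial.finite_setOfPred_isRoot hN0
    have : ∀ᶠ s : ℂ in 𝓝[≠] 0, ¬ N.IsRoot s := by
      have h2 := (hfin.subset (Set.sdiff_subset (t := {0}))).isClosed.isOpen_compl.mem_nhds
        (show (0 : ℂ) ∈ ({s | N.IsRoot s} \ {0})ᶜ by simp)
      filter_upwards [mem_nhdsWithin_of_mem_nhds h2, self_mem_nhdsWithin] with s hs hs0 hr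
      exact hs ⟨hr, hs0⟩
    refine this.mono fun s hs => ?_
    rw [Polynomial.IsRoot, ← hN] at hs
    exact ⟨left_ne_zero_of_mul hs, right_ne_zero_of_mul hs⟩
  -- every root of the tangent slice is close to a root of the nearby slices
  obtain ⟨b, hb⟩ := Infinite.exists_notMem_finset (insert ζ W)
  have hb0 : c * ((b - ζ) ^ 2 * ∏ w ∈ W, (b - w)) ≠ 0 := by
    have hne : ∀ a ∈ insert ζ W, b - a ≠ 0 := fun a ha h => hb (sub_eq_zero.1 h ▸ ha)
    exact mul_ne_zero hc (mul_ne_zero (pow_ne_zero _ (hne ζ (Finset.mem_insert_self _ _)))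
      (Finset.prod_ne_zero_iff.2 fun w hw => hne w (Finset.mem_insert_of_mem hw)))
  have hev2 : ∀ᶠ s : ℂ in 𝓝 0, ∀ a ∈ insert ζ W,
      ‖eval ![-v - s - u * a, a] f‖ * (1 + ‖b - a‖ / δ) ^ (slice V x z 0).ncard <
        ‖eval ![-v - s - u * b, b] f‖ := by
    simp only [Filter.eventually_all_finset]
    intro a ha
    have ha0 : c * ((a - ζ) ^ 2 * ∏ w ∈ W, (a - w)) = 0 := by
      rcases Finset.mem_insert.1 ha with rfl | ha
      · simp
      · rw [Finset.prod_eq_zero ha (sub_self a)]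
        simp
    simp only [hBf, hfac, ha0, zero_add]
    refine ContinuousAt.eventually_lt (by fun_prop) (by fun_prop) ?_
    simpa only [zero_mul, add_zero, norm_pos_iff, norm_zero, ne_eq] using hb0
  obtain ⟨ε₁, hε₁, hball⟩ := Metric.eventually_nhds_iff.1
    ((eventually_nhdsWithin_iff.1 hev1).and hev2)
  let ε : ℝ := min ε₀ ε₁ / 2
  have hε : 0 < ε := half_pos (lt_min hε₀ hε₁)
  have hε' : ε < min ε₀ ε₁ := half_lt_self (lt_min hε₀ hε₁)
  have hgood : ∀ s : ℂ, ‖s‖ = ε → e (p s) ≠ 0 ∧ S (p s) ≠ 0 := by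
    intro s hs
    refine (hball (by rw [dist_zero_right, hs]; exact hε'.trans_le (min_le_right _ _))).1 ?_
    rintro rfl
    simp only [norm_zero] at hs
    exact hε.ne hs
  let s : unitInterval → ℂ := fun t => ε * Complex.exp (2 * Real.pi * Complex.I * (t : ℝ))
  have hs : ∀ t, ‖s t‖ = ε := by
    intro t
    simp only [s]
    rw [norm_mul, show 2 * Real.pi * Complex.I * (t : ℝ) =
        ((2 * Real.pi * t : ℝ) : ℂ) * Complex.I by push_cast; ring,
        Complex.norm_exp_ofReal_mul_I, mul_one, Complex.norm_real, Real.norm_of_nonneg hε.le]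
  have hsc : Continuous s := by fun_prop
  let γ : Path (p ε) (p ε) := ⟨⟨fun t => p (s t), hpc.comp hsc⟩, by simp [s], by
    simp [s, Complex.exp_two_pi_mul_I]⟩
  have hγe : ∀ t, e (γ t) ≠ 0 := fun t => (hgood _ (hs t)).1
  have hεn : ‖(ε : ℂ)‖ = ε := by rw [Complex.norm_real, Real.norm_of_nonneg hε.le]
  have hpε := hgood ε hεn
  have hinjε := hSinj _ hpε.1 hpε.2
  have hfin := A.finite _ hpε.1
  -- each lift stays close to the root at which it starts
  have hclus : ∀ {y y'}, Transports V x z e γ y y' → ∀ a ∈ insert ζ W, ‖z y - a‖ < δ →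
      ‖z y' - a‖ < δ ∧ (a = ζ → y' ≠ y) := by
    rintro y y' ⟨Γ, hΓ⟩ a ha hya
    have hzc : Continuous fun t => z (Γ t) := A.polyFun_z.continuous.comp Γ.continuous
    have hrt : ∀ t, c * ((z (Γ t) - ζ) ^ 2 * ∏ w ∈ W, (z (Γ t) - w)) +
        s t * B (s t, z (Γ t)) = 0 := fun t => hproot _ _ (hΓ t).2
    have hlt : ∀ t, ‖z (Γ t) - a‖ < δ := by
      by_contra! hcon
      obtain ⟨t, ht⟩ := hcon
      obtain ⟨t', ht'⟩ := mem_range_of_exists_le_of_exists_ge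
        (f := fun t => ‖z (Γ t) - a‖) (c := δ) (hzc.sub continuous_const).norm ⟨0, by simpa using hya.le⟩ ⟨t, ht⟩
      exact hcross (s t') (by rw [hs]; exact hε'.trans_le (min_le_left _ _)) a ha _ ht' (hrt t')
    refine ⟨by simpa using hlt 1, ?_⟩
    rintro rfl heq
    refine hmono ε hε (hε'.trans_le (min_le_left _ _)) _ hzc (fun t => ⟨hlt t, hrt t⟩) ?_
    simp [heq]
  have hnear : ∀ a ∈ insert ζ W, ∃ y ∈ slice V x z (p ε), ‖z y - a‖ < δ := by
    intro a ha
    let Q : Polynomial ℂ := aeval ![Polynomial.C (-v - ε) - Polynomial.C u * Polynomial.X,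
      Polynomial.X] f
    have hQ : ∀ Z, Q.eval Z = eval ![-v - ε - u * Z, Z] f := by
      intro Z
      simp only [Q]
      rw [← Polynomial.coe_aeval_eq_eval, ← AlgHom.comp_apply, comp_aeval, aeval_def,
        ← eval₂_id]
      congr 1
      ext i
      fin_cases i <;> simp
    have hcard : (hfin.toFinset.image z).card = (slice V x z 0).ncard := by
      rw [Finset.card_image_of_injOn (by simpa using hinjε), ← Set.ncard_eq_toFinset_card _ hfin,
        A.ncard_slice hpε.1]
    obtain ⟨r, hr, hra⟩ := Polynomial.exists_root_near (Q := Q) (R := hfin.toFinset.image z)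
      (a := a) (b := b) (δ := δ) (by
        rw [hcard]
        refine (aeval_natDegree_le f hdeg _ (n := 1) fun i => ?_).trans (mul_one _).le
        fin_cases i
        · change (Polynomial.C (-v - (ε : ℂ)) - Polynomial.C u * Polynomial.X).natDegree ≤ 1
          compute_degree
        · exact Polynomial.natDegree_X_le) (by
        intro r hr
        obtain ⟨y, hy, rfl⟩ := Finset.mem_image.1 hr
        rw [hQ, hBf, hfac]
        exact hproot _ y (hfin.mem_toFinset.1 hy)) hδ (by
        rw [hcard, hQ, hQ]
        exact (hball (by rw [dist_zero_right, hεn]; exact hε'.trans_le (min_le_right _ _))).2 a ha)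
    obtain ⟨y, hy, rfl⟩ := Finset.mem_image.1 hr
    exact ⟨y, hfin.mem_toFinset.1 hy, hra⟩
  choose! Y hYm hYδ using hnear
  have huniq : ∀ {y a a'}, a ∈ insert ζ W → a' ∈ insert ζ W → ‖z y - a‖ < δ → ‖z y - a'‖ < δ →
      a = a' := by
    intro y a a' ha ha' h h'
    by_contra hne
    have h1 := hsep a ha a' ha' hne
    have h2 := norm_sub_le (z y - a') (z y - a)
    rw [show z y - a' - (z y - a) = a - a' by ring] at h2
    linarith
  choose! π hπ using A.lift γ hγe
  have hζm : ζ ∈ insert ζ W := Finset.mem_insert_self _ _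
  have hY' := hclus (hπ _ (hYm ζ hζm)) ζ hζm (hYδ ζ hζm)
  have hYinj : Set.InjOn Y (insert ζ W : Finset ℂ) := fun a ha a' ha' h =>
    huniq ha ha' (hYδ a ha) (h ▸ hYδ a' ha')
  have hY'n : π (Y ζ) ∉ (insert ζ W).image Y := by
    intro h
    obtain ⟨a, ha, haY⟩ := Finset.mem_image.1 h
    obtain rfl := huniq ha hζm (haY ▸ hYδ a ha) hY'.1
    exact hY'.2 rfl haY.symm
  have hall : insert (π (Y ζ)) ((insert ζ W).image Y) = hfin.toFinset := by
    refine Finset.eq_of_subset_of_card_le ?_ ?_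
    · intro y hy
      rw [hfin.mem_toFinset]
      rcases Finset.mem_insert.1 hy with rfl | hy
      · exact (hπ _ (hYm ζ hζm)).mem_right
      · obtain ⟨a, ha, rfl⟩ := Finset.mem_image.1 hy
        exact hYm a ha
    · rw [← Set.ncard_eq_toFinset_card _ hfin, A.ncard_slice hpε.1, Finset.card_insert_of_notMem hY'n,
        Finset.card_image_of_injOn hYinj, Finset.card_insert_of_notMem hζ, ← hW]
  have hcase : ∀ y ∈ slice V x z (p ε), y = π (Y ζ) ∨ ∃ a ∈ insert ζ W, Y a = y := by
    intro y hy
    rw [← hfin.mem_toFinset, ← hall, Finset.mem_insert, Finset.mem_image] at hy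
    exact hy
  have hfix : ∀ y ∈ slice V x z (p ε), y ≠ Y ζ → y ≠ π (Y ζ) → π y = y := by
    intro y hy hyζ hyπ
    obtain ⟨a, ha, rfl⟩ := (hcase y hy).resolve_left hyπ
    have haζ : a ≠ ζ := fun h => hyζ (h ▸ rfl)
    have h1 := (hclus (hπ _ hy) a ha (hYδ a ha)).1
    rcases hcase _ (hπ _ hy).mem_right with h | ⟨a', ha', h⟩
    · exact absurd (huniq ha hζm (h ▸ h1) hY'.1) haζ
    · rw [← h, huniq ha' ha (hYδ a' ha') (h ▸ h1)]
  have hback : π (π (Y ζ)) = Y ζ := by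
    have hm := (hπ _ (hYm ζ hζm)).mem_right
    have h1 := (hclus (hπ _ hm) ζ hζm hY'.1).1
    have h2 := (hclus (hπ _ hm) ζ hζm hY'.1).2 rfl
    obtain ⟨a, ha, h⟩ := (hcase _ (hπ _ hm).mem_right).resolve_left h2
    rw [← h, huniq ha hζm (hYδ a ha) (h ▸ h1)]
  refine ⟨p ε, hpε.1, γ, hγe, Y ζ, hYm ζ hζm, π (Y ζ), (hπ _ (hYm ζ hζm)).mem_right,
    (hY'.2 rfl).symm, hπ _ (hYm ζ hζm), ?_, fun y hy h1 h2 => ?_⟩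
  · have := hπ _ (hπ _ (hYm ζ hζm)).mem_right
    rwa [hback] at this
  · have := hπ y hy
    rwa [hfix y hy h1 h2] at this

end SliceCovering

namespace SliceCovering

variable {k n : ℕ} {V : Set (Fin n → ℂ)} {x : Fin k → (Fin n → ℂ) → ℂ} {z : (Fin n → ℂ) → ℂ}
  {e : (Fin k ⊕ Fin k → ℂ) → ℂ}

/-- The monodromy group of a slice covering, acting on the slice of parameter `0`. -/
def monodromyGroup (A : SliceCovering V x z e) : Subgroup (Equiv.Perm (slice V x z 0)) where
  carrier := {σ | ∃ γ : Path (0 : Fin k ⊕ Fin k → ℂ) 0, (∀ t, e (γ t) ≠ 0) ∧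
    ∀ y : slice V x z 0, Transports V x z e γ y (σ y)}
  one_mem' := ⟨Path.refl 0, fun _ => A.e_zero, fun y => Transports.refl A.e_zero y.2⟩
  mul_mem' := by
    rintro σ τ ⟨γ, hγ, h⟩ ⟨γ', hγ', h'⟩
    refine ⟨γ'.trans γ, fun t => ?_, fun y => (h' y).trans (h (τ y))⟩
    rw [Path.trans_apply]
    split_ifs
    · exact hγ' _
    · exact hγ _
  inv_mem' := by
    rintro σ ⟨γ, hγ, h⟩
    refine ⟨γ.symm, fun t => hγ _, fun y => ?_⟩
    simpa using (h (σ⁻¹ y)).symm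

lemma exists_mem_monodromyGroup (A : SliceCovering V x z e)
    (γ : Path (0 : Fin k ⊕ Fin k → ℂ) 0) (hγ : ∀ t, e (γ t) ≠ 0) :
    ∃ σ ∈ A.monodromyGroup, ∀ y : slice V x z 0, Transports V x z e γ y (σ y) := by
  choose! τ hτ using A.lift γ hγ
  choose! τ' hτ' using A.lift γ.symm (fun t => hγ _)
  refine ⟨⟨fun y => ⟨τ y, (hτ y y.2).mem_right⟩, fun y => ⟨τ' y, (hτ' y y.2).mem_right⟩,
    fun y => ?_, fun y => ?_⟩, ⟨γ, hγ, fun y => hτ y y.2⟩, fun y => hτ y y.2⟩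
  · exact Subtype.ext (A.lift_unique γ.symm (hτ' _ (hτ y y.2).mem_right) (hτ y y.2).symm)
  · exact Subtype.ext (A.lift_unique γ (hτ _ (hτ' y y.2).mem_right)
      (by simpa using (hτ' y y.2).symm))

lemma exists_swap_mem_monodromyGroup (A : SliceCovering V x z e)
    (hinj : Set.InjOn z (slice V x z 0)) {y₁ y₂ : slice V x z 0} (h₁₂ : y₁ ≠ y₂) :
    ∃ a b : slice V x z 0, a ≠ b ∧ Equiv.swap a b ∈ A.monodromyGroup := by
  classical
  obtain ⟨w, hw, γ, hγ, a, ha, b, hb, hab, hγa, hγb, hγy⟩ :=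
    A.exists_swap hinj y₁.2 y₂.2 (fun h => h₁₂ (Subtype.ext h))
  obtain ⟨δ, hδ⟩ := (isPathConnected_ne_zero A.polyFun_e ⟨0, A.e_zero⟩).joinedIn 0 A.e_zero w hw
  have hδ' : ∀ t, e (δ.symm t) ≠ 0 := fun t => hδ _
  obtain ⟨a', ha'⟩ := A.lift _ hδ' a ha
  obtain ⟨b', hb'⟩ := A.lift _ hδ' b hb
  have ha₂ : Transports V x z e δ a' a := by simpa using ha'.symm
  have hb₂ : Transports V x z e δ b' b := by simpa using hb'.symm
  have hab' : a' ≠ b' := by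
    rintro rfl
    exact hab (A.lift_unique δ ha₂ hb₂)
  refine ⟨⟨a', ha'.mem_right⟩, ⟨b', hb'.mem_right⟩, fun h => hab' (congrArg Subtype.val h),
    (δ.trans γ).trans δ.symm, fun t => ?_, fun y => ?_⟩
  · rw [Path.trans_apply]
    split_ifs
    · rw [Path.trans_apply]
      split_ifs
      · exact hδ _
      · exact hγ _
    · exact hδ' _
  · rw [Equiv.swap_apply_def]
    split_ifs with h1 h2
    · rw [h1]
      exact (ha₂.trans hγa).trans hb'
    · rw [h2]
      exact (hb₂.trans hγb).trans ha'
    · obtain ⟨y', hy'⟩ := A.lift δ hδ y y.2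
      refine (hy'.trans (hγy y' hy'.mem_right ?_ ?_)).trans hy'.symm
      · rintro rfl
        exact h1 (Subtype.ext (A.lift_unique _ hy'.symm ha'))
      · rintro rfl
        exact h2 (Subtype.ext (A.lift_unique _ hy'.symm hb'))

/-- The monodromy group of a slice covering is the full symmetric group. -/
theorem monodromyGroup_eq_top (A : SliceCovering V x z e) (hinj : Set.InjOn z (slice V x z 0)) :
    A.monodromyGroup = ⊤ := by
  classical
  have : Finite (slice V x z 0) := A.finite 0 A.e_zero
  rw [eq_top_iff, ← Equiv.Perm.closure_isSwap, Subgroup.closure_le]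
  rintro _ ⟨c, d, hcd, rfl⟩
  obtain ⟨a, b, hab, hswap⟩ := A.exists_swap_mem_monodromyGroup hinj hcd
  obtain ⟨γ, hγ₁, hγ₂⟩ := A.exists_transports_pair hinj a.2 b.2 c.2 d.2
    (fun h => hab (Subtype.ext h)) (fun h => hcd (Subtype.ext h))
  obtain ⟨σ, hσ, h⟩ := A.exists_mem_monodromyGroup γ
    (fun t => by obtain ⟨Γ, hΓ⟩ := hγ₁; exact (hΓ t).1)
  have hc : σ a = c := Subtype.ext (A.lift_unique γ (h a) hγ₁)
  have hd : σ b = d := Subtype.ext (A.lift_unique γ (h b) hγ₂)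
  rw [SetLike.mem_coe, ← hc, ← hd, Equiv.swap_apply_apply]
  exact mul_mem (mul_mem hσ hswap) (inv_mem hσ)

end SliceCovering

namespace MvPolynomial

/-- The linear form with coefficients `a`. -/
def linearForm {n : ℕ} (a : Fin n → ℂ) : MvPolynomial (Fin n) ℂ := ∑ j, C (a j) * X j

variable {n : ℕ}

lemma eval_linearForm (a y : Fin n → ℂ) : eval y (linearForm a) = ∑ j, a j * y j := by
  simp [linearForm]

lemma isHomogeneous_linearForm (a : Fin n → ℂ) : (linearForm a).IsHomogeneous 1 :=
  IsHomogeneous.sum _ _ _ fun j _ => by simpa using (isHomogeneous_C _ (a j)).mul (isHomogeneous_X ℂ j)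

lemma homogeneousComponent_succ_mul {L : MvPolynomial (Fin n) ℂ} (hL : L.IsHomogeneous 1)
    (p : MvPolynomial (Fin n) ℂ) (d : ℕ) :
    homogeneousComponent (d + 1) (L * p) = L * homogeneousComponent d p := by
  conv_lhs => rw [← sum_homogeneousComponent p, Finset.mul_sum, map_sum]
  have h : ∀ i, homogeneousComponent (d + 1) (L * homogeneousComponent i p) =
      if i = d then L * homogeneousComponent i p else 0 := by
    intro i
    rw [homogeneousComponent_of_mem (hL.mul (homogeneousComponent_isHomogeneous i p))]
    exact if_congr (by omega) rfl rfl
  simp only [h, Finset.sum_ite_eq', Finset.mem_range]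
  split_ifs with hd
  · rfl
  · rw [homogeneousComponent_eq_zero _ _ (by omega), mul_zero]

/-- Homogenization of a polynomial by means of a linear form. -/
lemma exists_isHomogeneous_eval_eq (p : MvPolynomial (Fin n) ℂ) (ℓ : Fin n → ℂ) :
    ∃ q : MvPolynomial (Fin n) ℂ, (∃ d, q.IsHomogeneous d) ∧
      ∀ y, ∑ j, ℓ j * y j = 1 → eval y q = eval y p := by
  refine ⟨∑ i ∈ Finset.range (p.totalDegree + 1),
    linearForm ℓ ^ (p.totalDegree - i) * homogeneousComponent i p,
    ⟨p.totalDegree, IsHomogeneous.sum _ _ _ fun i hi => ?_⟩, fun y hy => ?_⟩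
  · have := ((isHomogeneous_linearForm ℓ).pow (p.totalDegree - i)).mul
      (homogeneousComponent_isHomogeneous i p)
    rwa [one_mul, Nat.sub_add_cancel (by simpa [Nat.lt_succ_iff] using hi)] at this
  · conv_rhs => rw [← sum_homogeneousComponent p]
    simp [map_sum, eval_linearForm, hy]

end MvPolynomial

/-- The affine cone defined by an ideal. -/
def affineCone {n : ℕ} (J : Ideal (MvPolynomial (Fin n) ℂ)) : Set (Fin n → ℂ) :=
  {y | ∀ g ∈ J, eval y g = 0}

/-- The chart `ℓ = 1` of the projective variety defined by an ideal. -/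
def chart {n : ℕ} (J : Ideal (MvPolynomial (Fin n) ℂ)) (ℓ : Fin n → ℂ) : Set (Fin n → ℂ) :=
  {y | y ∈ affineCone J ∧ ∑ j, ℓ j * y j = 1}

section

variable {n : ℕ} {J : Ideal (MvPolynomial (Fin n) ℂ)}

lemma sum_mul_smul (a y : Fin n → ℂ) (s : ℂ) :
    ∑ j, a j * (s • y) j = s * ∑ j, a j * y j := by
  rw [Finset.mul_sum]
  exact Finset.sum_congr rfl fun j _ => by rw [Pi.smul_apply, smul_eq_mul]; ring

lemma affineCone_eq_zeroLocus : affineCone J = zeroLocus ℂ J := by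
  ext y
  simp [affineCone, zeroLocus, aeval_eq_eval]

lemma smul_mem_affineCone (hJhom : ∀ g ∈ J, ∀ i : ℕ, homogeneousComponent i g ∈ J)
    {y : Fin n → ℂ} (hy : y ∈ affineCone J) (s : ℂ) : s • y ∈ affineCone J := by
  intro g hg
  rw [← sum_homogeneousComponent g, map_sum]
  refine Finset.sum_eq_zero fun i _ => ?_
  rw [(homogeneousComponent_isHomogeneous i g).eval_smul_point, hy _ (hJhom g hg i), mul_zero]

lemma isClosed_affineCone : IsClosed (affineCone J) := by
  have : affineCone J = ⋂ g ∈ J, {y | eval y g = 0} := by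
    ext y
    simp [affineCone]
  rw [this]
  exact isClosed_biInter fun g _ => isClosed_eq (PolyFun.eval g).continuous continuous_const

lemma mem_of_eval_eq_zero (hJ : J.IsPrime) {p : MvPolynomial (Fin n) ℂ}
    (h : ∀ y ∈ affineCone J, eval y p = 0) : p ∈ J := by
  rw [← IsPrime.vanishingIdeal_zeroLocus (K := ℂ) J, ← affineCone_eq_zeroLocus,
    mem_vanishingIdeal_iff]
  simpa [aeval_eq_eval] using h

/-- A chart of an irreducible projective variety is irreducible. -/
lemma chart_irreducible (hJ : J.IsPrime)
    (hJhom : ∀ g ∈ J, ∀ i : ℕ, homogeneousComponent i g ∈ J) (ℓ : Fin n → ℂ)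
    {φ ψ : (Fin n → ℂ) → ℂ} (hφ : PolyFun φ) (hψ : PolyFun ψ)
    (hφ0 : ∃ y ∈ chart J ℓ, φ y ≠ 0) (hψ0 : ∃ y ∈ chart J ℓ, ψ y ≠ 0) :
    ∃ y ∈ chart J ℓ, φ y ≠ 0 ∧ ψ y ≠ 0 := by
  obtain ⟨p, hp⟩ := hφ
  obtain ⟨q, hq⟩ := hψ
  obtain ⟨p', ⟨d, hd⟩, hp'⟩ := exists_isHomogeneous_eval_eq p ℓ
  obtain ⟨q', ⟨d', hd'⟩, hq'⟩ := exists_isHomogeneous_eval_eq q ℓ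
  obtain ⟨y₁, hy₁, hφ1⟩ := hφ0
  obtain ⟨y₂, hy₂, hψ2⟩ := hψ0
  by_contra! hcon
  have hprod : linearForm ℓ * (p' * q') ∈ J := by
    refine mem_of_eval_eq_zero hJ fun y hy => ?_
    rw [map_mul, map_mul, eval_linearForm]
    by_cases h0 : ∑ j, ℓ j * y j = 0
    · rw [h0, zero_mul]
    · let s := ∑ j, ℓ j * y j
      have hs : s ≠ 0 := h0
      have hmem : s⁻¹ • y ∈ chart J ℓ := by
        refine ⟨smul_mem_affineCone hJhom hy _, ?_⟩
        rw [sum_mul_smul]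
        exact inv_mul_cancel₀ hs
      have h := hcon _ hmem
      rw [hp, hq, ← hp' _ hmem.2, ← hq' _ hmem.2, hd.eval_smul_point, hd'.eval_smul_point] at h
      have hs' : s⁻¹ ≠ 0 := inv_ne_zero hs
      have hpq : eval y p' * eval y q' = 0 := by
        by_cases hpy : eval y p' = 0
        · rw [hpy, zero_mul]
        · have := h (mul_ne_zero (pow_ne_zero _ hs') hpy)
          rw [(mul_eq_zero.1 this).resolve_left (pow_ne_zero _ hs'), mul_zero]
      rw [hpq, mul_zero]
  rcases hJ.mem_or_mem hprod with h | h
  · have := hy₁.1 _ h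
    rw [eval_linearForm, hy₁.2] at this
    exact one_ne_zero this
  rcases hJ.mem_or_mem h with h | h
  · exact hφ1 (by rw [hp, ← hp' _ hy₁.2, hy₁.1 _ h])
  · exact hψ2 (by rw [hq, ← hq' _ hy₂.2, hy₂.1 _ h])

end

section

variable {n k : ℕ} {J : Ideal (MvPolynomial (Fin n) ℂ)}

lemma MvPolynomial.IsHomogeneous.eval_eq_sum_finsuppAntidiag {p : MvPolynomial (Fin n) ℂ} {d : ℕ}
    (hp : p.IsHomogeneous d) (y : Fin n → ℂ) :
    eval y p = ∑ t : Finset.finsuppAntidiag (Finset.univ : Finset (Fin n)) d,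
      coeff t.1 p * ∏ j, y j ^ t.1 j := by
  rw [eval_eq', Finset.sum_coe_sort (Finset.finsuppAntidiag (Finset.univ : Finset (Fin n)) d)
    fun t => coeff t p * ∏ j, y j ^ t j]
  refine Finset.sum_subset (fun t ht => ?_) (fun t _ ht => ?_)
  · have h : t.degree = d := by
      rw [Finsupp.degree_eq_weight_one]
      exact hp (mem_support_iff.1 ht)
    rw [Finset.mem_finsuppAntidiag]
    exact ⟨by rw [← h, Finsupp.degree_eq_sum], Finset.subset_univ _⟩
  · rw [notMem_support_iff.1 ht, zero_mul]

/-- If linear forms `F o` have only the trivial common zero on a cone, then large powers of the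
irrelevant ideal are contained in the ideal they generate modulo the cone. -/
lemma exists_monomial_mem (F : Option (Fin k) → Fin n → ℂ)
    (hF : ∀ y ∈ affineCone J, (∀ o, ∑ j, F o j * y j = 0) → y = 0) :
    ∃ d, ∀ t : Fin n →₀ ℕ, t.degree = d →
      monomial t 1 ∈ J ⊔ Ideal.span (Set.range fun o => linearForm (F o)) := by
  let I := J ⊔ Ideal.span (Set.range fun o => linearForm (F o))
  have hrad : idealOfVars (Fin n) ℂ ≤ I.radical := by
    rw [← vanishingIdeal_zeroLocus_eq_radical (K := ℂ) I, idealOfVars, Ideal.span_le]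
    rintro _ ⟨i, rfl⟩
    rw [SetLike.mem_coe, mem_vanishingIdeal_iff]
    intro y hy
    have hy0 : y = 0 := by
      refine hF y (fun g hg => ?_) fun o => ?_
      · rw [← aeval_eq_eval]
        exact hy g (Ideal.mem_sup_left hg)
      · rw [← eval_linearForm, ← aeval_eq_eval]
        exact hy _ (Ideal.mem_sup_right (Ideal.subset_span ⟨o, rfl⟩))
    simp [hy0]
  obtain ⟨d, hd⟩ := Ideal.exists_pow_le_of_le_radical_of_fg hrad
    (IsNoetherian.noetherian (idealOfVars (Fin n) ℂ))
  refine ⟨d, fun t ht => hd ?_⟩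
  rw [pow_idealOfVars_eq_span]
  exact Ideal.subset_span ⟨t, ht, rfl⟩

/-- Multiplication by a linear form `z` on the monomials of a fixed large degree is, on a cone,
a combination of linear forms without common zeros on the cone. -/
lemma exists_matrices (hJhom : ∀ g ∈ J, ∀ i : ℕ, homogeneousComponent i g ∈ J)
    (F : Option (Fin k) → Fin n → ℂ)
    (hF : ∀ y ∈ affineCone J, (∀ o, ∑ j, F o j * y j = 0) → y = 0) (z : Fin n → ℂ) :
    ∃ (S : Type) (_ : Fintype S) (mon : S → (Fin n → ℂ) → ℂ) (M : Option (Fin k) → Matrix S S ℂ),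
      (∀ y, y ≠ 0 → ∃ s, mon s y ≠ 0) ∧ ∀ y ∈ affineCone J, ∀ s,
        (∑ j, z j * y j) * mon s y = ∑ o, (∑ j, F o j * y j) * ∑ t, M o s t * mon t y := by
  obtain ⟨d, hd⟩ := exists_monomial_mem F hF
  have hdeg : ∀ s : Finset.finsuppAntidiag (Finset.univ : Finset (Fin n)) d, s.1.degree = d :=
    fun s => by rw [Finsupp.degree_eq_sum]; exact (Finset.mem_finsuppAntidiag.1 s.2).1
  have hcoef : ∀ s : Finset.finsuppAntidiag (Finset.univ : Finset (Fin n)) d,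
      ∃ p : Option (Fin k) → MvPolynomial (Fin n) ℂ, (∀ o, (p o).IsHomogeneous d) ∧
        ∀ y ∈ affineCone J, (∑ j, z j * y j) * (∏ j, y j ^ s.1 j) =
          ∑ o, (∑ j, F o j * y j) * eval y (p o) := by
    intro s
    obtain ⟨g, hg, r, hr, hgr⟩ := Submodule.mem_sup.1
      (Ideal.mul_mem_left _ (linearForm z) (hd s.1 (hdeg s)))
    obtain ⟨p, hp⟩ := Ideal.mem_span_range_iff_exists_fun.1 hr
    refine ⟨fun o => homogeneousComponent d (p o),
      fun o => homogeneousComponent_isHomogeneous _ _, fun y hy => ?_⟩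
    have h := congrArg (homogeneousComponent (d + 1)) hgr
    rw [homogeneousComponent_succ_mul (isHomogeneous_linearForm z), map_add, ← hp, map_sum,
      homogeneousComponent_eq_self (isHomogeneous_monomial _ (hdeg s))] at h
    have h' := congrArg (eval y) h
    rw [map_add, hy _ (hJhom g hg _), zero_add, map_mul, map_sum, eval_linearForm,
      eval_monomial, one_mul, Finsupp.prod_fintype _ _ (fun i => pow_zero _)] at h'
    rw [← h']
    refine Finset.sum_congr rfl fun o _ => ?_
    rw [mul_comm (p o), homogeneousComponent_succ_mul (isHomogeneous_linearForm _), map_mul,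
      eval_linearForm]
  choose p hp hpe using hcoef
  refine ⟨Finset.finsuppAntidiag (Finset.univ : Finset (Fin n)) d, inferInstance,
    fun s y => ∏ j, y j ^ s.1 j, fun o s t => coeff t.1 (p s o), fun y hy => ?_, fun y hy s => ?_⟩
  · obtain ⟨i, hi⟩ := Function.ne_iff.1 hy
    refine ⟨⟨Finsupp.single i d, ?_⟩, ?_⟩
    · simp [Finset.mem_finsuppAntidiag, Finsupp.single_apply]
    · refine Finset.prod_ne_zero_iff.2 fun j _ => ?_
      by_cases hij : i = j
      · exact pow_ne_zero _ (hij ▸ hi)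
      · simp [hij]
  · rw [hpe s y hy]
    exact Finset.sum_congr rfl fun o _ => by rw [(hp s o).eval_eq_sum_finsuppAntidiag]

/-- The linear system through `c` in the directions of the linear forms `z` and `ℓ`. -/
def pencil (c : Fin k → Fin n → ℂ) (z ℓ : Fin n → ℂ) (w : Fin k ⊕ Fin k → ℂ) :
    Fin k → Fin n → ℂ :=
  fun i j => c i j + w (Sum.inl i) * z j + w (Sum.inr i) * ℓ j

lemma sum_pencil_mul (c : Fin k → Fin n → ℂ) (z ℓ : Fin n → ℂ) (w : Fin k ⊕ Fin k → ℂ)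
    (y : Fin n → ℂ) (i : Fin k) :
    ∑ j, pencil c z ℓ w i j * y j = ∑ j, c i j * y j + w (Sum.inl i) * ∑ j, z j * y j +
      w (Sum.inr i) * ∑ j, ℓ j * y j := by
  simp only [pencil, Finset.mul_sum, ← Finset.sum_add_distrib]
  exact Finset.sum_congr rfl fun j _ => by ring

/-- Elimination: on the linear sections of a projective variety near `c`, the ratio `z / ℓ`
satisfies a polynomial equation. -/
lemma exists_elimination (hJhom : ∀ g ∈ J, ∀ i : ℕ, homogeneousComponent i g ∈ J)
    (c : Fin k → Fin n → ℂ) (z ℓ : Fin n → ℂ)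
    (hc : ∀ y ∈ affineCone J, (∀ i, ∑ j, c i j * y j = 0) → ∑ j, ℓ j * y j = 0 → y = 0) :
    ∃ (κ : (Fin k ⊕ Fin k → ℂ) → ℂ) (N : ℕ) (a : ℕ → (Fin k ⊕ Fin k → ℂ) → ℂ),
      PolyFun κ ∧ (∀ j, PolyFun (a j)) ∧ κ 0 = 1 ∧ ∀ w, κ w ≠ 0 →
        ∀ y ∈ affineCone J, y ≠ 0 → (∀ i, ∑ j, pencil c z ℓ w i j * y j = 0) →
          ∑ j, ℓ j * y j ≠ 0 ∧ (∑ j, ℓ j * y j = 1 →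
            κ w * (∑ j, z j * y j) ^ N + ∑ i ∈ Finset.range N, a i w * (∑ j, z j * y j) ^ i = 0) := by
  classical
  obtain ⟨S, _, mon, M, hmon, hM⟩ := exists_matrices hJhom (fun o => o.elim ℓ c)
    (fun y hy h => hc y hy (fun i => h (some i)) (h none)) z
  let R := MvPolynomial (Fin k ⊕ Fin k) ℂ
  let P : Matrix S S R := 1 + ∑ i, (X (Sum.inl i) : R) • (M (some i)).map C
  let Q : Matrix S S R := -(M none).map C + ∑ i, (X (Sum.inr i) : R) • (M (some i)).map C
  let f : Polynomial R := ((Polynomial.X : Polynomial R) • P.map Polynomial.C +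
    Q.map Polynomial.C).det
  have hfdeg : f.natDegree ≤ Fintype.card S := Polynomial.natDegree_det_X_add_C_le P Q
  have hflead : f.coeff (Fintype.card S) = P.det := Polynomial.coeff_det_X_add_C_card P Q
  have hPe : ∀ w s t, eval w (P s t) = (1 + ∑ i, w (Sum.inl i) • M (some i)) s t := by
    intro w s t
    simp [P, Matrix.sum_apply, Matrix.one_apply, apply_ite]
  have hQe : ∀ w s t, eval w (Q s t) = (-M none + ∑ i, w (Sum.inr i) • M (some i)) s t := by
    intro w s t
    simp [Q, Matrix.sum_apply]
  have hPw : ∀ w, eval w P.det = (1 + ∑ i, w (Sum.inl i) • M (some i)).det := by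
    intro w
    rw [RingHom.map_det]
    congr 1
    ext s t
    exact hPe w s t
  have hfw : ∀ w s, (f.map (eval w)).eval s = (s • (1 + ∑ i, w (Sum.inl i) • M (some i)) +
      (-M none + ∑ i, w (Sum.inr i) • M (some i))).det := by
    intro w s
    rw [← Polynomial.coe_mapRingHom, ← Polynomial.coe_evalRingHom, RingHom.map_det, RingHom.map_det]
    congr 1
    ext a b
    rw [RingHom.mapMatrix_apply, Matrix.map_apply, RingHom.mapMatrix_apply, Matrix.map_apply,
      Matrix.add_apply, Matrix.add_apply, Matrix.smul_apply, Matrix.smul_apply, ← hPe, ← hQe]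
    simp
    ring
  refine ⟨fun w => eval w P.det, Fintype.card S, fun i w => eval w (f.coeff i), PolyFun.eval _,
    fun i => PolyFun.eval _, ?_, fun w hw y hy hy0 hyw => ?_⟩
  · rw [show (fun w => eval w P.det) 0 = eval 0 P.det from rfl, hPw]
    simp
  have hx : ∀ i, ∑ j, c i j * y j = -(w (Sum.inl i) * ∑ j, z j * y j) -
      w (Sum.inr i) * ∑ j, ℓ j * y j := by
    intro i
    have h := hyw i
    rw [sum_pencil_mul] at h
    linear_combination h
  let m : S → ℂ := fun s => mon s y
  have hm : m ≠ 0 := by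
    obtain ⟨s, hs⟩ := hmon y hy0
    exact Function.ne_iff.2 ⟨s, hs⟩
  have hmat : ((∑ j, z j * y j) • (1 + ∑ i, w (Sum.inl i) • M (some i)) +
      (∑ j, ℓ j * y j) • (-M none + ∑ i, w (Sum.inr i) • M (some i))).mulVec m = 0 := by
    ext s
    have h := hM y hy s
    rw [Fintype.sum_option] at h
    simp only [Option.elim_none, Option.elim_some, hx] at h
    have hMm : ∀ o, ∑ t, M o s t * mon t y = (M o).mulVec m s := fun o => rfl
    simp only [hMm] at h
    simp only [Matrix.add_mulVec, Matrix.smul_mulVec, Matrix.one_mulVec, Matrix.neg_mulVec,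
      Matrix.sum_mulVec, Pi.add_apply, Pi.smul_apply, Pi.neg_apply, Finset.sum_apply, smul_eq_mul,
      Pi.zero_apply]
    simp only [sub_mul, neg_mul, Finset.sum_sub_distrib, Finset.sum_neg_distrib] at h
    have h1 : ∀ (b : Fin k → ℂ) (r : ℂ), ∑ i, b i * r * (M (some i)).mulVec m s =
        r * ∑ i, b i * (M (some i)).mulVec m s := by
      intro b r
      rw [Finset.mul_sum]
      exact Finset.sum_congr rfl fun i _ => by ring
    rw [h1, h1] at h
    linear_combination h
  refine ⟨fun hℓ => hw ?_, fun hℓ => ?_⟩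
  · have hz : ∑ j, z j * y j ≠ 0 := fun hz => hy0 (hc y hy (fun i => by rw [hx, hz, hℓ]; ring) hℓ)
    rw [hℓ, zero_smul, add_zero, Matrix.smul_mulVec] at hmat
    rw [show (fun w => eval w P.det) w = eval w P.det from rfl, hPw]
    exact Matrix.exists_mulVec_eq_zero_iff.1 ⟨m, hm, (smul_eq_zero.1 hmat).resolve_left hz⟩
  · rw [hℓ, one_smul] at hmat
    have h := Matrix.exists_mulVec_eq_zero_iff.1 ⟨m, hm, hmat⟩
    rw [← hfw, Polynomial.eval_eq_sum_range' (n := Fintype.card S + 1)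
      (Nat.lt_succ_of_le (Polynomial.natDegree_map_le.trans hfdeg)), Finset.sum_range_succ] at h
    simp only [Polynomial.coeff_map, hflead] at h
    rw [add_comm]
    exact h

/-- A linear form on a cone is bounded by linear forms without common zeros on the cone. -/
lemma exists_bound_linearForm (hJhom : ∀ g ∈ J, ∀ i : ℕ, homogeneousComponent i g ∈ J)
    (c : Fin k → Fin n → ℂ) (z ℓ : Fin n → ℂ)
    (hc : ∀ y ∈ affineCone J, (∀ i, ∑ j, c i j * y j = 0) → ∑ j, ℓ j * y j = 0 → y = 0) :
    ∃ C : ℝ, 0 ≤ C ∧ ∀ y ∈ affineCone J,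
      ‖∑ j, z j * y j‖ ≤ C * (‖∑ j, ℓ j * y j‖ + ‖fun i => ∑ j, c i j * y j‖) := by
  let K := Metric.sphere (0 : Fin n → ℂ) 1 ∩ affineCone J
  have hK : IsCompact K := (isCompact_sphere _ _).inter_right isClosed_affineCone
  have hpos : ∀ y ∈ K, 0 < ‖∑ j, ℓ j * y j‖ + ‖fun i => ∑ j, c i j * y j‖ := by
    rintro y ⟨hy1, hy⟩
    by_contra! h
    have h1 := norm_nonneg (∑ j, ℓ j * y j)
    have h2 := norm_nonneg (fun i => ∑ j, c i j * y j)
    have h3 : (fun i => ∑ j, c i j * y j) = 0 := norm_eq_zero.1 (by linarith)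
    have hy0 := hc y hy (fun i => congrFun h3 i) (norm_eq_zero.1 (by linarith))
    rw [hy0] at hy1
    simp at hy1
  obtain ⟨C, hC⟩ := hK.exists_bound_of_continuousOn (f := fun y =>
      ‖∑ j, z j * y j‖ / (‖∑ j, ℓ j * y j‖ + ‖fun i => ∑ j, c i j * y j‖))
    (ContinuousOn.div (by fun_prop) (by fun_prop) fun y hy => (hpos y hy).ne')
  refine ⟨max C 0, le_max_right _ _, fun y hy => ?_⟩
  by_cases hy0 : y = 0
  · simp [hy0]
    positivity
  · have hny : ‖y‖ ≠ 0 := norm_ne_zero_iff.2 hy0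
    have hmem : ((‖y‖ : ℂ)⁻¹) • y ∈ K := by
      refine ⟨?_, smul_mem_affineCone hJhom hy _⟩
      rw [mem_sphere_zero_iff_norm, norm_smul, norm_inv, Complex.norm_real, norm_norm,
        inv_mul_cancel₀ hny]
    have h := (le_abs_self _).trans (hC _ hmem)
    have hp := hpos _ hmem
    rw [div_le_iff₀ hp] at h
    have hvec : (fun i => ∑ j, c i j * ((‖y‖ : ℂ)⁻¹ • y) j) =
        ((‖y‖ : ℂ)⁻¹) • fun i => ∑ j, c i j * y j := by
      ext i
      rw [sum_mul_smul, Pi.smul_apply, smul_eq_mul]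
    rw [hvec, sum_mul_smul, sum_mul_smul, norm_smul, norm_mul, norm_mul, norm_inv,
      Complex.norm_real, norm_norm] at h
    have hinv : 0 < ‖y‖⁻¹ := inv_pos.2 (norm_pos_iff.2 hy0)
    have h' : ‖∑ j, z j * y j‖ ≤ C * (‖∑ j, ℓ j * y j‖ + ‖fun i => ∑ j, c i j * y j‖) :=
      le_of_mul_le_mul_left (by linarith) hinv
    exact h'.trans (mul_le_mul_of_nonneg_right (le_max_left _ _) (by positivity))

end

section Normalize

variable {m : ℕ}

/-- The representative of a projective point on the affine hyperplane `ℓ = 1`. -/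
def chartRep (ℓ : Fin (m + 1) → ℂ) (P : Projectivization ℂ (Fin (m + 1) → ℂ)) :
    Fin (m + 1) → ℂ :=
  (∑ j, ℓ j * P.rep j)⁻¹ • P.rep

lemma chartRep_mk (ℓ : Fin (m + 1) → ℂ) {y : Fin (m + 1) → ℂ} (hy : y ≠ 0) :
    chartRep ℓ (Projectivization.mk ℂ y hy) = (∑ j, ℓ j * y j)⁻¹ • y := by
  obtain ⟨a, ha⟩ := Projectivization.exists_smul_eq_mk_rep ℂ y hy
  rw [chartRep, ← ha, Units.smul_def, sum_mul_smul, mul_inv, smul_smul]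
  congr 1
  field_simp

lemma continuous_mk' : Continuous (Projectivization.mk' ℂ (V := Fin (m + 1) → ℂ)) :=
  continuous_quotient_mk'

lemma continuousOn_chartRep (ℓ : Fin (m + 1) → ℂ) :
    ContinuousOn (chartRep ℓ) {P | ∑ j, ℓ j * P.rep j ≠ 0} := by
  have hq : Topology.IsQuotientMap (Projectivization.mk' ℂ (V := Fin (m + 1) → ℂ)) :=
    isQuotientMap_quotient_mk'
  have hsum : Continuous fun v : {v : Fin (m + 1) → ℂ // v ≠ 0} => ∑ j, ℓ j * v.1 j :=
    (show Continuous fun v : Fin (m + 1) → ℂ => ∑ j, ℓ j * v j by fun_prop).comp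
      continuous_subtype_val
  have hpre : Projectivization.mk' ℂ (V := Fin (m + 1) → ℂ) ⁻¹' {P | ∑ j, ℓ j * P.rep j ≠ 0} =
      {v | ∑ j, ℓ j * v.1 j ≠ 0} := by
    ext ⟨y, hy⟩
    obtain ⟨a, ha⟩ := Projectivization.exists_smul_eq_mk_rep ℂ y hy
    simp only [Set.mem_preimage, Set.mem_ofPred_eq, Projectivization.mk'_eq_mk]
    rw [← ha, Units.smul_def, sum_mul_smul, mul_ne_zero_iff]
    simp
  have hopen : IsOpen {P : Projectivization ℂ (Fin (m + 1) → ℂ) | ∑ j, ℓ j * P.rep j ≠ 0} := by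
    rw [← hq.isOpen_preimage, hpre]
    exact isOpen_ne_fun hsum continuous_const
  rw [hq.continuousOn_isOpen_iff hopen, hpre]
  have : chartRep ℓ ∘ Projectivization.mk' ℂ (V := Fin (m + 1) → ℂ) =
      fun v => (∑ j, ℓ j * v.1 j)⁻¹ • v.1 := by
    ext1 ⟨y, hy⟩
    exact chartRep_mk ℓ hy
  rw [this]
  exact (hsum.continuousOn.inv₀ fun v hv => hv).smul continuous_subtype_val.continuousOn

end Normalize

section Incidence

variable {m k : ℕ} {J : Ideal (MvPolynomial (Fin (m + 1)) ℂ)}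
  {D : MvPolynomial (Fin k × Fin (m + 1)) ℂ}

/-- The conditions under which a linear system `c` and a vector `y` define a point of the
incidence variety. -/
structure Incident (J : Ideal (MvPolynomial (Fin (m + 1)) ℂ))
    (D : MvPolynomial (Fin k × Fin (m + 1)) ℂ) (c : Fin k → Fin (m + 1) → ℂ)
    (y : Fin (m + 1) → ℂ) : Prop where
  eval_ne_zero : eval (fun ij => c ij.1 ij.2) D ≠ 0
  mem : y ∈ affineCone J
  ne_zero : y ≠ 0
  sum_eq_zero : ∀ i, ∑ j, c i j * y j = 0

lemma Incident.smul (hJhom : ∀ g ∈ J, ∀ i : ℕ, homogeneousComponent i g ∈ J)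
    {c : Fin k → Fin (m + 1) → ℂ} {y : Fin (m + 1) → ℂ} (h : Incident J D c y) {s : ℂ}
    (hs : s ≠ 0) : Incident J D c (s • y) :=
  ⟨h.1, smul_mem_affineCone hJhom h.2 s, smul_ne_zero hs h.3, fun i => by
    rw [sum_mul_smul, h.4, mul_zero]⟩

/-- The point of the incidence variety defined by a linear system and a vector. -/
def incidencePoint (hJhom : ∀ g ∈ J, ∀ i : ℕ, homogeneousComponent i g ∈ J)
    {c : Fin k → Fin (m + 1) → ℂ} {y : Fin (m + 1) → ℂ} (h : Incident J D c y) :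
    IncidenceU k m J D :=
  ⟨(c, Projectivization.mk ℂ y h.3), by
    obtain ⟨a, ha⟩ := Projectivization.exists_smul_eq_mk_rep ℂ y h.3
    have h' := h.smul hJhom a.ne_zero
    rw [← Units.smul_def, ha] at h'
    exact ⟨⟨h'.2, h'.4⟩, h.1⟩⟩

lemma IncidenceU.incident (p : IncidenceU k m J D) : Incident J D p.1.1 p.1.2.rep :=
  ⟨p.2.2, p.2.1.1, p.1.2.rep_nonzero, p.2.1.2⟩

lemma incidencePoint_rep (hJhom : ∀ g ∈ J, ∀ i : ℕ, homogeneousComponent i g ∈ J)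
    (p : IncidenceU k m J D) : incidencePoint hJhom p.incident = p :=
  Subtype.ext (Prod.ext rfl (Projectivization.mk_rep _))

lemma incidencePoint_smul (hJhom : ∀ g ∈ J, ∀ i : ℕ, homogeneousComponent i g ∈ J)
    {c : Fin k → Fin (m + 1) → ℂ} {y : Fin (m + 1) → ℂ} (h : Incident J D c y) {s : ℂ}
    (h' : Incident J D c (s • y)) : incidencePoint hJhom h' = incidencePoint hJhom h :=
  Subtype.ext (Prod.ext rfl ((Projectivization.mk_eq_mk_iff' ℂ _ _ _ _).2 ⟨s, rfl⟩))

lemma continuous_incidencePoint (hJhom : ∀ g ∈ J, ∀ i : ℕ, homogeneousComponent i g ∈ J)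
    {T : Type*} [TopologicalSpace T] {c : T → Fin k → Fin (m + 1) → ℂ}
    {y : T → Fin (m + 1) → ℂ} (hc : Continuous c) (hy : Continuous y)
    (h : ∀ t, Incident J D (c t) (y t)) : Continuous fun t => incidencePoint hJhom (h t) :=
  Continuous.subtype_mk (hc.prodMk (continuous_mk'.comp (hy.subtype_mk fun t => (h t).3))) _

/-- The fibers of the incidence covering are finite. -/
lemma finite_fiber (hJhom : ∀ g ∈ J, ∀ i : ℕ, homogeneousComponent i g ∈ J)
    (hcov : IsCoveringMap (rho1 k m J D)) (c : Uopen k m D) :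
    (rho1 k m J D ⁻¹' {c}).Finite := by
  let K : Set (Fin (m + 1) → ℂ) :=
    Metric.sphere 0 1 ∩ (affineCone J ∩ {y | ∀ i, ∑ j, c.1 i j * y j = 0})
  have hK : IsCompact K := by
    refine (isCompact_sphere _ _).inter_right (isClosed_affineCone.inter ?_)
    rw [Set.ofPred_forall]
    exact isClosed_iInter fun i => isClosed_eq (by fun_prop) continuous_const
  have hinc : ∀ y : K, Incident J D c.1 y.1 := fun y => ⟨c.2, y.2.2.1, fun h => by
    have := y.2.1
    rw [h] at this
    simp at this, y.2.2.2⟩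
  have : CompactSpace K := isCompact_iff_compactSpace.1 hK
  have hcomp : IsCompact (rho1 k m J D ⁻¹' {c}) := by
    convert isCompact_range
      (continuous_incidencePoint hJhom (T := K) continuous_const continuous_subtype_val hinc) using 1
    refine Set.Subset.antisymm (fun p hp => ?_) ?_
    · obtain rfl : rho1 k m J D p = c := hp
      have hr := p.incident
      have hn : ‖p.1.2.rep‖ ≠ 0 := norm_ne_zero_iff.2 hr.3
      have hs : ((‖p.1.2.rep‖ : ℂ))⁻¹ ≠ 0 := inv_ne_zero (by exact_mod_cast hn)
      have hr' := hr.smul hJhom hs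
      refine ⟨⟨_, ?_, hr'.2, hr'.4⟩, ?_⟩
      · rw [mem_sphere_zero_iff_norm, norm_smul, norm_inv, Complex.norm_real, norm_norm,
          inv_mul_cancel₀ hn]
      · exact (incidencePoint_smul hJhom hr hr').trans (incidencePoint_rep hJhom p)
    · rintro _ ⟨y, rfl⟩
      rfl
  exact hcomp.finite ⟨(hcov c).discreteTopology_fiber⟩

end Incidence

section LinearSlice

variable {m k : ℕ} {J : Ideal (MvPolynomial (Fin (m + 1)) ℂ)}
  {D : MvPolynomial (Fin k × Fin (m + 1)) ℂ}

/-- The linear section of the chart `ℓ = 1` by the member `w` of the pencil. -/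
abbrev linearSlice (J : Ideal (MvPolynomial (Fin (m + 1)) ℂ)) (c : Fin k → Fin (m + 1) → ℂ)
    (z ℓ : Fin (m + 1) → ℂ) (w : Fin k ⊕ Fin k → ℂ) : Set (Fin (m + 1) → ℂ) :=
  slice (chart J ℓ) (fun i y => ∑ j, c i j * y j) (fun y => ∑ j, z j * y j) w

variable {c : Fin k → Fin (m + 1) → ℂ} {z ℓ : Fin (m + 1) → ℂ} {w : Fin k ⊕ Fin k → ℂ}

lemma mem_linearSlice {y : Fin (m + 1) → ℂ} : y ∈ linearSlice J c z ℓ w ↔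
    y ∈ chart J ℓ ∧ ∀ i, ∑ j, pencil c z ℓ w i j * y j = 0 := by
  refine and_congr_right fun hy => forall_congr' fun i => ?_
  rw [sum_pencil_mul, hy.2, mul_one]

lemma incident_of_mem (hw : eval (fun ij => pencil c z ℓ w ij.1 ij.2) D ≠ 0)
    {y : Fin (m + 1) → ℂ} (hy : y ∈ linearSlice J c z ℓ w) : Incident J D (pencil c z ℓ w) y := by
  rw [mem_linearSlice] at hy
  refine ⟨hw, hy.1.1, fun h => ?_, hy.2⟩
  have := hy.1.2
  simp [h] at this

lemma chartRep_incidencePoint (hJhom : ∀ g ∈ J, ∀ i : ℕ, homogeneousComponent i g ∈ J)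
    {y : Fin (m + 1) → ℂ} (hy : y ∈ linearSlice J c z ℓ w) {c' : Fin k → Fin (m + 1) → ℂ}
    (h : Incident J D c' y) : chartRep ℓ (incidencePoint hJhom h).1.2 = y := by
  rw [incidencePoint, chartRep_mk, hy.1.2, inv_one, one_smul]

lemma chartRep_mem (hJhom : ∀ g ∈ J, ∀ i : ℕ, homogeneousComponent i g ∈ J)
    {p : IncidenceU k m J D} (hp : p.1.1 = pencil c z ℓ w) (hℓ : ∑ j, ℓ j * p.1.2.rep j ≠ 0) :
    chartRep ℓ p.1.2 ∈ linearSlice J c z ℓ w := by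
  have h := p.incident.smul hJhom (inv_ne_zero hℓ)
  rw [mem_linearSlice]
  refine ⟨⟨h.2, ?_⟩, fun i => ?_⟩
  · rw [chartRep, sum_mul_smul, inv_mul_cancel₀ hℓ]
  · rw [← hp]
    exact h.4 i

lemma incidencePoint_chartRep (hJhom : ∀ g ∈ J, ∀ i : ℕ, homogeneousComponent i g ∈ J)
    {p : IncidenceU k m J D} (hp : p.1.1 = pencil c z ℓ w)
    (h : Incident J D (pencil c z ℓ w) (chartRep ℓ p.1.2)) : incidencePoint hJhom h = p := by
  revert h
  rw [← hp]
  intro h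
  exact (incidencePoint_smul hJhom p.incident h).trans (incidencePoint_rep hJhom p)

lemma continuous_pencil (c : Fin k → Fin (m + 1) → ℂ) (z ℓ : Fin (m + 1) → ℂ) :
    Continuous (pencil c z ℓ) := by
  unfold pencil
  fun_prop

/-- The hypotheses under which linear sections of a chart form a slice covering of
`{e ≠ 0}`. -/
structure GoodPencil (J : Ideal (MvPolynomial (Fin (m + 1)) ℂ))
    (D : MvPolynomial (Fin k × Fin (m + 1)) ℂ) (c : Fin k → Fin (m + 1) → ℂ)
    (z ℓ : Fin (m + 1) → ℂ) (e : (Fin k ⊕ Fin k → ℂ) → ℂ) : Prop where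
  hom : ∀ g ∈ J, ∀ i : ℕ, homogeneousComponent i g ∈ J
  cov : IsCoveringMap (rho1 k m J D)
  polyFun_e : PolyFun e
  eval_ne_zero : ∀ w, e w ≠ 0 → eval (fun ij => pencil c z ℓ w ij.1 ij.2) D ≠ 0
  sum_ne_zero : ∀ w, e w ≠ 0 → ∀ y ∈ affineCone J, y ≠ 0 →
    (∀ i, ∑ j, pencil c z ℓ w i j * y j = 0) → ∑ j, ℓ j * y j ≠ 0

namespace GoodPencil

variable {e : (Fin k ⊕ Fin k → ℂ) → ℂ}

lemma rep_ne_zero (h : GoodPencil J D c z ℓ e) (hw : e w ≠ 0) {p : IncidenceU k m J D}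
    (hp : p.1.1 = pencil c z ℓ w) : ∑ j, ℓ j * p.1.2.rep j ≠ 0 :=
  h.sum_ne_zero w hw _ p.incident.2 p.incident.3 fun i => by rw [← hp]; exact p.incident.4 i

lemma finite (h : GoodPencil J D c z ℓ e) (hw : e w ≠ 0) : (linearSlice J c z ℓ w).Finite := by
  refine ((finite_fiber h.hom h.cov ⟨pencil c z ℓ w, h.eval_ne_zero w hw⟩).image
    fun p => chartRep ℓ p.1.2).subset fun y hy => ?_
  exact ⟨incidencePoint h.hom (incident_of_mem (h.eval_ne_zero w hw) hy), rfl,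
    chartRep_incidencePoint h.hom hy _⟩

lemma sections (h : GoodPencil J D c z ℓ e) {w₀ : Fin k ⊕ Fin k → ℂ} (hw₀ : e w₀ ≠ 0) :
    ∃ r > 0, ∃ σ : (Fin (m + 1) → ℂ) → (Fin k ⊕ Fin k → ℂ) → Fin (m + 1) → ℂ,
    (∀ w ∈ Metric.ball w₀ r, e w ≠ 0) ∧
    (∀ y ∈ linearSlice J c z ℓ w₀, ContinuousOn (σ y) (Metric.ball w₀ r) ∧ σ y w₀ = y) ∧
    ∀ w ∈ Metric.ball w₀ r,
      Set.BijOn (fun y => σ y w) (linearSlice J c z ℓ w₀) (linearSlice J c z ℓ w) := by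
  classical
  let b : Uopen k m D := ⟨pencil c z ℓ w₀, h.eval_ne_zero w₀ hw₀⟩
  obtain ⟨_, U, hbU, hUo, -, H, hH⟩ := h.cov b
  obtain ⟨U', hU'o, rfl⟩ := isOpen_induced_iff.1 hUo
  have hopen : IsOpen {w | e w ≠ 0 ∧ pencil c z ℓ w ∈ U'} :=
    (isOpen_ne_fun h.polyFun_e.continuous continuous_const).inter
      (hU'o.preimage (continuous_pencil c z ℓ))
  obtain ⟨r, hr, hball⟩ := Metric.isOpen_iff.1 hopen w₀ ⟨hw₀, hbU⟩
  have hD : ∀ w, w ∈ Metric.ball w₀ r → eval (fun ij => pencil c z ℓ w ij.1 ij.2) D ≠ 0 :=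
    fun w hw => h.eval_ne_zero w (hball hw).1
  let β : ∀ w, w ∈ Metric.ball w₀ r → (Subtype.val ⁻¹' U' : Set (Uopen k m D)) :=
    fun w hw => ⟨⟨pencil c z ℓ w, hD w hw⟩, (hball hw).2⟩
  have hw₀r : w₀ ∈ Metric.ball w₀ r := Metric.mem_ball_self hr
  let pt : ∀ {w}, w ∈ Metric.ball w₀ r → ∀ {y}, y ∈ linearSlice J c z ℓ w →
      (rho1 k m J D ⁻¹' (Subtype.val ⁻¹' U') : Set (IncidenceU k m J D)) :=
    fun {w} hw {y} hy => ⟨incidencePoint h.hom (incident_of_mem (hD w hw) hy), (hball hw).2⟩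
  have hpt : ∀ {w} (hw : w ∈ Metric.ball w₀ r) {y} (hy : y ∈ linearSlice J c z ℓ w),
      H (pt hw hy) = (β w hw, (H (pt hw hy)).2) :=
    fun hw y hy => Prod.ext (Subtype.ext (hH _)) rfl
  have hrep : ∀ {w} (hw : w ∈ Metric.ball w₀ r) {y} (hy : y ∈ linearSlice J c z ℓ w),
      chartRep ℓ (pt hw hy).1.1.2 = y :=
    fun hw y hy => chartRep_incidencePoint h.hom hy (incident_of_mem (hD _ hw) hy)
  have hbase : ∀ {w} (hw : w ∈ Metric.ball w₀ r) i, (H.symm (β w hw, i)).1.1.1 = pencil c z ℓ w := by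
    intro w hw i
    have := hH (H.symm (β w hw, i))
    rw [H.apply_symm_apply] at this
    exact (congrArg Subtype.val this).symm
  have hne : ∀ {w} (hw : w ∈ Metric.ball w₀ r) i,
      ∑ j, ℓ j * (H.symm (β w hw, i)).1.1.2.rep j ≠ 0 :=
    fun hw i => h.rep_ne_zero (hball hw).1 (hbase hw i)
  have hmem : ∀ {w} (hw : w ∈ Metric.ball w₀ r) i,
      chartRep ℓ (H.symm (β w hw, i)).1.1.2 ∈ linearSlice J c z ℓ w :=
    fun hw i => chartRep_mem h.hom (hbase hw i) (hne hw i)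
  have hpt' : ∀ {w} (hw : w ∈ Metric.ball w₀ r) i, pt hw (hmem hw i) = H.symm (β w hw, i) :=
    fun hw i => Subtype.ext (incidencePoint_chartRep h.hom (hbase hw i)
      (incident_of_mem (hD _ hw) (hmem hw i)))
  let σ : (Fin (m + 1) → ℂ) → (Fin k ⊕ Fin k → ℂ) → Fin (m + 1) → ℂ := fun y w =>
    if hyw : y ∈ linearSlice J c z ℓ w₀ ∧ w ∈ Metric.ball w₀ r then
      chartRep ℓ (H.symm (β w hyw.2, (H (pt hw₀r hyw.1)).2)).1.1.2 else 0
  have hσ : ∀ {w} (hw : w ∈ Metric.ball w₀ r) {y} (hy : y ∈ linearSlice J c z ℓ w₀),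
      σ y w = chartRep ℓ (H.symm (β w hw, (H (pt hw₀r hy)).2)).1.1.2 :=
    fun hw y hy => dif_pos ⟨hy, hw⟩
  refine ⟨r, hr, σ, fun w hw => (hball hw).1, fun y hy => ⟨?_, ?_⟩, fun w hw => ⟨?_, ?_, ?_⟩⟩
  · rw [continuousOn_iff_continuous_domRestrict]
    have heq : (Metric.ball w₀ r).domRestrict (σ y) = fun w : Metric.ball w₀ r =>
        chartRep ℓ (H.symm (β w.1 w.2, (H (pt hw₀r hy)).2)).1.1.2 := by
      ext1 w
      exact hσ w.2 hy
    rw [heq]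
    have hβ : Continuous fun w : Metric.ball w₀ r => β w.1 w.2 := by
      refine Continuous.subtype_mk (Continuous.subtype_mk ?_ _) _
      exact (continuous_pencil c z ℓ).comp continuous_subtype_val
    have hval : Continuous (Subtype.val : (rho1 k m J D ⁻¹' (Subtype.val ⁻¹' U') :
        Set (IncidenceU k m J D)) → IncidenceU k m J D) := continuous_subtype_val
    refine (continuousOn_chartRep ℓ).comp_continuous
      (continuous_snd.comp (continuous_subtype_val.comp (hval.comp
        (H.symm.continuous.comp (Continuous.prodMk hβ continuous_const)))))
      fun w => hne w.2 _
  · rw [hσ hw₀r hy, ← hpt hw₀r hy, H.symm_apply_apply, hrep hw₀r hy]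
  · intro y hy
    change σ y w ∈ _
    rw [hσ hw hy]
    exact hmem hw _
  · intro y hy y' hy' heq
    change σ y w = σ y' w at heq
    rw [hσ hw hy, hσ hw hy'] at heq
    have h1 : ∀ {a b} (ha : a ∈ linearSlice J c z ℓ w) (hb : b ∈ linearSlice J c z ℓ w),
        a = b → pt hw ha = pt hw hb := by
      rintro a b _ _ rfl
      rfl
    replace h1 := h1 (hmem hw _) (hmem hw _) heq
    rw [hpt' hw, hpt' hw] at h1
    have h2 := congrArg Prod.snd (H.symm.injective h1)
    have h3 : pt hw₀r hy = pt hw₀r hy' := H.injective (by rw [hpt hw₀r hy, hpt hw₀r hy', h2])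
    rw [← hrep hw₀r hy, ← hrep hw₀r hy', h3]
  · intro y hy
    refine ⟨_, hmem hw₀r (H (pt hw hy)).2, ?_⟩
    change σ _ w = y
    rw [hσ hw (hmem hw₀r _), hpt' hw₀r, H.apply_symm_apply]
    change chartRep ℓ (H.symm (β w hw, (H (pt hw hy)).2)).1.1.2 = y
    rw [← hpt hw hy, H.symm_apply_apply, hrep hw hy]

end GoodPencil

end LinearSlice

namespace GoodPencil

variable {m k : ℕ} {J : Ideal (MvPolynomial (Fin (m + 1)) ℂ)}
  {D : MvPolynomial (Fin k × Fin (m + 1)) ℂ} {c : Fin k → Fin (m + 1) → ℂ}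
  {z ℓ : Fin (m + 1) → ℂ} {w w' : Fin k ⊕ Fin k → ℂ} {e : (Fin k ⊕ Fin k → ℂ) → ℂ}

/-- The path in the base of the incidence covering defined by a path of parameters. -/
def basePath (h : GoodPencil J D c z ℓ e) (γ : Path w w') (hγ : ∀ t, e (γ t) ≠ 0) :
    C(unitInterval, Uopen k m D) :=
  ⟨fun t => ⟨pencil c z ℓ (γ t), h.eval_ne_zero _ (hγ t)⟩,
    Continuous.subtype_mk ((continuous_pencil c z ℓ).comp γ.continuous) _⟩

lemma lift (h : GoodPencil J D c z ℓ e) (γ : Path w w') (hγ : ∀ t, e (γ t) ≠ 0)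
    {y : Fin (m + 1) → ℂ} (hy : y ∈ linearSlice J c z ℓ w) :
    ∃ y', Transports (chart J ℓ) (fun i y => ∑ j, c i j * y j) (fun y => ∑ j, z j * y j) e γ
      y y' := by
  have hw : e w ≠ 0 := by simpa using hγ 0
  let p := incidencePoint h.hom (incident_of_mem (h.eval_ne_zero w hw) hy)
  have hp : h.basePath γ hγ 0 = rho1 k m J D p := by
    refine Subtype.ext ?_
    change pencil c z ℓ (γ 0) = pencil c z ℓ w
    rw [γ.source]
  let Γ := h.cov.liftPath (h.basePath γ hγ) p hp
  have hbase : ∀ t, (Γ t).1.1 = pencil c z ℓ (γ t) := fun t =>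
    congrArg Subtype.val (congrFun (h.cov.liftPath_lifts (h.basePath γ hγ) p hp) t)
  have hne := fun t => h.rep_ne_zero (hγ t) (hbase t)
  refine ⟨_, ⟨⟨fun t => chartRep ℓ (Γ t).1.2, ?_⟩, ?_, rfl⟩, fun t =>
    ⟨hγ t, chartRep_mem h.hom (hbase t) (hne t)⟩⟩
  · exact (continuousOn_chartRep ℓ).comp_continuous
      (continuous_snd.comp (continuous_subtype_val.comp Γ.continuous)) hne
  · change chartRep ℓ (Γ 0).1.2 = y
    rw [h.cov.liftPath_zero]
    exact chartRep_incidencePoint h.hom hy (incident_of_mem (h.eval_ne_zero w hw) hy)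

lemma lift_unique (h : GoodPencil J D c z ℓ e) {γ : Path w w'} {y y₁ y₂ : Fin (m + 1) → ℂ}
    (h₁ : Transports (chart J ℓ) (fun i y => ∑ j, c i j * y j) (fun y => ∑ j, z j * y j) e γ y y₁)
    (h₂ : Transports (chart J ℓ) (fun i y => ∑ j, c i j * y j) (fun y => ∑ j, z j * y j) e γ y y₂) :
    y₁ = y₂ := by
  obtain ⟨Γ₁, hΓ₁⟩ := h₁
  obtain ⟨Γ₂, hΓ₂⟩ := h₂
  have hI₁ := fun t => incident_of_mem (h.eval_ne_zero _ (hΓ₁ t).1) (hΓ₁ t).2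
  have hI₂ := fun t => incident_of_mem (h.eval_ne_zero _ (hΓ₂ t).1) (hΓ₂ t).2
  have hcont := (continuous_pencil c z ℓ).comp γ.continuous
  have key := h.cov.eq_of_comp_eq (continuous_incidencePoint h.hom hcont Γ₁.continuous hI₁)
    (continuous_incidencePoint h.hom hcont Γ₂.continuous hI₂) rfl 0
    (by
      refine Subtype.ext (Prod.ext rfl ?_)
      change Projectivization.mk ℂ (Γ₁ 0) _ = Projectivization.mk ℂ (Γ₂ 0) _
      simp only [Path.source])
  have h1 := congrArg (fun p : IncidenceU k m J D => chartRep ℓ p.1.2) (congrFun key 1)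
  have e₁ : chartRep ℓ (incidencePoint h.hom (hI₁ 1)).1.2 = Γ₁ 1 :=
    chartRep_incidencePoint h.hom (hΓ₁ 1).2 (hI₁ 1)
  have e₂ : chartRep ℓ (incidencePoint h.hom (hI₂ 1)).1.2 = Γ₂ 1 :=
    chartRep_incidencePoint h.hom (hΓ₂ 1).2 (hI₂ 1)
  rw [← Γ₁.target, ← Γ₂.target, ← e₁, ← e₂]
  exact h1

end GoodPencil

section Pencil

variable {m k : ℕ} {J : Ideal (MvPolynomial (Fin (m + 1)) ℂ)}
  {D : MvPolynomial (Fin k × Fin (m + 1)) ℂ} {c : Fin k → Fin (m + 1) → ℂ}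
  {z ℓ : Fin (m + 1) → ℂ}

lemma pencil_zero (c : Fin k → Fin (m + 1) → ℂ) (z ℓ : Fin (m + 1) → ℂ) :
    pencil c z ℓ 0 = c := by
  ext i j
  simp [pencil]

lemma polyFun_sum_mul {n : ℕ} (a : Fin n → ℂ) : PolyFun fun y : Fin n → ℂ => ∑ j, a j * y j :=
  ⟨linearForm a, fun y => (eval_linearForm a y).symm⟩

lemma exists_sliceCovering (hJ : J.IsPrime)
    (hJhom : ∀ g ∈ J, ∀ i : ℕ, homogeneousComponent i g ∈ J)
    (hcov : IsCoveringMap (rho1 k m J D)) (hD : eval (fun ij => c ij.1 ij.2) D ≠ 0)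
    (hc : ∀ y ∈ affineCone J, (∀ i, ∑ j, c i j * y j = 0) → ∑ j, ℓ j * y j = 0 → y = 0) :
    ∃ e, GoodPencil J D c z ℓ e ∧
      SliceCovering (chart J ℓ) (fun i y => ∑ j, c i j * y j) (fun y => ∑ j, z j * y j) e := by
  obtain ⟨κ, N, a, hκ, ha, hκ0, hrel⟩ := exists_elimination hJhom c z ℓ hc
  obtain ⟨C, hC, hbound⟩ := exists_bound_linearForm hJhom c z ℓ hc
  have hpoly : PolyFun fun w => eval (fun ij : Fin k × Fin (m + 1) => pencil c z ℓ w ij.1 ij.2) D :=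
    (PolyFun.eval D).comp fun ij => ((PolyFun.const _).add
      ((PolyFun.coord _).mul (PolyFun.const _))).add ((PolyFun.coord _).mul (PolyFun.const _))
  have hg : GoodPencil J D c z ℓ fun w => eval (fun ij => pencil c z ℓ w ij.1 ij.2) D * κ w :=
    ⟨hJhom, hcov, hpoly.mul hκ, fun w hw => left_ne_zero_of_mul hw,
      fun w hw y hy hy0 hs => (hrel w (right_ne_zero_of_mul hw) y hy hy0 hs).1⟩
  refine ⟨_, hg, ?_⟩
  exact {
    irr := fun φ ψ hφ hψ hφ0 hψ0 => chart_irreducible hJ hJhom ℓ hφ hψ hφ0 hψ0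
    polyFun_x := fun i => polyFun_sum_mul (c i)
    polyFun_z := polyFun_sum_mul z
    polyFun_e := hg.polyFun_e
    e_zero := by
      rw [pencil_zero, hκ0, mul_one]
      exact hD
    finite := fun w hw => hg.finite hw
    sections := fun w hw => hg.sections hw
    lift := fun γ hγ y hy => hg.lift γ hγ hy
    lift_unique := fun γ => hg.lift_unique
    relation := by
      refine ⟨κ, N, a, hκ, ha, fun w hw => ⟨right_ne_zero_of_mul hw, fun y hy => ?_⟩⟩
      have hI := incident_of_mem (hg.eval_ne_zero w hw) hy
      exact (hrel w (right_ne_zero_of_mul hw) y hI.2 hI.3 hI.4).2 hy.1.2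
    bound := by
      refine ⟨C, hC, fun y hy => ?_⟩
      have := hbound y hy.1
      rwa [hy.2, norm_one] at this }

/-- Given finitely many projective points, there are linear forms `ℓ` and `z` such that `ℓ`
vanishes at none of them and `z / ℓ` separates them. -/
lemma exists_separating_linearForms {ι : Type*} [Finite ι]
    (y : ι → Projectivization ℂ (Fin (m + 1) → ℂ)) (hy : Function.Injective y) :
    ∃ ℓ z : Fin (m + 1) → ℂ, (∀ i, ∑ j, ℓ j * (y i).rep j ≠ 0) ∧
      Function.Injective fun i => ∑ j, z j * chartRep ℓ (y i) j := by
  have hcoef : ∀ {κ : Type _} [Finite κ] (v : κ → Fin (m + 1) → ℂ), (∀ i, v i ≠ 0) →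
      ∃ a : Fin (m + 1) → ℂ, ∀ i, ∑ j, a j * v i j ≠ 0 := by
    intro κ _ v hv
    obtain ⟨f, hf⟩ := Module.exists_dual_forall_apply_ne_zero (K := ℂ) v hv
    refine ⟨fun j => f (Pi.single j 1), fun i => ?_⟩
    have : ∑ j, f (Pi.single j 1) * v i j = f (v i) := by
      conv_rhs => rw [pi_eq_sum_univ' (v i), map_sum]
      refine Finset.sum_congr rfl fun j _ => ?_
      rw [map_smul, smul_eq_mul, mul_comm]
    rw [this]
    exact hf i
  obtain ⟨ℓ, hℓ⟩ := hcoef (fun i => (y i).rep) fun i => (y i).rep_nonzero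
  obtain ⟨z, hz⟩ := hcoef
    (fun ij : {ij : ι × ι // ij.1 ≠ ij.2} => chartRep ℓ (y ij.1.1) - chartRep ℓ (y ij.1.2))
    fun ⟨⟨i, i'⟩, hii⟩ heq => hii <| hy <| by
      have h1 := sub_eq_zero.1 heq
      change (∑ j, ℓ j * (y i).rep j)⁻¹ • (y i).rep = (∑ j, ℓ j * (y i').rep j)⁻¹ • (y i').rep at h1
      rw [← (y i).mk_rep, ← (y i').mk_rep, Projectivization.mk_eq_mk_iff']
      refine ⟨(∑ j, ℓ j * (y i).rep j) * (∑ j, ℓ j * (y i').rep j)⁻¹, ?_⟩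
      rw [mul_smul, ← h1, smul_smul, mul_inv_cancel₀ (hℓ i), one_smul]
  refine ⟨ℓ, z, hℓ, fun i i' heq => by_contra fun hii => hz ⟨(i, i'), hii⟩ ?_⟩
  simpa [mul_sub, sub_eq_zero] using heq

end Pencil

section Fiber

variable {m k : ℕ} {J : Ideal (MvPolynomial (Fin (m + 1)) ℂ)}
  {D : MvPolynomial (Fin k × Fin (m + 1)) ℂ} {z ℓ : Fin (m + 1) → ℂ}

lemma incident_of_mem_zero {c : Fin k → Fin (m + 1) → ℂ}
    (hD : eval (fun ij => c ij.1 ij.2) D ≠ 0) {y : Fin (m + 1) → ℂ}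
    (hy : y ∈ linearSlice J c z ℓ 0) : Incident J D c y := by
  have := incident_of_mem (D := D) (by rwa [pencil_zero]) hy
  rwa [pencil_zero] at this

/-- The linear slice of parameter `0` is the fiber of the incidence covering over the base point
of the pencil. -/
def sliceEquivFiber (hJhom : ∀ g ∈ J, ∀ i : ℕ, homogeneousComponent i g ∈ J) (c₀ : Uopen k m D)
    (hℓ : ∀ p : {x : IncidenceU k m J D // rho1 k m J D x = c₀}, ∑ j, ℓ j * p.1.1.2.rep j ≠ 0) :
    linearSlice J c₀.1 z ℓ 0 ≃ {x : IncidenceU k m J D // rho1 k m J D x = c₀} where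
  toFun y := ⟨incidencePoint hJhom (incident_of_mem_zero c₀.2 y.2), rfl⟩
  invFun p := ⟨chartRep ℓ p.1.1.2, chartRep_mem hJhom
    (by rw [pencil_zero]; exact congrArg Subtype.val p.2) (hℓ p)⟩
  left_inv y := Subtype.ext
    (chartRep_incidencePoint hJhom y.2 (incident_of_mem_zero c₀.2 y.2))
  right_inv p := by
    have hp : p.1.1.1 = pencil c₀.1 z ℓ 0 := by
      rw [pencil_zero]
      exact congrArg Subtype.val p.2
    have hmem := chartRep_mem hJhom hp (hℓ p)
    have hD : eval (fun ij => pencil c₀.1 z ℓ 0 ij.1 ij.2) D ≠ 0 := by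
      rw [pencil_zero]
      exact c₀.2
    refine Subtype.ext (Eq.trans ?_ (incidencePoint_chartRep hJhom hp (incident_of_mem hD hmem)))
    exact Subtype.ext (Prod.ext (pencil_zero c₀.1 z ℓ).symm rfl)

end Fiber

/-- **Surjectivity of the monodromy homomorphism `π₁(U, L₀) → Sym(L₀ ∩ Ỹ)`.**
Let `Ỹ ⊆ ℙ^m` be an irreducible projective variety of dimension `k` (prime homogeneous ideal
`J`), and `U` the Zariski open subset of `Gr(ℙ^{m−k}, ℙ^m)` over which the incidence projection
`ρ₁` is a `deg Ỹ`-to-1 covering map, with basepoint `L₀ ∈ U`.  Then the monodromy homomorphism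
`π₁(U, L₀) → Sym(L₀ ∩ Ỹ)` is surjective: every permutation `σ` of the fiber `L₀ ∩ Ỹ` is realized
by a loop `γ` at `L₀` in `U`, in the sense that for each fiber point `e` some lift of `γ` runs
from `e` to `σ e`. -/
theorem monodromy_surjective {m k : ℕ}
    (J : Ideal (MvPolynomial (Fin (m + 1)) ℂ)) (hJprime : J.IsPrime)
    (hJhom : ∀ g ∈ J, ∀ i : ℕ, homogeneousComponent i g ∈ J)
    (hdim : ringKrullDim (MvPolynomial (Fin (m + 1)) ℂ ⧸ J) = ((k + 1 : ℕ) : ℕ))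
    (D : MvPolynomial (Fin k × Fin (m + 1)) ℂ)
    (hne : ∃ c : Fin k → Fin (m + 1) → ℂ, eval (fun ij => c ij.1 ij.2) D ≠ 0)
    (hcov : IsCoveringMap (rho1 k m J D))
    (c₀ : Uopen k m D) :
    ∀ σ : Equiv.Perm {x : IncidenceU k m J D // rho1 k m J D x = c₀},
      ∃ γ : Path c₀ c₀,
        ∀ e : {x : IncidenceU k m J D // rho1 k m J D x = c₀},
          ∃ Γ : Path e.1 (σ e).1, ∀ t, rho1 k m J D (Γ t) = γ t := by
  intro σ
  have hfin : Finite {x : IncidenceU k m J D // rho1 k m J D x = c₀} :=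
    finite_fiber hJhom hcov c₀
  obtain ⟨ℓ, z, hℓ, hz⟩ := exists_separating_linearForms
    (fun p : {x : IncidenceU k m J D // rho1 k m J D x = c₀} => p.1.1.2)
    fun p q hpq => Subtype.ext <| Subtype.ext <|
      Prod.ext (congrArg Subtype.val (p.2.trans q.2.symm)) hpq
  have hc : ∀ y ∈ affineCone J, (∀ i, ∑ j, c₀.1 i j * y j = 0) → ∑ j, ℓ j * y j = 0 → y = 0 := by
    intro y hy hy0 hyℓ
    by_contra hne0
    obtain ⟨a, ha⟩ := Projectivization.exists_smul_eq_mk_rep ℂ y hne0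
    refine hℓ ⟨incidencePoint hJhom ⟨c₀.2, hy, hne0, hy0⟩, rfl⟩ ?_
    change ∑ j, ℓ j * (Projectivization.mk ℂ y hne0).rep j = 0
    rw [← ha, Units.smul_def, sum_mul_smul, hyℓ, mul_zero]
  obtain ⟨E, hE, A⟩ := exists_sliceCovering (z := z) hJprime hJhom hcov c₀.2 hc
  let φ := sliceEquivFiber (z := z) hJhom c₀ hℓ
  have hinj : Set.InjOn (fun y : Fin (m + 1) → ℂ => ∑ j, z j * y j) (linearSlice J c₀.1 z ℓ 0) := by
    intro y hy y' hy' heq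
    have h1 : ∀ y : linearSlice J c₀.1 z ℓ 0, chartRep ℓ (φ y).1.1.2 = y := fun y =>
      congrArg Subtype.val (φ.symm_apply_apply y)
    have h2 : φ ⟨y, hy⟩ = φ ⟨y', hy'⟩ := hz (by simpa only [h1] using heq)
    exact congrArg Subtype.val (φ.injective h2)
  have hτ : (φ.trans σ).trans φ.symm ∈ A.monodromyGroup := by
    rw [A.monodromyGroup_eq_top hinj]
    exact Subgroup.mem_top _
  obtain ⟨γ, hγ, hΓ⟩ := hτ
  have hbase : ∀ t (h : γ t = 0), hE.basePath γ hγ t = c₀ := fun t h => Subtype.ext <| by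
    change pencil c₀.1 z ℓ (γ t) = c₀.1
    rw [h, pencil_zero]
  refine ⟨⟨hE.basePath γ hγ, hbase 0 γ.source, hbase 1 γ.target⟩, fun p => ?_⟩
  obtain ⟨Γ, hΓ'⟩ := hΓ (φ.symm p)
  have hI := fun t => incident_of_mem (hE.eval_ne_zero _ (hΓ' t).1) (hΓ' t).2
  have hend : ∀ t (h : γ t = 0) (y : linearSlice J c₀.1 z ℓ 0), Γ t = y →
      incidencePoint hJhom (hI t) = (φ y).1 := fun t h y hy => by
    refine Subtype.ext (Prod.ext (congrArg Subtype.val (hbase t h)) ?_)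
    change Projectivization.mk ℂ (Γ t) _ = Projectivization.mk ℂ y.1 _
    simp only [hy]
  refine ⟨⟨⟨fun t => incidencePoint hJhom (hI t), continuous_incidencePoint hJhom
    ((continuous_pencil c₀.1 z ℓ).comp γ.continuous) Γ.continuous hI⟩, ?_, ?_⟩, fun t => rfl⟩
  · exact (hend 0 γ.source _ Γ.source).trans (by rw [φ.apply_symm_apply])
  · exact (hend 1 γ.target _ Γ.target).trans (by simp)

end
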